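/- Lower bound in the main theorem (dilute Fermi gas): Fix an integer q ≥ 1 and a potential v with scattering length a_v as in the context. For every ε > 0 there exists ρ₀ > 0 such that for all 0 < ρ < ρ₀, liminf_{L→∞} E(⌊ρL³⌋, L)/L³ ≥ (3/5)(6π²/q)^{2/3} ρ^{5/3} + 4π(1 − 1/q) a_v ρ² − ε ρ². -/

import Mathlib

/-!
STATEMENT 0: Lower bound in the main theorem (dilute Fermi gas).
For a nonnegative, bounded, measurable, radial, compactly supported pair
potential `v` with scattering length `a`, and `q ≥ 1` spin states:
for every `ε > 0` there is `ρ₀ > 0` such that for all `0 < ρ < ρ₀`,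
`liminf_{L→∞} E(⌊ρL³⌋, L)/L³
   ≥ (3/5)(6π²/q)^{2/3} ρ^{5/3} + 4π(1 - 1/q) a ρ² - ε ρ²`.

The ground state energy `E(N,L)` is the infimum of the energy quadratic form
over normalized antisymmetric wave functions `Ψ(x₁,σ₁,…,x_N,σ_N)` with each
spin component a smooth function compactly supported in the open box
`(0,L)^{3N}` (a form core for the Dirichlet (H¹₀) realization).
-/

open MeasureTheory Real Filter
open scoped RealInnerProductSpace

noncomputable section

abbrev R3 := EuclideanSpace ℝ (Fin 3)

/-- `|∇f|²(x) = ∑_j |∂_j f(x)|²` for a complex-valued function on ℝ³. -/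
def gradSq (f : R3 → ℂ) (x : R3) : ℝ :=
  ∑ j : Fin 3, ‖fderiv ℝ f x (EuclideanSpace.single j 1)‖ ^ 2

/-- The open cube `(0,L)³`. -/
def openCube (L : ℝ) : Set R3 := {x | ∀ j, x j ∈ Set.Ioo 0 L}

/-- Admissible `N`-fermion wave functions with `q` spin states in the box `[0,L]³`:
each spin component smooth with (compact) support inside the open box (Dirichlet
boundary conditions), totally antisymmetric under simultaneous exchange of
position-spin pairs, and normalized in `L²`. -/
def IsFermionicState (N q : ℕ) (L : ℝ)
    (Ψ : (Fin N → R3) → (Fin N → Fin q) → ℂ) : Prop :=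
  (∀ σ, ContDiff ℝ (⊤ : ℕ∞) (fun X => Ψ X σ)) ∧
  (∀ σ, tsupport (fun X => Ψ X σ) ⊆ {X | ∀ i, X i ∈ openCube L}) ∧
  (∀ (i j : Fin N), i ≠ j → ∀ X σ,
      Ψ (X ∘ Equiv.swap i j) (σ ∘ Equiv.swap i j) = - Ψ X σ) ∧
  (∑ σ : Fin N → Fin q, ∫ X : Fin N → R3, ‖Ψ X σ‖ ^ 2) = 1

/-- The energy `Q(Ψ)` of a wave function: kinetic energy plus interaction. -/
def energyForm (N q : ℕ) (v : R3 → ℝ)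
    (Ψ : (Fin N → R3) → (Fin N → Fin q) → ℂ) : ℝ :=
  ∑ σ : Fin N → Fin q, ∫ X : Fin N → R3,
    ((∑ i, gradSq (fun y => Ψ (Function.update X i y) σ) (X i)) +
      ∑ i, ∑ j, if i < j then v (X i - X j) * ‖Ψ X σ‖ ^ 2 else 0)

/-- The ground state energy `E(N,L)`. -/
def groundEnergy (N q : ℕ) (L : ℝ) (v : R3 → ℝ) : ℝ :=
  sInf {E | ∃ Ψ, IsFermionicState N q L Ψ ∧ energyForm N q v Ψ = E}

open FourierTransform in
theorem fourier_ae_eq_Lp_fourier {f : R3 → ℂ} (hf1 : Integrable f) (hf2 : MemLp f 2) :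
    𝓕 f =ᵐ[volume] (𝓕 (hf2.toLp f) : Lp (α := R3) ℂ 2) := by
  have hcont : Continuous (𝓕 f) :=
    VectorFourier.fourierIntegral_continuous continuous_fourierChar
      (by exact continuous_inner) hf1
  refine ae_eq_of_integral_contDiff_smul_eq hcont.locallyIntegrable
    ((Lp.memLp _).locallyIntegrable (by norm_num)) fun g hg hgc => ?_
  let G : SchwartzMap R3 ℂ := HasCompactSupport.toSchwartzMap (f := fun x => (g x : ℂ))
    (hgc.comp_left (g := fun t : ℝ => (t : ℂ)) (by simp))
    (Complex.ofRealCLM.contDiff.comp hg)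
  have hG : ∀ x, G x = (g x : ℂ) := fun x => rfl
  have h1 := DFunLike.congr_fun (Lp.fourier_toTemperedDistribution_eq (hf2.toLp f)) G
  rw [TemperedDistribution.fourier_apply, Lp.toTemperedDistribution_apply,
    Lp.toTemperedDistribution_apply] at h1
  have h2 : ∀ F : Lp (α := R3) ℂ 2 volume, ∫ x, g x • F x = ∫ x, G x • F x := by
    intro F
    congr with x
  rw [h2, ← h1]
  have h3 : ∫ x, (𝓕 G) x • (hf2.toLp f) x = ∫ x, (𝓕 G) x • f x := by
    apply integral_congr_ae
    filter_upwards [hf2.coeFn_toLp] with x hx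
    rw [hx]
  rw [h3]
  have h4 := VectorFourier.integral_fourierIntegral_smul_eq_flip (μ := (volume : Measure R3))
    (ν := (volume : Measure R3)) (L := innerₗ R3) (f := f) (g := G) continuous_fourierChar
    (by exact continuous_inner) hf1 G.integrable
  have h5 : ∫ x, g x • 𝓕 f x = ∫ x, 𝓕 f x • G x := by
    congr with x
    rw [hG, smul_eq_mul, mul_comm]; simp
  rw [h5]
  refine h4.trans ?_
  congr with x
  rw [smul_eq_mul, smul_eq_mul, mul_comm, SchwartzMap.fourier_coe, flip_innerₗ]
  rfl

open FourierTransform in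
theorem memLp_fourier {f : R3 → ℂ} (hf1 : Integrable f) (hf2 : MemLp f 2) :
    MemLp (𝓕 f) 2 :=
  (memLp_congr_ae (fourier_ae_eq_Lp_fourier hf1 hf2)).2 (Lp.memLp _)

theorem integral_norm_sq_eq_norm_toLp_sq {f : R3 → ℂ} (hf : MemLp f 2) :
    ∫ x, ‖f x‖ ^ 2 = ‖hf.toLp f‖ ^ 2 := by
  rw [← @inner_self_eq_norm_sq ℂ, L2.inner_def]
  have : ∫ x, inner ℂ (hf.toLp f x) (hf.toLp f x) = ∫ x, ((‖f x‖ ^ 2 : ℝ) : ℂ) := by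
    apply integral_congr_ae
    filter_upwards [hf.coeFn_toLp] with x hx
    rw [hx, inner_self_eq_norm_sq_to_K]; simp
  rw [this, integral_complex_ofReal]; simp

open FourierTransform in
/-- Plancherel's identity for functions in `L¹ ∩ L²`. -/
theorem integral_norm_sq_fourier_eq {f : R3 → ℂ} (hf1 : Integrable f) (hf2 : MemLp f 2) :
    ∫ p, ‖𝓕 f p‖ ^ 2 = ∫ x, ‖f x‖ ^ 2 := by
  rw [integral_norm_sq_eq_norm_toLp_sq hf2, ← Lp.norm_fourier_eq,
    integral_norm_sq_eq_norm_toLp_sq (memLp_fourier hf1 hf2)]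
  congr 2
  apply Lp.ext
  exact (MemLp.coeFn_toLp _).trans (fourier_ae_eq_Lp_fourier hf1 hf2)

open FourierTransform in
theorem memLp_fourierInv {f : R3 → ℂ} (hf1 : Integrable f) (hf2 : MemLp f 2) :
    MemLp (𝓕⁻ f) 2 := by
  rw [Real.fourierInv_eq_fourier_comp_neg]
  exact memLp_fourier (by exact hf1.comp_neg) (by
    exact hf2.comp_measurePreserving (Measure.measurePreserving_neg volume))

open FourierTransform in
theorem integral_norm_sq_fourierInv_eq {f : R3 → ℂ} (hf1 : Integrable f) (hf2 : MemLp f 2) :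
    ∫ p, ‖𝓕⁻ f p‖ ^ 2 = ∫ x, ‖f x‖ ^ 2 := by
  have h : ∀ p, 𝓕⁻ f p = 𝓕 f (-p) := fun p => Real.fourierInv_eq_fourier_neg f p
  simp_rw [h]
  rw [integral_neg_eq_self (fun p => ‖𝓕 f p‖ ^ 2) volume, integral_norm_sq_fourier_eq hf1 hf2]

theorem norm_integral_mul_sq_le {α : Type*} [MeasurableSpace α] {μ : Measure α} {A B : α → ℂ}
    (hA : MemLp A 2 μ) (hB : MemLp B 2 μ) :
    ‖∫ x, A x * B x ∂μ‖ ^ 2 ≤ (∫ x, ‖A x‖ ^ 2 ∂μ) * ∫ x, ‖B x‖ ^ 2 ∂μ := by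
  have h1 : ‖∫ x, A x * B x ∂μ‖ ≤ ∫ x, ‖A x‖ * ‖B x‖ ∂μ := by
    refine (norm_integral_le_integral_norm _).trans (le_of_eq ?_)
    simp
  have h2 := integral_mul_le_Lp_mul_Lq_of_nonneg (μ := μ) (p := 2) (q := 2)
    (f := fun x => ‖A x‖) (g := fun x => ‖B x‖) (by constructor <;> norm_num)
    (.of_forall fun _ => norm_nonneg _) (.of_forall fun _ => norm_nonneg _)
    (by simpa using hA.norm) (by simpa using hB.norm)
  have h3 := h1.trans h2
  have hp : ∀ C : α → ℂ, 0 ≤ ∫ x, ‖C x‖ ^ (2:ℝ) ∂μ := fun C =>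
    integral_nonneg fun x => by positivity
  calc _ ≤ ((∫ x, ‖A x‖ ^ (2:ℝ) ∂μ) ^ (1/2:ℝ) * (∫ x, ‖B x‖ ^ (2:ℝ) ∂μ) ^ (1/2:ℝ)) ^ 2 := by
        gcongr
    _ = _ := by
      rw [mul_pow, ← Real.rpow_natCast, ← Real.rpow_natCast, ← Real.rpow_mul (hp A),
        ← Real.rpow_mul (hp B)]
      norm_num

open FourierTransform in
theorem fourierInv_finset_sum {ι : Type*} (s : Finset ι) (c : ι → ℂ) (f : ι → R3 → ℂ)
    (hf : ∀ j ∈ s, Integrable (f j)) (p : R3) :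
    𝓕⁻ (fun x => ∑ j ∈ s, c j * f j x) p = ∑ j ∈ s, c j * 𝓕⁻ (f j) p := by
  simp only [Real.fourierInv_eq]
  simp_rw [Finset.smul_sum]
  rw [integral_finsetSum]
  · refine Finset.sum_congr rfl fun j hj => ?_
    rw [← integral_const_mul]
    congr with x
    simp only [Circle.smul_def, smul_eq_mul]; ring
  · intro j hj
    have := ((Real.fourierIntegral_convergent_iff (-p)).2 (hf j hj)).const_mul (c j)
    refine this.congr (.of_forall fun x => ?_)
    simp only [Circle.smul_def, smul_eq_mul, inner_neg_right, neg_neg]; ring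

open FourierTransform in
/-- A Bessel inequality for translates, with disjoint supports, of a fixed profile. -/
theorem sum_norm_sq_integral_fourierInv_translate_le {ι : Type*} (s : Finset ι) (y : ι → R3)
    {R : ℝ} (hy : ∀ j ∈ s, ∀ k ∈ s, j ≠ k → 2 * R ≤ ‖y j - y k‖)
    {η : R3 → ℝ} (hηc : Continuous η) (hηR : ∀ x, R ≤ ‖x‖ → η x = 0)
    {F : R3 → ℂ} (hF : MemLp F 2) :
    ∑ j ∈ s, ‖∫ p, 𝓕⁻ (fun x => (η (x - y j) : ℂ)) p * F p‖ ^ 2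
      ≤ (∫ x, η x ^ 2) * ∫ p, ‖F p‖ ^ 2 := by
  have hcs : HasCompactSupport η := HasCompactSupport.of_support_subset_isCompact
    (isCompact_closedBall (0:R3) R) fun x hx => by
      by_contra h
      simp only [Metric.mem_closedBall, dist_zero_right, not_le] at h
      exact hx (hηR x h.le)
  have hsq : Integrable (fun x : R3 => η x ^ 2) := by
    have h2 : HasCompactSupport (fun x : R3 => η x ^ 2) :=
      hcs.comp_left (g := fun t : ℝ => t ^ 2) (by norm_num)
    exact Continuous.integrable_of_hasCompactSupport (hηc.pow 2) h2
  set f : ι → R3 → ℂ := fun j x => (η (x - y j) : ℂ) with hf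
  have hfc : ∀ j, Continuous (f j) := fun j =>
    Complex.continuous_ofReal.comp (hηc.comp (continuous_id.sub continuous_const))
  have hfs : ∀ j, HasCompactSupport (f j) := fun j =>
    (hcs.comp_homeomorph (Homeomorph.subRight (y j))).comp_left (g := fun t : ℝ => (t : ℂ)) (by simp)
  have hf1 : ∀ j, Integrable (f j) := fun j => (hfc j).integrable_of_hasCompactSupport (hfs j)
  have hf2 : ∀ j, MemLp (f j) 2 := fun j => (hfc j).memLp_of_hasCompactSupport (hfs j)
  set I : ι → ℂ := fun j => ∫ p, 𝓕⁻ (f j) p * F p with hI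
  set c : ι → ℂ := fun j => (starRingEnd ℂ) (I j) with hc
  set g : R3 → ℂ := fun x => ∑ j ∈ s, c j * f j x with hg
  have hg1 : Integrable g := integrable_finsetSum _ fun j _ => (hf1 j).const_mul _
  have hg2 : MemLp g 2 := memLp_finsetSum _ fun j _ => (hf2 j).const_mul _
  set S := ∑ j ∈ s, ‖I j‖ ^ 2 with hS
  have hS0 : 0 ≤ S := by positivity
  have e1 : (S : ℂ) = ∫ p, 𝓕⁻ g p * F p := by
    have : ∀ p, 𝓕⁻ g p * F p = ∑ j ∈ s, c j * (𝓕⁻ (f j) p * F p) := by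
      intro p
      rw [hg, fourierInv_finset_sum s c f (fun j _ => hf1 j), Finset.sum_mul]
      exact Finset.sum_congr rfl fun j _ => by ring
    simp_rw [this]
    rw [integral_finsetSum]
    · rw [hS]
      push_cast
      refine Finset.sum_congr rfl fun j _ => ?_
      rw [integral_const_mul, hc]
      simp only
      rw [Complex.conj_mul']
    · intro j _
      exact ((memLp_fourierInv (hf1 j) (hf2 j)).integrable_mul hF).const_mul _
  have e2 : ∫ x, ‖g x‖ ^ 2 = S * ∫ x, η x ^ 2 := by
    have : ∀ x, ‖g x‖ ^ 2 = ∑ j ∈ s, ‖I j‖ ^ 2 * η (x - y j) ^ 2 := by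
      intro x
      by_cases h : ∃ j ∈ s, η (x - y j) ≠ 0
      · obtain ⟨j, hj, hjx⟩ := h
        have h0 : ∀ k ∈ s, k ≠ j → η (x - y k) = 0 := by
          intro k hk hkj
          by_contra hne
          have a1 : ‖x - y j‖ < R := by
            by_contra! hh; exact hjx (hηR _ hh)
          have a2 : ‖x - y k‖ < R := by
            by_contra! hh; exact hne (hηR _ hh)
          have a3 := hy j hj k hk hkj.symm
          have a4 : ‖y j - y k‖ ≤ ‖x - y k‖ + ‖x - y j‖ := by
            have := norm_sub_le (x - y k) (x - y j)
            simpa using this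
          linarith
        rw [hg]
        simp only
        rw [Finset.sum_eq_single_of_mem j hj, Finset.sum_eq_single_of_mem j hj]
        · simp [hf, hc, mul_pow]
        · intro k hk hkj; rw [h0 k hk hkj]; simp
        · intro k hk hkj; simp [hf, h0 k hk hkj]
      · push Not at h
        rw [Finset.sum_eq_zero (fun j hj => by rw [h j hj]; simp)]
        rw [hg]
        simp only
        rw [Finset.sum_eq_zero (fun j hj => by simp [hf, h j hj])]
        simp
    simp_rw [this]
    rw [integral_finsetSum, hS, Finset.sum_mul]
    · refine Finset.sum_congr rfl fun j _ => ?_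
      rw [integral_const_mul, integral_sub_right_eq_self (fun x => η x ^ 2)]
    · intro j _
      refine Integrable.const_mul ?_ _
      exact hsq.comp_sub_right (y j)
  have e3 := norm_integral_mul_sq_le (memLp_fourierInv hg1 hg2) hF
  rw [← e1, integral_norm_sq_fourierInv_eq hg1 hg2, e2, Complex.norm_real, Real.norm_eq_abs,
    sq_abs] at e3
  rcases hS0.eq_or_lt with h | h
  · rw [← h]
    exact mul_nonneg (integral_nonneg fun _ => by positivity)
      (integral_nonneg fun _ => by positivity)
  · have : S * S ≤ S * ((∫ x, η x ^ 2) * ∫ p, ‖F p‖ ^ 2) := by nlinarith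
    exact le_of_mul_le_mul_left this h

/-- The radial profile `s` of the vector field `x s(‖x‖²)` which equals `x / ‖x‖³` outside the
unit ball. -/
def fieldProfile (t : ℝ) : ℝ := if t ≤ 1 then (5 - 3 * t) / 2 else t ^ (-(3 / 2) : ℝ)

/-- The derivative of `fieldProfile`. -/
def fieldProfileDeriv (t : ℝ) : ℝ := if t ≤ 1 then -(3 / 2) else -(3 / 2) * t ^ (-(5 / 2) : ℝ)

/-- The radial profile of a regularisation of `1 / ‖x‖`, as a function of `‖x‖²`. -/
def potProfile (t : ℝ) : ℝ :=
  if t ≤ 1 then 1 - (t - 1) / 2 + 3 / 8 * (t - 1) ^ 2 else t ^ (-(1 / 2) : ℝ)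

theorem hasDerivAt_ite_le_one {f g f' g' : ℝ → ℝ} (hf : ∀ t, HasDerivAt f (f' t) t)
    (hg : ∀ t, 0 < t → HasDerivAt g (g' t) t) (h1 : f 1 = g 1) (h2 : f' 1 = g' 1) (t : ℝ) :
    HasDerivAt (fun t => if t ≤ 1 then f t else g t) (if t ≤ 1 then f' t else g' t) t := by
  rcases lt_trichotomy t 1 with h | h | h
  · rw [if_pos h.le]
    refine (hf t).congr_of_eventuallyEq ?_
    filter_upwards [Iio_mem_nhds h] with x hx
    rw [if_pos (le_of_lt hx)]
  · subst h
    rw [if_pos le_rfl]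
    have a1 : HasDerivWithinAt (fun t => if t ≤ 1 then f t else g t) (f' 1) (Set.Iic 1) 1 :=
      (hf 1).hasDerivWithinAt.congr (fun x hx => if_pos hx) (if_pos le_rfl)
    have a2 : HasDerivWithinAt (fun t => if t ≤ 1 then f t else g t) (f' 1) (Set.Ici 1) 1 := by
      rw [h2]
      refine (hg 1 one_pos).hasDerivWithinAt.congr (fun x hx => ?_) (by simp [h1])
      rcases (show (1:ℝ) ≤ x from hx).eq_or_lt with hh | hh
      · rw [← hh]; simp [h1]
      · exact if_neg (not_le.2 hh)
    have := a1.union a2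
    rwa [Set.Iic_union_Ici, hasDerivWithinAt_univ] at this
  · rw [if_neg (not_le.2 h)]
    refine (hg t (by linarith)).congr_of_eventuallyEq ?_
    filter_upwards [Ioi_mem_nhds h] with x hx
    rw [if_neg (not_le.2 hx)]

theorem hasDerivAt_fieldProfile (t : ℝ) :
    HasDerivAt fieldProfile (fieldProfileDeriv t) t := by
  refine hasDerivAt_ite_le_one (f := fun t => (5 - 3 * t) / 2) (g := fun t => t ^ (-(3 / 2) : ℝ))
    (f' := fun _ => -(3 / 2)) (g' := fun t => -(3 / 2) * t ^ (-(5 / 2) : ℝ)) (fun t => ?_)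
    (fun t ht => ?_) (by norm_num) (by norm_num) t
  · have := (((hasDerivAt_id t).const_mul 3).const_sub 5).div_const 2
    exact this.congr_deriv (by norm_num)
  · convert Real.hasDerivAt_rpow_const (p := -(3 / 2)) (Or.inl ht.ne') using 2; norm_num

theorem hasDerivAt_potProfile (t : ℝ) :
    HasDerivAt potProfile (-(1 / 2) * fieldProfile t) t := by
  have := hasDerivAt_ite_le_one (f := fun t => 1 - (t - 1) / 2 + 3 / 8 * (t - 1) ^ 2)
    (g := fun t => t ^ (-(1 / 2) : ℝ))
    (f' := fun t => -(1 / 2) * ((5 - 3 * t) / 2)) (g' := fun t => -(1 / 2) * t ^ (-(3 / 2) : ℝ))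
    (fun t => ?_) (fun t ht => ?_) (by norm_num) (by norm_num) t
  · unfold fieldProfile
    rw [mul_ite]; exact this
  · have h1 := (hasDerivAt_id t).sub_const 1
    have := ((h1.div_const 2).const_sub 1).add ((h1.pow 2).const_mul (3/8))
    refine this.congr_deriv ?_
    simp; ring
  · convert Real.hasDerivAt_rpow_const (p := -(1 / 2)) (Or.inl ht.ne') using 2; norm_num

theorem continuous_fieldProfile : Continuous fieldProfile :=
  continuous_iff_continuousAt.2 fun t => (hasDerivAt_fieldProfile t).continuousAt

theorem continuous_fieldProfileDeriv : Continuous fieldProfileDeriv := by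
  have h : fieldProfileDeriv = fun t => -(3 / 2) * (max t 1) ^ (-(5 / 2) : ℝ) := by
    ext t
    unfold fieldProfileDeriv
    split_ifs with h
    · rw [max_eq_right h]; simp
    · rw [max_eq_left (le_of_not_ge h)]
  rw [h]
  refine continuous_const.mul (Continuous.rpow_const (by fun_prop) fun x => Or.inl ?_)
  have : (1:ℝ) ≤ max x 1 := le_max_right _ _
  linarith

theorem fieldProfile_div (t : ℝ) :
    3 * fieldProfile t + 2 * t * fieldProfileDeriv t = 15 / 2 * max (1 - t) 0 := by
  unfold fieldProfile fieldProfileDeriv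
  split_ifs with h
  · rw [max_eq_left (by linarith)]; ring
  · push Not at h
    rw [max_eq_right (by linarith)]
    have : t ^ (-(3/2) : ℝ) = t * t ^ (-(5/2) : ℝ) := by
      rw [mul_comm, ← Real.rpow_add_one (by linarith)]; norm_num
    rw [this]; ring

theorem potProfile_nonneg {t : ℝ} : 0 ≤ potProfile t := by
  unfold potProfile
  split_ifs with h
  · nlinarith [sq_nonneg (t - 1)]
  · exact Real.rpow_nonneg (by linarith) _

theorem potProfile_le {t : ℝ} (ht : 0 ≤ t) : potProfile t ≤ 15 / 8 := by
  unfold potProfile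
  split_ifs with h
  · nlinarith [sq_nonneg (t - 1)]
  · have := Real.rpow_le_one_of_one_le_of_nonpos (le_of_not_ge h) (z := -(1/2)) (by norm_num)
    linarith

theorem contDiff_potProfile : ContDiff ℝ 1 potProfile := by
  rw [contDiff_one_iff_deriv]
  refine ⟨fun t => (hasDerivAt_potProfile t).differentiableAt, ?_⟩
  have : deriv potProfile = fun t => -(1 / 2) * fieldProfile t :=
    funext fun t => (hasDerivAt_potProfile t).deriv
  rw [this]
  exact continuous_const.mul continuous_fieldProfile

theorem contDiff_fieldProfile : ContDiff ℝ 1 fieldProfile := by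
  rw [contDiff_one_iff_deriv]
  refine ⟨fun t => (hasDerivAt_fieldProfile t).differentiableAt, ?_⟩
  rw [show deriv fieldProfile = fieldProfileDeriv from
    funext fun t => (hasDerivAt_fieldProfile t).deriv]
  exact continuous_fieldProfileDeriv

/-- A smoothed `1 / ‖x‖`, equal to it for `‖x‖ ≥ R`. -/
def smoothPot (R : ℝ) (x : R3) : ℝ := potProfile (‖x‖ ^ 2 / R ^ 2) / R

/-- The normalised charge density generating `smoothPot`. -/
def charge (R : ℝ) (x : R3) : ℝ := 15 / (8 * π * R ^ 3) * max (1 - ‖x‖ ^ 2 / R ^ 2) 0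

theorem contDiff_smoothPot (R : ℝ) : ContDiff ℝ 1 (smoothPot R) := by
  unfold smoothPot
  exact (contDiff_potProfile.comp ((contDiff_norm_sq ℝ).div_const _)).div_const _

theorem smoothPot_eq {R : ℝ} (hR : 0 < R) {x : R3} (hx : R ≤ ‖x‖) : smoothPot R x = 1 / ‖x‖ := by
  have hx0 : 0 < ‖x‖ := hR.trans_le hx
  unfold smoothPot potProfile
  rw [← div_pow]
  have h1 : 1 ≤ ‖x‖ / R := (one_le_div hR).2 hx
  split_ifs with h
  · have : ‖x‖ / R = 1 := by nlinarith
    rw [this]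
    have h2 : ‖x‖ = R := by field_simp at this; exact this
    rw [h2]; norm_num
  · rw [← Real.rpow_natCast, ← Real.rpow_mul (by positivity)]
    norm_num
    rw [Real.rpow_neg_one]; field_simp

theorem smoothPot_nonneg {R : ℝ} (hR : 0 < R) (x : R3) : 0 ≤ smoothPot R x :=
  div_nonneg potProfile_nonneg hR.le

theorem smoothPot_le {R : ℝ} (hR : 0 < R) (x : R3) : smoothPot R x ≤ 2 / R := by
  unfold smoothPot
  gcongr
  exact (potProfile_le (by positivity)).trans (by norm_num)

theorem fderiv_smoothPot {R : ℝ} (hR : 0 < R) (x w : R3) :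
    fderiv ℝ (smoothPot R) x w = -(⟪x, w⟫ * fieldProfile (‖x‖ ^ 2 / R ^ 2) / R ^ 3) := by
  have h1 : HasFDerivAt (fun x : R3 => ‖x‖ ^ 2 / R ^ 2) ((R ^ 2)⁻¹ • (2 • innerSL ℝ x)) x := by
    simpa [div_eq_inv_mul] using ((hasStrictFDerivAt_norm_sq x).hasFDerivAt.const_mul ((R ^ 2)⁻¹))
  have h2 := ((hasDerivAt_potProfile (‖x‖ ^ 2 / R ^ 2)).comp_hasFDerivAt x h1).const_mul (R⁻¹)
  have h3 : HasFDerivAt (smoothPot R) _ x := h2.congr_of_eventuallyEq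
    (.of_forall fun y => by simp [smoothPot, div_eq_inv_mul])
  rw [h3.fderiv]
  simp
  field_simp

theorem continuous_charge (R : ℝ) : Continuous (charge R) := by
  unfold charge; fun_prop

theorem charge_nonneg {R : ℝ} (hR : 0 < R) (x : R3) : 0 ≤ charge R x := by
  unfold charge; positivity

theorem charge_eq_zero {R : ℝ} (hR : 0 < R) {x : R3} (hx : R ≤ ‖x‖) : charge R x = 0 := by
  unfold charge
  rw [max_eq_right, mul_zero]
  rw [sub_nonpos, ← div_pow, one_le_sq_iff₀ (by positivity)]
  exact (one_le_div hR).2 hx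

theorem hasCompactSupport_charge {R : ℝ} (hR : 0 < R) : HasCompactSupport (charge R) :=
  HasCompactSupport.of_support_subset_isCompact (isCompact_closedBall (0:R3) R) fun x hx => by
    by_contra h
    simp only [Metric.mem_closedBall, dist_zero_right, not_le] at h
    exact hx (charge_eq_zero hR h.le)

theorem integrable_charge {R : ℝ} (hR : 0 < R) : Integrable (charge R) :=
  (continuous_charge R).integrable_of_hasCompactSupport (hasCompactSupport_charge hR)

theorem integral_charge {R : ℝ} (hR : 0 < R) : ∫ x, charge R x = 1 := by
  have h := integral_fun_norm_addHaar (volume : Measure R3)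
    (fun r => 15 / (8 * π * R ^ 3) * max (1 - r ^ 2 / R ^ 2) 0)
  unfold charge
  rw [h]
  have h2 : ∫ y in Set.Ioi (0:ℝ), y ^ (Module.finrank ℝ R3 - 1) •
      (15 / (8 * π * R ^ 3) * max (1 - y ^ 2 / R ^ 2) 0) =
      ∫ y in (0:ℝ)..R, 15 / (8 * π * R ^ 3) * (y ^ 2 - (R ^ 2)⁻¹ * y ^ 4) := by
    rw [intervalIntegral.integral_of_le hR.le]
    rw [← integral_indicator measurableSet_Ioi, ← integral_indicator measurableSet_Ioc]
    congr with y
    by_cases hy : 0 < y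
    · rw [Set.indicator_of_mem (by exact hy)]
      by_cases hyR : y ≤ R
      · rw [Set.indicator_of_mem (by exact ⟨hy, hyR⟩), max_eq_left]
        · simp; ring
        · rw [sub_nonneg, ← div_pow, sq_le_one_iff₀ (by positivity)]
          exact (div_le_one hR).2 hyR
      · rw [Set.indicator_of_notMem (by simp [hyR]), max_eq_right]
        · simp
        · rw [sub_nonpos, ← div_pow, one_le_sq_iff₀ (by positivity)]
          exact (one_le_div hR).2 (le_of_not_ge hyR)
    · rw [Set.indicator_of_notMem (by simpa using hy), Set.indicator_of_notMem]
      simp; intro h; exact absurd h hy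
  rw [h2]
  rw [intervalIntegral.integral_const_mul, intervalIntegral.integral_sub (by simp) (by
    apply Continuous.intervalIntegrable; fun_prop), intervalIntegral.integral_const_mul,
    integral_pow, integral_pow]
  rw [measureReal_def, EuclideanSpace.volume_ball_fin_three]
  simp
  field_simp
  norm_num
  rw [ENNReal.toReal_ofReal (by positivity)]
  ring

theorem integral_charge_sq_le {R : ℝ} (hR : 0 < R) : ∫ x, charge R x ^ 2 ≤ 1 / R ^ 3 := by
  have h1 : ∀ x, charge R x ^ 2 ≤ 1 / R ^ 3 * charge R x := by
    intro x
    have h2 : charge R x ≤ 1 / R ^ 3 := by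
      unfold charge
      have : max (1 - ‖x‖ ^ 2 / R ^ 2) 0 ≤ 1 := by
        apply max_le _ zero_le_one
        have : 0 ≤ ‖x‖ ^ 2 / R ^ 2 := by positivity
        linarith
      calc _ ≤ 15 / (8 * π * R ^ 3) * 1 := by gcongr
        _ ≤ 1 / R ^ 3 := by
          rw [mul_one, div_le_div_iff₀ (by positivity) (by positivity)]
          have := pi_gt_three
          have : 0 < R ^ 3 := by positivity
          nlinarith
    rw [sq]
    exact mul_le_mul_of_nonneg_right h2 (charge_nonneg hR x)
  calc _ ≤ ∫ x, 1 / R ^ 3 * charge R x := by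
        apply integral_mono _ ((integrable_charge hR).const_mul _) h1
        refine Continuous.integrable_of_hasCompactSupport ((continuous_charge R).pow 2) ?_
        exact (hasCompactSupport_charge hR).comp_left (g := fun t : ℝ => t ^ 2) (by norm_num)
    _ = _ := by rw [integral_const_mul, integral_charge hR, mul_one]

/-- The weak form of `-Δ (smoothPot R) = 4π charge R`. -/
theorem integral_fderiv_smoothPot {R : ℝ} (hR : 0 < R) {g : R3 → ℝ} (hg : ContDiff ℝ 1 g)
    (hgc : HasCompactSupport g) :
    ∫ x, ∑ j, fderiv ℝ (smoothPot R) x (EuclideanSpace.single j 1) *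
      fderiv ℝ g x (EuclideanSpace.single j 1) = 4 * π * ∫ x, charge R x * g x := by
  set F : Fin 3 → R3 → ℝ := fun j x => x j * fieldProfile (‖x‖ ^ 2 / R ^ 2) / R ^ 3 with hF
  have hFe : ∀ j x, fderiv ℝ (smoothPot R) x (EuclideanSpace.single j 1) = - F j x := by
    intro j x
    rw [fderiv_smoothPot hR]
    simp [hF, EuclideanSpace.inner_single_right]
  have hFc : ∀ j, ContDiff ℝ 1 (F j) := by
    intro j
    have : ContDiff ℝ 1 (fun x : R3 => x j) := by fun_prop
    exact (this.mul (contDiff_fieldProfile.comp ((contDiff_norm_sq ℝ).div_const _))).div_const _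
  have hdF : ∀ j x, fderiv ℝ (F j) x (EuclideanSpace.single j 1) =
      (fieldProfile (‖x‖ ^ 2 / R ^ 2) +
        2 * (x j) ^ 2 / R ^ 2 * fieldProfileDeriv (‖x‖ ^ 2 / R ^ 2)) / R ^ 3 := by
    intro j x
    have h1 : HasFDerivAt (fun x : R3 => ‖x‖ ^ 2 / R ^ 2) ((R ^ 2)⁻¹ • (2 • innerSL ℝ x)) x := by
      simpa [div_eq_inv_mul] using ((hasStrictFDerivAt_norm_sq x).hasFDerivAt.const_mul ((R ^ 2)⁻¹))
    have h2 := (hasDerivAt_fieldProfile (‖x‖ ^ 2 / R ^ 2)).comp_hasFDerivAt x h1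
    have h0 : HasFDerivAt (fun x : R3 => x j) (EuclideanSpace.proj j : R3 →L[ℝ] ℝ) x :=
      (EuclideanSpace.proj j : R3 →L[ℝ] ℝ).hasFDerivAt
    have h3 := (h0.mul h2).const_mul ((R ^ 3)⁻¹)
    have h4 : HasFDerivAt (F j) _ x := h3.congr_of_eventuallyEq
      (.of_forall fun y => by simp [hF, div_eq_inv_mul])
    rw [h4.fderiv]
    simp [EuclideanSpace.inner_single_right]
    field_simp
    ring
  have hgd : ∀ j : Fin 3, Continuous fun x => fderiv ℝ g x (EuclideanSpace.single j 1) := fun j =>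
    (hg.continuous_fderiv (by norm_num)).clm_apply continuous_const
  have hgdc : ∀ j : Fin 3, HasCompactSupport fun x => fderiv ℝ g x (EuclideanSpace.single j 1) :=
    fun j => hgc.fderiv_apply (𝕜 := ℝ) _
  have hFd : ∀ j : Fin 3, Continuous fun x => fderiv ℝ (F j) x (EuclideanSpace.single j 1) := fun j =>
    ((hFc j).continuous_fderiv (by norm_num)).clm_apply continuous_const
  have i1 : ∀ j, Integrable fun x => F j x * fderiv ℝ g x (EuclideanSpace.single j 1) := fun j =>
    ((hFc j).continuous.mul (hgd j)).integrable_of_hasCompactSupport ((hgdc j).mul_left)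
  have i2 : ∀ j, Integrable fun x => fderiv ℝ (F j) x (EuclideanSpace.single j 1) * g x := fun j =>
    ((hFd j).mul hg.continuous).integrable_of_hasCompactSupport hgc.mul_left
  have i3 : ∀ j, Integrable fun x => F j x * g x := fun j =>
    ((hFc j).continuous.mul hg.continuous).integrable_of_hasCompactSupport hgc.mul_left
  have ibp : ∀ j, ∫ x, F j x * fderiv ℝ g x (EuclideanSpace.single j 1) =
      - ∫ x, fderiv ℝ (F j) x (EuclideanSpace.single j 1) * g x := fun j =>
    integral_mul_fderiv_eq_neg_fderiv_mul_of_integrable (i2 j) (i1 j) (i3 j)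
      (fun x _ => (hFc j).differentiable (by norm_num) x)
      (fun x _ => hg.differentiable (by norm_num) x)
  simp_rw [hFe, neg_mul]
  simp_rw [Finset.sum_neg_distrib]
  rw [integral_neg, integral_finsetSum _ fun j _ => i1 j]
  simp_rw [ibp]
  rw [Finset.sum_neg_distrib, neg_neg]
  rw [← integral_finsetSum _ fun j _ => i2 j, ← integral_const_mul]
  congr with x
  rw [← Finset.sum_mul, ← mul_assoc]
  congr 1
  simp_rw [hdF]
  rw [← Finset.sum_div, Finset.sum_add_distrib, ← Finset.sum_mul, ← Finset.sum_div,
    ← Finset.mul_sum]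
  have h := fieldProfile_div (‖x‖ ^ 2 / R ^ 2)
  have hn : ∑ i, x i ^ 2 = ‖x‖ ^ 2 := by
    rw [EuclideanSpace.norm_sq_eq]; simp
  rw [hn]
  unfold charge
  have : 4 * π * (15 / (8 * π * R ^ 3) * max (1 - ‖x‖ ^ 2 / R ^ 2) 0) =
    (15 / 2 * max (1 - ‖x‖ ^ 2 / R ^ 2) 0) / R ^ 3 := by field_simp; ring
  rw [this, ← h]
  simp
  ring

/-- The potential `v` has the zero-energy scattering solution `φ` with scattering length `a`. -/
structure IsScatteringSolution (v φ : R3 → ℝ) (R0 a : ℝ) : Prop where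
  R0_pos : 0 < R0
  meas : Measurable v
  nonneg : ∀ x, 0 ≤ v x
  bdd : ∃ C, ∀ x, v x ≤ C
  supp : ∀ x : R3, R0 < ‖x‖ → v x = 0
  contDiff : ContDiff ℝ 1 φ
  sol_nonneg : ∀ x, 0 ≤ φ x
  sol_le_one : ∀ x, φ x ≤ 1
  sol_eq : ∀ x : R3, R0 ≤ ‖x‖ → φ x = 1 - a / ‖x‖
  weak : ∀ g : R3 → ℝ, ContDiff ℝ (⊤ : ℕ∞) g → HasCompactSupport g →
      (∫ x : R3, ⟪gradient φ x, gradient g x⟫) + (1/2) * ∫ x : R3, v x * φ x * g x = 0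

theorem integrable_of_bdd_of_support {w : R3 → ℝ} (hm : Measurable w) {C r : ℝ}
    (hC : ∀ x, |w x| ≤ C) (hs : ∀ x, r < ‖x‖ → w x = 0) : Integrable w := by
  have h : IntegrableOn w (Metric.closedBall 0 r) :=
    Measure.integrableOn_of_bounded (M := C) (isCompact_closedBall (0:R3) r).measure_lt_top.ne
      hm.aestronglyMeasurable (.of_forall fun x => by simpa using hC x)
  refine (integrableOn_iff_integrable_of_support_subset fun x hx => ?_).1 h
  by_contra hh
  simp only [Metric.mem_closedBall, dist_zero_right, not_le] at hh
  exact hx (hs x hh)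

theorem integrable_smul_of_support {E : Type*} [NormedAddCommGroup E] [NormedSpace ℝ E]
    {w : R3 → ℝ} (hw : Integrable w) {r : ℝ} (hs : ∀ x, r < ‖x‖ → w x = 0) {h : R3 → E}
    (hh : Continuous h) : Integrable (fun x => w x • h x) := by
  have h1 : IntegrableOn (fun x => w x • h x) (Metric.closedBall 0 r) :=
    hw.integrableOn.smul_continuousOn hh.continuousOn (isCompact_closedBall (0:R3) r)
  refine (integrableOn_iff_integrable_of_support_subset fun x hx => ?_).1 h1
  by_contra hh
  simp only [Metric.mem_closedBall, dist_zero_right, not_le] at hh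
  exact hx (by simp [hs x hh])

theorem inner_gradient_eq_sum {f g : R3 → ℝ} (x : R3) :
    ⟪gradient f x, gradient g x⟫ = ∑ j, fderiv ℝ f x (EuclideanSpace.single j 1) *
      fderiv ℝ g x (EuclideanSpace.single j 1) := by
  have h : ∀ (u : R3 → ℝ) j, fderiv ℝ u x (EuclideanSpace.single j 1) = gradient u x j := by
    intro u j
    have := InnerProductSpace.toDual_symm_apply (𝕜 := ℝ) (x := EuclideanSpace.single j 1)
      (y := fderiv ℝ u x)
    rw [← this, EuclideanSpace.inner_single_right]
    simp [gradient]
  simp_rw [h, PiLp.inner_apply]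
  simp [mul_comm]

theorem exists_contDiff_approx {ξ : R3 → ℝ} (h1 : ContDiff ℝ 1 ξ) (hc : HasCompactSupport ξ)
    {ε : ℝ} (hε : 0 < ε) : ∃ g : R3 → ℝ, ContDiff ℝ (⊤ : ℕ∞) g ∧ (∀ x, |g x - ξ x| ≤ ε) ∧
      ∀ j x, |fderiv ℝ g x (EuclideanSpace.single j 1) -
        fderiv ℝ ξ x (EuclideanSpace.single j 1)| ≤ ε := by
  have key : ∀ u : R3 → ℝ, Continuous u → HasCompactSupport u →
      ∃ δ > 0, ∀ r, 0 < r → r ≤ δ → ∀ x, ∀ y ∈ Metric.ball x r, dist (u y) (u x) ≤ ε := by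
    intro u hu huc
    obtain ⟨δ, hδ, h⟩ := Metric.uniformContinuous_iff.1 (huc.uniformContinuous_of_continuous hu) ε hε
    exact ⟨δ, hδ, fun r hr hrd x y hy => (h (lt_of_lt_of_le hy hrd)).le⟩
  have hd : ∀ j : Fin 3, Continuous fun x => fderiv ℝ ξ x (EuclideanSpace.single j 1) := fun j =>
    (h1.continuous_fderiv (by norm_num)).clm_apply continuous_const
  have hdc : ∀ j : Fin 3, HasCompactSupport fun x => fderiv ℝ ξ x (EuclideanSpace.single j 1) :=
    fun j => hc.fderiv_apply (𝕜 := ℝ) _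
  obtain ⟨δ0, hδ0, k0⟩ := key ξ h1.continuous hc
  choose δ hδ k using fun j => key _ (hd j) (hdc j)
  set r := min δ0 (Finset.univ.inf' Finset.univ_nonempty δ) with hr
  have hr0 : 0 < r := lt_min hδ0 ((Finset.lt_inf'_iff _).2 fun j _ => hδ j)
  have hr1 : r ≤ δ0 := min_le_left _ _
  have hr2 : ∀ j, r ≤ δ j := fun j => (min_le_right _ _).trans (Finset.inf'_le _ (Finset.mem_univ j))
  let b : ContDiffBump (0 : R3) := ⟨r / 2, r, by linarith, by linarith⟩
  have hb : LocallyIntegrable (b.normed volume) (volume : Measure R3) :=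
    (b.continuous_normed).locallyIntegrable
  refine ⟨(convolution (b.normed volume) ξ (ContinuousLinearMap.lsmul ℝ ℝ) volume), ?_, ?_, ?_⟩
  · exact b.hasCompactSupport_normed.contDiff_convolution_left _ b.contDiff_normed
      h1.continuous.locallyIntegrable
  · intro x
    rw [← Real.dist_eq]
    exact b.dist_normed_convolution_le h1.continuous.aestronglyMeasurable (k0 r hr0 hr1 x)
  · intro j x
    rw [(hc.hasFDerivAt_convolution_right (ContinuousLinearMap.lsmul ℝ ℝ) hb h1 x).fderiv]
    rw [convolution_precompR_apply]
    · rw [← Real.dist_eq]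
      exact b.dist_normed_convolution_le (hd j).aestronglyMeasurable (k j r hr0 (hr2 j) x)
    · exact hb
    · exact hc.fderiv (𝕜 := ℝ)
    · exact h1.continuous_fderiv (by norm_num)

namespace IsScatteringSolution

variable {v φ : R3 → ℝ} {R0 a R : ℝ}

theorem integrable (h : IsScatteringSolution v φ R0 a) : Integrable v := by
  obtain ⟨C, hC⟩ := h.bdd
  exact integrable_of_bdd_of_support h.meas (fun x => by
    rw [abs_of_nonneg (h.nonneg x)]; exact hC x) h.supp

theorem integrable_mul (h : IsScatteringSolution v φ R0 a) : Integrable fun x => v x * φ x := by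
  simpa using integrable_smul_of_support h.integrable h.supp h.contDiff.continuous

/-- `φ - 1 + a m` where `m` is a regularisation of `1 / ‖x‖`. -/
def localSol (φ : R3 → ℝ) (a R : ℝ) (x : R3) : ℝ := φ x - 1 + a * smoothPot R x

theorem contDiff_localSol (h : IsScatteringSolution v φ R0 a) :
    ContDiff ℝ 1 (localSol φ a R) :=
  (h.contDiff.sub contDiff_const).add (contDiff_const.mul (contDiff_smoothPot R))

theorem localSol_eq_zero (h : IsScatteringSolution v φ R0 a) (hR : R0 ≤ R) {x : R3}
    (hx : R ≤ ‖x‖) : localSol φ a R x = 0 := by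
  unfold localSol
  rw [h.sol_eq x (hR.trans hx), smoothPot_eq (h.R0_pos.trans_le hR) hx]
  ring

theorem tsupport_localSol (h : IsScatteringSolution v φ R0 a) (hR : R0 ≤ R) :
    tsupport (localSol φ a R) ⊆ Metric.closedBall 0 R :=
  closure_minimal (fun x hx => by
    by_contra hh
    simp only [Metric.mem_closedBall, dist_zero_right, not_le] at hh
    exact hx (h.localSol_eq_zero hR hh.le)) Metric.isClosed_closedBall

theorem hasCompactSupport_localSol (h : IsScatteringSolution v φ R0 a) (hR : R0 ≤ R) :
    HasCompactSupport (localSol φ a R) :=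
  (isCompact_closedBall (0:R3) R).of_isClosed_subset (isClosed_tsupport _) (h.tsupport_localSol hR)

theorem fderiv_localSol (h : IsScatteringSolution v φ R0 a) (x : R3) :
    fderiv ℝ (localSol φ a R) x = fderiv ℝ φ x + a • fderiv ℝ (smoothPot R) x := by
  have h1 := (h.contDiff.differentiable (by norm_num) x).hasFDerivAt
  have h2 := ((contDiff_smoothPot R).differentiable (by norm_num) x).hasFDerivAt
  exact ((h1.sub_const 1).add (h2.const_mul a)).fderiv

theorem fderiv_localSol_eq_zero (h : IsScatteringSolution v φ R0 a) (hR : R0 ≤ R) {x : R3}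
    (hx : R < ‖x‖) : fderiv ℝ (localSol φ a R) x = 0 := by
  have : localSol φ a R =ᶠ[nhds x] fun _ => 0 := by
    filter_upwards [continuous_norm.continuousAt.eventually (lt_mem_nhds hx)] with y hy
    exact h.localSol_eq_zero hR (le_of_lt hy)
  rw [this.fderiv_eq]
  simp

theorem continuous_fderiv_localSol (h : IsScatteringSolution v φ R0 a) (w : R3) :
    Continuous fun x => fderiv ℝ (localSol φ a R) x w :=
  (h.contDiff_localSol.continuous_fderiv (by norm_num)).clm_apply continuous_const

theorem integrable_fderiv_localSol_mul (h : IsScatteringSolution v φ R0 a) (hR : R0 ≤ R) (w : R3)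
    {g : R3 → ℝ} (hg : Continuous g) :
    Integrable fun x => fderiv ℝ (localSol φ a R) x w * g x :=
  ((h.continuous_fderiv_localSol w).mul hg).integrable_of_hasCompactSupport
    (((h.hasCompactSupport_localSol hR).fderiv_apply (𝕜 := ℝ) w).mul_right)

theorem weak_localSol_of_hasCompactSupport (h : IsScatteringSolution v φ R0 a) (hR : R0 ≤ R)
    {g : R3 → ℝ} (hg : ContDiff ℝ (⊤ : ℕ∞) g) (hgc : HasCompactSupport g) :
    ∫ x, ∑ j, fderiv ℝ (localSol φ a R) x (EuclideanSpace.single j 1) *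
      fderiv ℝ g x (EuclideanSpace.single j 1) =
      -(1/2) * (∫ x, v x * φ x * g x) + 4 * π * a * ∫ x, charge R x * g x := by
  have hg1 : ContDiff ℝ 1 g := hg.of_le (by exact_mod_cast le_top)
  have e1 := integral_fderiv_smoothPot (h.R0_pos.trans_le hR) hg1 hgc
  have e2 := h.weak g hg hgc
  simp_rw [inner_gradient_eq_sum] at e2
  have hgd : ∀ j : Fin 3, Continuous fun x => fderiv ℝ g x (EuclideanSpace.single j 1) := fun j =>
    (hg1.continuous_fderiv (by norm_num)).clm_apply continuous_const
  have hgdc : ∀ j : Fin 3, HasCompactSupport fun x => fderiv ℝ g x (EuclideanSpace.single j 1) :=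
    fun j => hgc.fderiv_apply (𝕜 := ℝ) _
  have int : ∀ u : R3 → ℝ, ContDiff ℝ 1 u → Integrable fun x => ∑ j, fderiv ℝ u x
      (EuclideanSpace.single j 1) * fderiv ℝ g x (EuclideanSpace.single j 1) := fun u hu =>
    integrable_finsetSum _ fun j _ => (((hu.continuous_fderiv (by norm_num)).clm_apply
      continuous_const).mul (hgd j)).integrable_of_hasCompactSupport ((hgdc j).mul_left)
  have e3 : ∫ x, ∑ j, fderiv ℝ (localSol φ a R) x (EuclideanSpace.single j 1) *
      fderiv ℝ g x (EuclideanSpace.single j 1) =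
      (∫ x, ∑ j, fderiv ℝ φ x (EuclideanSpace.single j 1) *
        fderiv ℝ g x (EuclideanSpace.single j 1)) + a *
      ∫ x, ∑ j, fderiv ℝ (smoothPot R) x (EuclideanSpace.single j 1) *
        fderiv ℝ g x (EuclideanSpace.single j 1) := by
    rw [← integral_const_mul, ← integral_add (int _ h.contDiff) ((int _ (contDiff_smoothPot R)).const_mul a)]
    congr with x
    rw [Finset.mul_sum, ← Finset.sum_add_distrib]
    refine Finset.sum_congr rfl fun j _ => ?_
    rw [h.fderiv_localSol]
    simp; ring
  rw [e3, e1]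
  linarith

theorem weak_localSol (h : IsScatteringSolution v φ R0 a) (hR : R0 ≤ R)
    {g : R3 → ℝ} (hg : ContDiff ℝ (⊤ : ℕ∞) g) :
    ∫ x, ∑ j, fderiv ℝ (localSol φ a R) x (EuclideanSpace.single j 1) *
      fderiv ℝ g x (EuclideanSpace.single j 1) =
      -(1/2) * (∫ x, v x * φ x * g x) + 4 * π * a * ∫ x, charge R x * g x := by
  have hR' := h.R0_pos.trans_le hR
  let b : ContDiffBump (0 : R3) := ⟨R + 1, R + 2, by linarith, by linarith⟩
  have hb : ∀ x : R3, ‖x‖ ≤ R → (fun y => b y * g y) =ᶠ[nhds x] g := by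
    intro x hx
    have : Metric.ball (0:R3) (R + 1) ∈ nhds x :=
      Metric.isOpen_ball.mem_nhds (by simp; linarith)
    filter_upwards [this] with y hy
    rw [b.one_of_mem_closedBall (Metric.ball_subset_closedBall hy), one_mul]
  have := h.weak_localSol_of_hasCompactSupport hR (g := fun x => b x * g x) (b.contDiff.mul hg)
    (b.hasCompactSupport.mul_right)
  convert this using 1
  · congr with x
    rcases le_or_gt ‖x‖ R with hx | hx
    · rw [(hb x hx).fderiv_eq]
    · rw [h.fderiv_localSol_eq_zero hR hx]; simp
  · congr 3
    · ext x
      rcases le_or_gt ‖x‖ R with hx | hx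
      · rw [(hb x hx).eq_of_nhds]
      · rw [h.supp x (hR.trans_lt hx)]; simp
    · ext x
      rcases le_or_gt ‖x‖ R with hx | hx
      · rw [(hb x hx).eq_of_nhds]
      · rw [charge_eq_zero hR' hx.le]; simp

theorem integral_mul_eq (h : IsScatteringSolution v φ R0 a) :
    (1/2) * ∫ x, v x * φ x = 4 * π * a := by
  have := h.weak_localSol (le_refl R0) (g := fun _ => 1) contDiff_const
  simp [integral_charge h.R0_pos] at this
  linarith

theorem length_nonneg (h : IsScatteringSolution v φ R0 a) : 0 ≤ a := by
  have h1 := h.integral_mul_eq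
  have h2 : 0 ≤ ∫ x, v x * φ x := integral_nonneg fun x => mul_nonneg (h.nonneg x) (h.sol_nonneg x)
  have := pi_pos
  by_contra! hh
  nlinarith

/-- The energy of the local solution. -/
theorem dirichlet_localSol_le (h : IsScatteringSolution v φ R0 a) (hR : R0 ≤ R) :
    (∫ x, ∑ j, fderiv ℝ (localSol φ a R) x (EuclideanSpace.single j 1) ^ 2) +
      (1/2) * ∫ x, v x * φ x ^ 2 ≤ 4 * π * a * (1 + 2 * a / R) := by
  have hR' := h.R0_pos.trans_le hR
  have hξ := h.contDiff_localSol (R := R)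
  have hξc := h.hasCompactSupport_localSol hR
  set ξ := localSol φ a R with hξdef
  have iv : ∀ g : R3 → ℝ, Continuous g → Integrable fun x => v x * φ x * g x := fun g hg => by
    simpa using integrable_smul_of_support h.integrable_mul (r := R0)
      (fun x hx => by rw [h.supp x hx]; simp) hg
  have ic : ∀ g : R3 → ℝ, Continuous g → Integrable fun x => charge R x * g x := fun g hg =>
    ((continuous_charge R).mul hg).integrable_of_hasCompactSupport
      (hasCompactSupport_charge hR').mul_right
  have a0 := h.length_nonneg
  set A := ∫ x, ∑ j, |fderiv ℝ ξ x (EuclideanSpace.single j 1)| with hA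
  have iA : ∀ j : Fin 3, Integrable fun x => |fderiv ℝ ξ x (EuclideanSpace.single j 1)| := fun j => by
    have := (h.integrable_fderiv_localSol_mul hR (EuclideanSpace.single j 1) (g := fun _ => 1)
      continuous_const).abs
    simpa using this
  have main : ∀ ε : ℝ, 0 < ε → (∫ x, ∑ j, fderiv ℝ ξ x (EuclideanSpace.single j 1) ^ 2) ≤
      (-(1/2) * (∫ x, v x * φ x * ξ x) + 4 * π * a * ∫ x, charge R x * ξ x) +
        ε * (A + 8 * π * a) := by
    intro ε hε
    obtain ⟨g, hg, hg0, hg1⟩ := exists_contDiff_approx hξ hξc hε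
    have w := h.weak_localSol hR hg
    have hgd : ∀ j : Fin 3, Continuous fun x => fderiv ℝ g x (EuclideanSpace.single j 1) := fun j =>
      (hg.continuous_fderiv (by simp)).clm_apply continuous_const
    have d1 : (∫ x, ∑ j, fderiv ℝ ξ x (EuclideanSpace.single j 1) ^ 2) ≤
        (∫ x, ∑ j, fderiv ℝ ξ x (EuclideanSpace.single j 1) *
          fderiv ℝ g x (EuclideanSpace.single j 1)) + ε * A := by
      rw [hA, ← integral_const_mul, ← integral_add]
      · apply integral_mono
        · refine integrable_finsetSum _ fun j _ => ?_
          simpa [sq] using h.integrable_fderiv_localSol_mul hR (EuclideanSpace.single j 1)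
            (h.continuous_fderiv_localSol (EuclideanSpace.single j 1))
        · exact (integrable_finsetSum _ fun j _ => h.integrable_fderiv_localSol_mul hR _ (hgd j)).add
            ((integrable_finsetSum _ fun j _ => iA j).const_mul ε)
        · intro x
          simp only
          rw [Finset.mul_sum, ← Finset.sum_add_distrib]
          refine Finset.sum_le_sum fun j _ => ?_
          have b1 := hg1 j x
          set p := fderiv ℝ ξ x (EuclideanSpace.single j 1)
          set q := fderiv ℝ g x (EuclideanSpace.single j 1)
          have b2 : p * (p - q) ≤ |p| * |p - q| := by rw [← abs_mul]; exact le_abs_self _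
          rw [abs_sub_comm] at b2
          nlinarith [abs_nonneg p]
      · exact integrable_finsetSum _ fun j _ => h.integrable_fderiv_localSol_mul hR _ (hgd j)
      · exact (integrable_finsetSum _ fun j _ => iA j).const_mul ε
    have d2 : (∫ x, v x * φ x * ξ x) ≤ (∫ x, v x * φ x * g x) + ε * ∫ x, v x * φ x := by
      rw [← integral_const_mul, ← integral_add (iv g hg.continuous) (h.integrable_mul.const_mul _)]
      apply integral_mono (iv ξ hξ.continuous) ((iv g hg.continuous).add (h.integrable_mul.const_mul _))
      intro x
      have c1 := (abs_le.1 (hg0 x)).1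
      have c2 := mul_nonneg (h.nonneg x) (h.sol_nonneg x)
      simp only [Pi.add_apply]; nlinarith
    have d3 : (∫ x, charge R x * g x) ≤ (∫ x, charge R x * ξ x) + ε * ∫ x, charge R x := by
      rw [← integral_const_mul, ← integral_add (ic ξ hξ.continuous) ((integrable_charge hR').const_mul _)]
      apply integral_mono (ic g hg.continuous)
        ((ic ξ hξ.continuous).add ((integrable_charge hR').const_mul _))
      intro x
      have c1 := (abs_le.1 (hg0 x)).2
      have c2 := charge_nonneg hR' x
      simp only [Pi.add_apply]; nlinarith
    rw [integral_charge hR'] at d3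
    have e := h.integral_mul_eq
    have d3' := mul_le_mul_of_nonneg_left d3 (show 0 ≤ 4 * π * a by positivity)
    have d2' : -(1/2) * (∫ x, v x * φ x * g x) ≤ -(1/2) * (∫ x, v x * φ x * ξ x) +
      ε * (4 * π * a) := by rw [← e]; linarith
    linarith
  have main' : (∫ x, ∑ j, fderiv ℝ ξ x (EuclideanSpace.single j 1) ^ 2) ≤
      (-(1/2) * (∫ x, v x * φ x * ξ x) + 4 * π * a * ∫ x, charge R x * ξ x) := by
    have hA0 : 0 ≤ A := integral_nonneg fun x => by positivity
    refine le_of_forall_pos_le_add fun ε hε => ?_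
    have := main (ε / (A + 8 * π * a + 1)) (by positivity)
    refine this.trans ?_
    gcongr
    rw [div_mul_eq_mul_div, div_le_iff₀ (by positivity)]
    nlinarith
  have e1 : ∫ x, v x * φ x * ξ x ≥ (∫ x, v x * φ x ^ 2) - ∫ x, v x * φ x := by
    rw [← integral_sub _ h.integrable_mul]
    · apply integral_mono _ (iv ξ hξ.continuous)
      · intro x
        have c2 := mul_nonneg (h.nonneg x) (h.sol_nonneg x)
        have c3 := mul_nonneg a0 (smoothPot_nonneg hR' x)
        simp only [hξdef, localSol]; nlinarith
      · refine Integrable.sub ?_ h.integrable_mul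
        simpa [sq, mul_assoc] using iv φ h.contDiff.continuous
    · simpa [sq, mul_assoc] using iv φ h.contDiff.continuous
  have e2 : ∫ x, charge R x * ξ x ≤ 2 * a / R := by
    calc _ ≤ ∫ x, charge R x * (2 * a / R) := by
          apply integral_mono (ic ξ hξ.continuous) ((integrable_charge hR').mul_const _)
          intro x
          simp only
          refine mul_le_mul_of_nonneg_left ?_ (charge_nonneg hR' x)
          have c1 := h.sol_le_one x
          have c2 := mul_le_mul_of_nonneg_left (smoothPot_le hR' x) a0
          simp only [hξdef, localSol]
          have : a * (2 / R) = 2 * a / R := by ring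
          linarith
      _ = _ := by rw [integral_mul_const, integral_charge hR', one_mul]
  have e2' := mul_le_mul_of_nonneg_left e2 (show 0 ≤ 4 * π * a by positivity)
  have e := h.integral_mul_eq
  linarith

end IsScatteringSolution

theorem sq_le_mul_of_forall_pos {x D E : ℝ} (hx : 0 ≤ x) (hD : 0 ≤ D) (hE : 0 ≤ E)
    (h : ∀ t > 0, 2 * x ≤ t * D + E / t) : x ^ 2 ≤ D * E := by
  rcases hx.eq_or_lt with h0 | h0
  · rw [← h0, zero_pow (by norm_num)]; positivity
  · rcases hD.eq_or_lt with h1 | h1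
    · exfalso
      have := h ((E + 1) / x) (by positivity)
      rw [← h1, mul_zero, zero_add, div_div_eq_mul_div, le_div_iff₀ (by positivity)] at this
      nlinarith
    · have := h (x / D) (by positivity)
      rw [div_mul_cancel₀ _ h1.ne', div_div_eq_mul_div] at this
      have h2 : x ≤ E * D / x := by linarith
      rw [le_div_iff₀ h0] at h2
      nlinarith

namespace IsScatteringSolution

variable {v φ : R3 → ℝ} {R0 a R : ℝ}

/-- The normalised density `v φ / (8π a)`; it exists also when `a = 0`. -/
theorem exists_density (h : IsScatteringSolution v φ R0 a) : ∃ κ : R3 → ℝ, Measurable κ ∧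
    (∀ x, 0 ≤ κ x) ∧ (∃ C, ∀ x, κ x ≤ C) ∧ (∀ x, R0 < ‖x‖ → κ x = 0) ∧ ∫ x, κ x = 1 ∧
    ∀ᵐ x, v x * φ x = 8 * π * a * κ x := by
  have hp := pi_pos
  rcases h.length_nonneg.eq_or_lt with h0 | h0
  · refine ⟨charge R0, (continuous_charge R0).measurable, charge_nonneg h.R0_pos, ?_,
      fun x hx => charge_eq_zero h.R0_pos hx.le, integral_charge h.R0_pos, ?_⟩
    · obtain ⟨C, hC⟩ := (continuous_charge R0).bounded_above_of_compact_support
        (hasCompactSupport_charge h.R0_pos)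
      exact ⟨C, fun x => (le_abs_self _).trans (hC x)⟩
    · have := h.integral_mul_eq
      rw [← h0] at this
      have h1 : ∫ x, v x * φ x = 0 := by linarith
      rw [integral_eq_zero_iff_of_nonneg (fun x => mul_nonneg (h.nonneg x) (h.sol_nonneg x))
        h.integrable_mul] at h1
      filter_upwards [h1] with x hx
      rw [hx, ← h0]; simp
  · obtain ⟨C, hC⟩ := h.bdd
    refine ⟨fun x => v x * φ x / (8 * π * a), ?_, fun x => ?_, ⟨C / (8 * π * a), fun x => ?_⟩,
      fun x hx => ?_, ?_, .of_forall fun x => ?_⟩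
    · exact (h.meas.mul h.contDiff.continuous.measurable).div_const _
    · exact div_nonneg (mul_nonneg (h.nonneg x) (h.sol_nonneg x)) (by positivity)
    · refine div_le_div_of_nonneg_right ?_ (by positivity)
      calc v x * φ x ≤ v x * 1 := mul_le_mul_of_nonneg_left (h.sol_le_one x) (h.nonneg x)
        _ ≤ C := by rw [mul_one]; exact hC x
    · simp [h.supp x hx]
    · rw [integral_div, div_eq_one_iff_eq (by positivity)]
      linarith [h.integral_mul_eq]
    · field_simp

theorem complex_weak_localSol (h : IsScatteringSolution v φ R0 a) (hR : R0 ≤ R)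
    {ψ : R3 → ℂ} (hψ : ContDiff ℝ (⊤ : ℕ∞) ψ) :
    ∫ x, ∑ j, fderiv ℝ (localSol φ a R) x (EuclideanSpace.single j 1) •
      fderiv ℝ ψ x (EuclideanSpace.single j 1) =
      -(1/2 : ℝ) • (∫ x, (v x * φ x) • ψ x) + (4 * π * a) • ∫ x, charge R x • ψ x := by
  have hR' := h.R0_pos.trans_le hR
  have hd : ∀ j : Fin 3, Continuous fun x => fderiv ℝ ψ x (EuclideanSpace.single j 1) := fun j =>
    (hψ.continuous_fderiv (by simp)).clm_apply continuous_const
  have i1 : Integrable fun x => ∑ j, fderiv ℝ (localSol φ a R) x (EuclideanSpace.single j 1) •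
      fderiv ℝ ψ x (EuclideanSpace.single j 1) :=
    integrable_finsetSum _ fun j _ => ((h.continuous_fderiv_localSol _).smul
      (hd j)).integrable_of_hasCompactSupport
      (((h.hasCompactSupport_localSol hR).fderiv_apply (𝕜 := ℝ) _).smul_right)
  have i2 : Integrable fun x => (v x * φ x) • ψ x :=
    integrable_smul_of_support h.integrable_mul (r := R0)
      (fun x hx => by rw [h.supp x hx]; simp) hψ.continuous
  have i3 : Integrable fun x => charge R x • ψ x :=
    ((continuous_charge R).smul hψ.continuous).integrable_of_hasCompactSupport
      (hasCompactSupport_charge hR').smul_right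
  have key : ∀ L : ℂ →L[ℝ] ℝ, L (∫ x, ∑ j, fderiv ℝ (localSol φ a R) x
      (EuclideanSpace.single j 1) • fderiv ℝ ψ x (EuclideanSpace.single j 1)) =
      L (-(1/2 : ℝ) • (∫ x, (v x * φ x) • ψ x) + (4 * π * a) • ∫ x, charge R x • ψ x) := by
    intro L
    have w := h.weak_localSol hR (g := fun x => L (ψ x)) (L.contDiff.comp hψ)
    rw [map_add, map_smul, map_smul, ← L.integral_comp_comm i1, ← L.integral_comp_comm i2,
      ← L.integral_comp_comm i3]
    simp only [map_sum, map_smul, smul_eq_mul]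
    rw [← w]
    congr with x
    refine Finset.sum_congr rfl fun j _ => ?_
    have : HasFDerivAt (fun x => L (ψ x)) (L.comp (fderiv ℝ ψ x)) x :=
      L.hasFDerivAt.comp x (hψ.differentiable (by simp) x).hasFDerivAt
    rw [this.fderiv]; rfl
  exact Complex.ext (key Complex.reCLM) (key Complex.imCLM)

theorem dyson_zero (h : IsScatteringSolution v φ R0 a) (hR : R0 ≤ R) {κ : R3 → ℝ}
    (hκ : ∀ᵐ x, v x * φ x = 8 * π * a * κ x) (hκi : Integrable κ)
    (hκs : ∀ x, R0 < ‖x‖ → κ x = 0)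
    {ψ u : R3 → ℂ} (hψ : ContDiff ℝ (⊤ : ℕ∞) ψ) (hu : Continuous u) :
    4 * π * a * ‖(∫ x, charge R x • ψ x) + ∫ x, κ x • (u x - ψ x)‖ ^ 2 ≤
      (1 + 2 * a / R) * ((∫ x in Metric.ball 0 R, gradSq ψ x) + (1/2) * ∫ x, v x * ‖u x‖ ^ 2) := by
  have hR' := h.R0_pos.trans_le hR
  have hp := pi_pos
  have a0 := h.length_nonneg
  have hd : ∀ j : Fin 3, Continuous fun x => fderiv ℝ ψ x (EuclideanSpace.single j 1) := fun j =>
    (hψ.continuous_fderiv (by simp)).clm_apply continuous_const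
  have hgc : Continuous (gradSq ψ) := by
    unfold gradSq; exact continuous_finsetSum _ fun j _ => (hd j).norm.pow 2
  set ℓ := (∫ x, charge R x • ψ x) + ∫ x, κ x • (u x - ψ x) with hℓ
  set D := (∫ x, ∑ j, fderiv ℝ (localSol φ a R) x (EuclideanSpace.single j 1) ^ 2) +
      (1/2) * ∫ x, v x * φ x ^ 2 with hD
  have hDle : D ≤ 4 * π * a * (1 + 2 * a / R) := h.dirichlet_localSol_le hR
  set E := (∫ x in Metric.ball 0 R, gradSq ψ x) + (1/2) * ∫ x, v x * ‖u x‖ ^ 2 with hE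
  have hD0 : 0 ≤ D := add_nonneg (integral_nonneg fun x => by positivity)
    (mul_nonneg (by norm_num) (integral_nonneg fun x => mul_nonneg (h.nonneg x) (sq_nonneg _)))
  have hE0 : 0 ≤ E := add_nonneg (integral_nonneg fun x => by unfold gradSq; positivity)
    (mul_nonneg (by norm_num) (integral_nonneg fun x => mul_nonneg (h.nonneg x) (sq_nonneg _)))
  have i1 : ∀ j : Fin 3, Integrable fun x => fderiv ℝ (localSol φ a R) x (EuclideanSpace.single j 1) •
      fderiv ℝ ψ x (EuclideanSpace.single j 1) := fun j => ((h.continuous_fderiv_localSol _).smul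
      (hd j)).integrable_of_hasCompactSupport
      (((h.hasCompactSupport_localSol hR).fderiv_apply (𝕜 := ℝ) _).smul_right)
  have i2 : ∀ g : R3 → ℂ, Continuous g → Integrable fun x => (v x * φ x) • g x := fun g hg =>
    integrable_smul_of_support h.integrable_mul (r := R0)
      (fun x hx => by rw [h.supp x hx]; simp) hg
  have eq1 : (4 * π * a) • ℓ = (∫ x, ∑ j, fderiv ℝ (localSol φ a R) x (EuclideanSpace.single j 1) •
      fderiv ℝ ψ x (EuclideanSpace.single j 1)) + (1/2 : ℝ) • ∫ x, (v x * φ x) • u x := by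
    rw [h.complex_weak_localSol hR hψ, hℓ, smul_add]
    have : (4 * π * a) • ∫ x, κ x • (u x - ψ x) = (1/2 : ℝ) • ∫ x, (v x * φ x) • (u x - ψ x) := by
      rw [← integral_smul, ← integral_smul]
      apply integral_congr_ae
      filter_upwards [hκ] with x hx
      rw [hx, smul_smul, smul_smul]
      congr 1; ring
    rw [this]
    simp_rw [smul_sub]
    rw [integral_sub (i2 u hu) (i2 ψ hψ.continuous), smul_sub]
    simp only [neg_smul]
    abel
  have hball : ∫ x in Metric.ball 0 R, gradSq ψ x = ∫ x in Metric.closedBall (0 : R3) R, gradSq ψ x := by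
    apply setIntegral_congr_set
    exact Metric.ball_subset_closedBall.eventuallyLE.antisymm (by
      rw [ae_le_set, Metric.closedBall_sdiff_ball]
      exact Measure.addHaar_sphere _ _ _)
  have iD1 : Integrable fun x => ∑ j, fderiv ℝ (localSol φ a R) x (EuclideanSpace.single j 1) ^ 2 := by
    refine integrable_finsetSum _ fun j _ => ?_
    simpa [sq] using h.integrable_fderiv_localSol_mul hR (EuclideanSpace.single j 1)
            (h.continuous_fderiv_localSol (EuclideanSpace.single j 1))
  have iD2 : Integrable fun x => v x * φ x ^ 2 := by
    simpa using integrable_smul_of_support h.integrable h.supp (h.contDiff.continuous.pow 2)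
  have iE1 : Integrable ((Metric.closedBall (0:R3) R).indicator (gradSq ψ)) :=
    (hgc.continuousOn.integrableOn_compact (isCompact_closedBall _ _)).integrable_indicator
      Metric.isClosed_closedBall.measurableSet
  have iE2 : Integrable fun x => v x * ‖u x‖ ^ 2 := by
    simpa using integrable_smul_of_support h.integrable h.supp (hu.norm.pow 2)
  have main : (4 * π * a * ‖ℓ‖) ^ 2 ≤ D * E := by
    refine sq_le_mul_of_forall_pos (by positivity) hD0 hE0 fun t ht => ?_
    have n1 : 4 * π * a * ‖ℓ‖ ≤ ∫ x, ((∑ j, |fderiv ℝ (localSol φ a R) x (EuclideanSpace.single j 1)| *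
      ‖fderiv ℝ ψ x (EuclideanSpace.single j 1)‖) + (1/2) * (v x * φ x * ‖u x‖)) := by
      have : 4 * π * a * ‖ℓ‖ = ‖(4 * π * a) • ℓ‖ := by
        rw [norm_smul, Real.norm_eq_abs, abs_of_nonneg (by positivity)]
      have i4 : Integrable fun x => (1/2 : ℝ) • (v x * φ x) • u x := (i2 u hu).smul (1/2 : ℝ)
      rw [this, eq1, ← integral_smul, ← integral_add (integrable_finsetSum _ fun j _ => i1 j) i4]
      refine norm_integral_le_of_norm_le ?_ (.of_forall fun x => ?_)
      · refine Integrable.add (integrable_finsetSum _ fun j _ => ?_) (Integrable.const_mul ?_ _)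
        · refine (i1 j).norm.congr (.of_forall fun x => ?_)
          simp only [norm_smul, Real.norm_eq_abs]
        · refine (i2 u hu).norm.congr (.of_forall fun x => ?_)
          simp only [norm_smul, Real.norm_eq_abs,
            abs_of_nonneg (mul_nonneg (h.nonneg x) (h.sol_nonneg x))]
      · refine (norm_add_le _ _).trans (add_le_add ((norm_sum_le _ _).trans (le_of_eq ?_)) (le_of_eq ?_))
        · simp only [norm_smul, Real.norm_eq_abs]
        · simp only [norm_smul, Real.norm_eq_abs,
            abs_of_nonneg (mul_nonneg (h.nonneg x) (h.sol_nonneg x))]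
          norm_num
    have n2 : (∫ x, ((∑ j, |fderiv ℝ (localSol φ a R) x (EuclideanSpace.single j 1)| *
      ‖fderiv ℝ ψ x (EuclideanSpace.single j 1)‖) + (1/2) * (v x * φ x * ‖u x‖))) ≤
      ∫ x, ((t / 2) * ((∑ j, fderiv ℝ (localSol φ a R) x (EuclideanSpace.single j 1) ^ 2) +
        (1/2) * (v x * φ x ^ 2)) + (1 / (2 * t)) * ((Metric.closedBall (0:R3) R).indicator (gradSq ψ) x +
          (1/2) * (v x * ‖u x‖ ^ 2))) := by
      have am : ∀ p q : ℝ, p * q ≤ (t / 2) * p ^ 2 + (1 / (2 * t)) * q ^ 2 := by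
        intro p q
        have : (t / 2) * p ^ 2 + (1 / (2 * t)) * q ^ 2 - p * q = (1 / (2 * t)) * (t * p - q) ^ 2 := by
          field_simp; ring
        have h2 : 0 ≤ (1 / (2 * t)) * (t * p - q) ^ 2 := by positivity
        linarith
      refine integral_mono_of_nonneg (.of_forall fun x => ?_) ?_ (.of_forall fun x => ?_)
      · have := mul_nonneg (h.nonneg x) (h.sol_nonneg x)
        simp only [Pi.zero_apply]; positivity
      · exact ((iD1.add (iD2.const_mul _)).const_mul _).add ((iE1.add (iE2.const_mul _)).const_mul _)
      · simp only
        have b1 : ∑ j, |fderiv ℝ (localSol φ a R) x (EuclideanSpace.single j 1)| *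
            ‖fderiv ℝ ψ x (EuclideanSpace.single j 1)‖ ≤ (t / 2) * (∑ j, fderiv ℝ (localSol φ a R) x
            (EuclideanSpace.single j 1) ^ 2) + (1 / (2 * t)) *
            (Metric.closedBall (0:R3) R).indicator (gradSq ψ) x := by
          by_cases hx : x ∈ Metric.closedBall (0:R3) R
          · rw [Set.indicator_of_mem hx]
            unfold gradSq
            rw [Finset.mul_sum, Finset.mul_sum, ← Finset.sum_add_distrib]
            refine Finset.sum_le_sum fun j _ => ?_
            have := am |fderiv ℝ (localSol φ a R) x (EuclideanSpace.single j 1)|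
              ‖fderiv ℝ ψ x (EuclideanSpace.single j 1)‖
            rwa [sq_abs] at this
          · simp only [Metric.mem_closedBall, dist_zero_right, not_le] at hx
            rw [Set.indicator_of_notMem (by simpa using hx), h.fderiv_localSol_eq_zero hR hx]
            simp
        have b2 := mul_le_mul_of_nonneg_left (am (φ x) ‖u x‖) (h.nonneg x)
        nlinarith
    have n3 : ∫ x, ((t / 2) * ((∑ j, fderiv ℝ (localSol φ a R) x (EuclideanSpace.single j 1) ^ 2) +
        (1/2) * (v x * φ x ^ 2)) + (1 / (2 * t)) * ((Metric.closedBall (0:R3) R).indicator (gradSq ψ) x +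
          (1/2) * (v x * ‖u x‖ ^ 2))) = (t / 2) * D + (1 / (2 * t)) * E := by
      have j1 : Integrable fun x => (∑ j, fderiv ℝ (localSol φ a R) x (EuclideanSpace.single j 1) ^ 2) +
        (1/2) * (v x * φ x ^ 2) := iD1.add (iD2.const_mul _)
      have j2 : Integrable fun x => (Metric.closedBall (0:R3) R).indicator (gradSq ψ) x +
          (1/2) * (v x * ‖u x‖ ^ 2) := iE1.add (iE2.const_mul _)
      rw [integral_add (j1.const_mul _) (j2.const_mul _), integral_const_mul, integral_const_mul]
      rw [integral_add iD1 (iD2.const_mul _), integral_add iE1 (iE2.const_mul _), integral_const_mul,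
        integral_const_mul, integral_indicator Metric.isClosed_closedBall.measurableSet, ← hball]
    have : 2 * ((t / 2) * D + (1 / (2 * t)) * E) = t * D + E / t := by field_simp
    linarith
  rcases a0.eq_or_lt with h0 | h0
  · rw [← h0]; simpa using hE0
  · have e1 : (4 * π * a * ‖ℓ‖) ^ 2 ≤ 4 * π * a * (1 + 2 * a / R) * E :=
      main.trans (mul_le_mul_of_nonneg_right hDle hE0)
    have e2 : 4 * π * a * (4 * π * a * ‖ℓ‖ ^ 2) ≤ 4 * π * a * ((1 + 2 * a / R) * E) := by
      calc _ = (4 * π * a * ‖ℓ‖) ^ 2 := by ring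
        _ ≤ _ := e1
        _ = _ := by ring
    exact le_of_mul_le_mul_left e2 (by positivity)

theorem dyson (h : IsScatteringSolution v φ R0 a) (hR : R0 ≤ R) {κ : R3 → ℝ}
    (hκ : ∀ᵐ x, v x * φ x = 8 * π * a * κ x) (hκi : Integrable κ)
    (hκs : ∀ x, R0 < ‖x‖ → κ x = 0)
    {ψ u : R3 → ℂ} (hψ : ContDiff ℝ (⊤ : ℕ∞) ψ) (hu : Continuous u) (y : R3) :
    4 * π * a * ‖(∫ x, charge R (x - y) • ψ x) + ∫ x, κ (x - y) • (u x - ψ x)‖ ^ 2 ≤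
      (1 + 2 * a / R) * ((∫ x in Metric.ball y R, gradSq ψ x) +
        (1/2) * ∫ x, v (x - y) * ‖u x‖ ^ 2) := by
  have := h.dyson_zero hR hκ hκi hκs (ψ := fun x => ψ (x + y)) (u := fun x => u (x + y))
    (hψ.comp (contDiff_id.add contDiff_const)) (hu.comp (by fun_prop))
  have e1 : ∫ x, charge R (x - y) • ψ x = ∫ x, charge R x • ψ (x + y) := by
    rw [← integral_add_right_eq_self _ y]; simp
  have e2 : ∫ x, κ (x - y) • (u x - ψ x) = ∫ x, κ x • (u (x + y) - ψ (x + y)) := by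
    rw [← integral_add_right_eq_self _ y]; simp
  have e3 : ∫ x, v (x - y) * ‖u x‖ ^ 2 = ∫ x, v x * ‖u (x + y)‖ ^ 2 := by
    rw [← integral_add_right_eq_self _ y]; simp
  have e4 : ∫ x in Metric.ball y R, gradSq ψ x =
      ∫ x in Metric.ball 0 R, gradSq (fun x => ψ (x + y)) x := by
    rw [← integral_indicator Metric.isOpen_ball.measurableSet,
      ← integral_indicator Metric.isOpen_ball.measurableSet, ← integral_add_right_eq_self _ y]
    congr with x
    simp only [Set.indicator, Metric.mem_ball, dist_eq_norm, add_sub_cancel_right, sub_zero]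
    congr 1
    unfold gradSq
    simp_rw [fderiv_comp_add_right]
  rw [e1, e2, e3, e4]
  exact this

end IsScatteringSolution

/-- A bounded measurable function all of whose moments are integrable. -/
structure RapidDecay (F : R3 → ℂ) : Prop where
  meas : AEStronglyMeasurable F
  moments : ∀ n : ℕ, Integrable fun p => ‖p‖ ^ n * ‖F p‖
  bdd : ∃ C, ∀ p, ‖F p‖ ≤ C

namespace RapidDecay
variable {F : R3 → ℂ}

theorem indicator (h : RapidDecay F) {S : Set R3} (hS : MeasurableSet S) :
    RapidDecay (S.indicator F) where
  meas := h.meas.indicator hS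
  moments n := by
    refine ((h.moments n).indicator hS).congr (.of_forall fun p => ?_)
    by_cases hp : p ∈ S <;> simp [hp]
  bdd := by
    obtain ⟨C, hC⟩ := h.bdd
    exact ⟨C, fun p => (norm_indicator_le_norm_self _ _).trans (hC p)⟩

theorem integrable (h : RapidDecay F) : Integrable F :=
  (integrable_norm_iff h.meas).1 (by simpa using h.moments 0)

theorem integrable_moment_sq (h : RapidDecay F) (n : ℕ) :
    Integrable fun p => ‖p‖ ^ n * ‖F p‖ ^ 2 := by
  obtain ⟨C, hC⟩ := h.bdd
  refine ((h.moments n).mul_const C).mono' ?_ (.of_forall fun p => ?_)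
  · exact (continuous_norm.pow n).aestronglyMeasurable.mul (h.meas.norm.pow 2)
  · rw [norm_of_nonneg (by positivity), mul_assoc, sq]
    gcongr; exact hC p

theorem memLp (h : RapidDecay F) : MemLp F 2 := by
  rw [memLp_two_iff_integrable_sq_norm h.meas]
  simpa using h.integrable_moment_sq 0

theorem coord_mul (h : RapidDecay F) (j : Fin 3) :
    MemLp (fun p => (p j : ℂ) * F p) 2 ∧ Integrable fun p => (p j : ℂ) * F p := by
  have hm : AEStronglyMeasurable fun p : R3 => (p j : ℂ) * F p :=
    AEStronglyMeasurable.mul (by fun_prop) h.meas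
  have hj : ∀ p : R3, |p j| ≤ ‖p‖ := fun p => by
    simpa using PiLp.norm_apply_le p j
  constructor
  · rw [memLp_two_iff_integrable_sq_norm hm]
    refine (h.integrable_moment_sq 2).mono' (hm.norm.pow 2) (.of_forall fun p => ?_)
    rw [norm_of_nonneg (by positivity), norm_mul, mul_pow]
    gcongr
    simpa using hj p
  · refine (h.moments 1).mono' hm (.of_forall fun p => ?_)
    rw [norm_mul, pow_one]
    gcongr
    simpa using hj p

open FourierTransform in
theorem contDiff_fourierInv (h : RapidDecay F) : ContDiff ℝ (⊤ : ℕ∞) (𝓕⁻ F) := by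
  rw [Real.fourierInv_eq_fourier_comp_neg]
  refine Real.contDiff_fourier fun n _ => ?_
  refine (h.moments n).comp_neg.congr (.of_forall fun p => by simp)

open FourierTransform in
theorem fderiv_fourierInv (h : RapidDecay F) (j : Fin 3) (x : R3) :
    fderiv ℝ (𝓕⁻ F) x (EuclideanSpace.single j 1) =
      2 * π * Complex.I * 𝓕⁻ (fun p => (p j : ℂ) * F p) x := by
  have hF : Integrable fun p => F (-p) := h.integrable.comp_neg
  have hF1 : Integrable fun p => ‖p‖ * ‖F (-p)‖ := by
    refine (h.moments 1).comp_neg.congr (.of_forall fun p => by simp)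
  rw [Real.fourierInv_eq_fourier_comp_neg, Real.fourierInv_eq_fourier_comp_neg,
    Real.fderiv_fourier hF hF1, Real.fourier_continuousLinearMap_apply,
    Real.fourier_eq, Real.fourier_eq, ← integral_const_mul]
  · congr with p
    have e : innerSL ℝ p (EuclideanSpace.single j 1) = p j := by
      rw [innerSL_apply_apply, EuclideanSpace.inner_single_right]; simp
    simp only [VectorFourier.fourierSMulRight_apply, Circle.smul_def, e]
    simp
    ring
  · refine (hF1.const_mul (2 * π * ‖innerSL ℝ (E := R3)‖)).mono'
      hF.aestronglyMeasurable.fourierSMulRight (.of_forall fun p => ?_)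
    rw [← mul_assoc]
    exact VectorFourier.norm_fourierSMulRight_le _ _ _

open FourierTransform in
theorem gradSq_fourierInv (h : RapidDecay F) :
    Integrable (gradSq (𝓕⁻ F)) ∧
    ∫ x, gradSq (𝓕⁻ F) x = ∫ p, 4 * π ^ 2 * ‖p‖ ^ 2 * ‖F p‖ ^ 2 := by
  have e : ∀ x, gradSq (𝓕⁻ F) x =
      ∑ j : Fin 3, 4 * π ^ 2 * ‖𝓕⁻ (fun p => (p j : ℂ) * F p) x‖ ^ 2 := by
    intro x
    unfold gradSq
    refine Finset.sum_congr rfl fun j _ => ?_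
    rw [h.fderiv_fourierInv]
    simp only [norm_mul, mul_pow, Complex.norm_real, Complex.norm_I, Complex.norm_ofNat,
      norm_of_nonneg pi_pos.le]
    ring
  have hi : ∀ j : Fin 3, Integrable fun x => 4 * π ^ 2 * ‖𝓕⁻ (fun p => (p j : ℂ) * F p) x‖ ^ 2 :=
    fun j => by
      have := memLp_fourierInv (h.coord_mul j).2 (h.coord_mul j).1
      exact ((memLp_two_iff_integrable_sq_norm this.1).1 this).const_mul _
  have hi2 : ∀ j : Fin 3, Integrable fun p : R3 => 4 * π ^ 2 * ‖(p j : ℂ) * F p‖ ^ 2 :=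
    fun j => by
      have := (h.coord_mul j).1
      exact ((memLp_two_iff_integrable_sq_norm this.1).1 this).const_mul _
  constructor
  · exact (integrable_finsetSum _ fun j _ => hi j).congr (.of_forall fun x => (e x).symm)
  · simp_rw [e]
    rw [integral_finsetSum _ fun j _ => hi j]
    simp_rw [integral_const_mul, integral_norm_sq_fourierInv_eq (h.coord_mul _).2 (h.coord_mul _).1,
      ← integral_const_mul]
    rw [← integral_finsetSum _ fun j _ => hi2 j]
    congr with p
    rw [EuclideanSpace.norm_sq_eq p]
    simp only [norm_mul, mul_pow, Complex.norm_real]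
    rw [Finset.mul_sum, Finset.sum_mul]
    exact Finset.sum_congr rfl fun j _ => by ring

end RapidDecay

open FourierTransform in
theorem rapidDecay_fourier {u : R3 → ℂ} (hu : ContDiff ℝ (⊤ : ℕ∞) u) (hc : HasCompactSupport u) :
    RapidDecay (𝓕 u) := by
  let U : SchwartzMap R3 ℂ := hc.toSchwartzMap hu
  have e : (𝓕 u) = (𝓕 U : SchwartzMap R3 ℂ) := by
    rw [SchwartzMap.fourier_coe]; rfl
  rw [e]
  refine ⟨(SchwartzMap.continuous _).aestronglyMeasurable,
    fun n => SchwartzMap.integrable_pow_mul volume _ n, ?_⟩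
  obtain ⟨C, hC⟩ := (𝓕 U : SchwartzMap R3 ℂ).decay 0 0
  exact ⟨C, fun p => by simpa using hC.2 p⟩

open FourierTransform in
theorem fourierInv_fourier_of_test {u : R3 → ℂ} (hu : ContDiff ℝ (⊤ : ℕ∞) u)
    (hc : HasCompactSupport u) : 𝓕⁻ (𝓕 u) = u :=
  Continuous.fourierInv_fourier_eq hu.continuous
    (hu.continuous.integrable_of_hasCompactSupport hc) (rapidDecay_fourier hu hc).integrable

open FourierTransform in
theorem integral_fourierInv_mul_eq {f g : R3 → ℂ} (hf : Integrable f) (hg : Integrable g) :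
    ∫ x, 𝓕⁻ f x * g x = ∫ x, f x * 𝓕⁻ g x := by
  rw [Real.fourierInv_eq_fourier_comp_neg, Real.fourierInv_eq_fourier_comp_neg]
  have := VectorFourier.integral_fourierIntegral_smul_eq_flip (μ := (volume : Measure R3))
    (ν := (volume : Measure R3)) (L := innerₗ R3) (f := fun x => f (-x)) (g := g)
    continuous_fourierChar (by exact continuous_inner) hf.comp_neg hg
  simp only [smul_eq_mul] at this
  refine Eq.trans this ?_
  rw [← integral_neg_eq_self]
  simp only [neg_neg]
  congr with x
  congr 1
  rw [Real.fourier_eq]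
  unfold VectorFourier.fourierIntegral
  rw [← integral_neg_eq_self]
  simp [real_inner_comm]

open FourierTransform in
theorem fourierInv_translate (f : R3 → ℂ) (y p : R3) :
    𝓕⁻ (fun x => f (x - y)) p = (fourierChar ⟪y, p⟫ : ℂ) * 𝓕⁻ f p := by
  rw [Real.fourierInv_eq, Real.fourierInv_eq, ← integral_add_right_eq_self _ y,
    ← integral_const_mul]
  congr with x
  simp [Circle.smul_def, inner_add_left, AddChar.map_add_eq_mul]
  ring

open FourierTransform in
theorem norm_fourierInv_le (f : R3 → ℂ) (p : R3) : ‖𝓕⁻ f p‖ ≤ ∫ x, ‖f x‖ := by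
  rw [Real.fourierInv_eq]
  exact (norm_integral_le_integral_norm _).trans (le_of_eq (by simp))

open FourierTransform in
theorem continuous_fourierInv_of_integrable {f : R3 → ℂ} (hf : Integrable f) :
    Continuous (𝓕⁻ f) := by
  rw [Real.fourierInv_eq_fourier_comp_neg]
  exact VectorFourier.fourierIntegral_continuous continuous_fourierChar
    (by exact continuous_inner) hf.comp_neg

open FourierTransform in
/-- The Fourier transform of a probability density supported in a ball of radius `R` is close to
one at low momenta. -/
theorem one_sub_le_norm_fourierInv {f : R3 → ℝ} (hf : Integrable f) (hf0 : ∀ x, 0 ≤ f x)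
    (hf1 : ∫ x, f x = 1) {R : ℝ} (hR : ∀ x, R < ‖x‖ → f x = 0) (p : R3) :
    1 - 2 * π * R * ‖p‖ ≤ ‖𝓕⁻ (fun x => (f x : ℂ)) p‖ := by
  have h1 : ‖(1:ℂ) - 𝓕⁻ (fun x => (f x : ℂ)) p‖ ≤ ∫ x, 2 * π * R * ‖p‖ * f x := by
    have e : (1:ℂ) - 𝓕⁻ (fun x => (f x : ℂ)) p =
        ∫ x, (1 - (fourierChar ⟪x, p⟫ : ℂ)) * (f x : ℂ) := by
      rw [Real.fourierInv_eq]
      have i1 : Integrable fun x => (f x : ℂ) := hf.ofReal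
      have i2 : Integrable fun x => (fourierChar ⟪x, p⟫ : ℂ) * (f x : ℂ) := by
        have := (Real.fourierIntegral_convergent_iff (-p)).2 i1
        refine this.congr (.of_forall fun x => ?_)
        simp [Circle.smul_def]
      have : ∀ x, (1 - (fourierChar ⟪x, p⟫ : ℂ)) * (f x : ℂ) =
          (f x : ℂ) - (fourierChar ⟪x, p⟫ : ℂ) * (f x : ℂ) := fun x => by ring
      simp_rw [this]
      rw [integral_sub i1 i2, integral_complex_ofReal, hf1]
      simp [Circle.smul_def]
    rw [e]
    refine norm_integral_le_of_norm_le (hf.const_mul _) (.of_forall fun x => ?_)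
    rw [norm_mul, Complex.norm_real, norm_of_nonneg (hf0 x)]
    by_cases hx : R < ‖x‖
    · simp [hR x hx]
    · push Not at hx
      refine mul_le_mul_of_nonneg_right ?_ (hf0 x)
      have h2 : ‖(1:ℂ) - (fourierChar ⟪x, p⟫ : ℂ)‖ ≤ ‖2 * π * ⟪x, p⟫‖ := by
        rw [norm_sub_rev, Real.fourierChar_apply, mul_comm]
        exact_mod_cast Real.norm_exp_I_mul_ofReal_sub_one_le (x := 2 * π * ⟪x, p⟫)
      refine h2.trans ?_
      rw [norm_mul, norm_of_nonneg (by positivity), mul_assoc (2 * π)]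
      gcongr
      exact (norm_inner_le_norm x p).trans (by gcongr)
  rw [integral_const_mul, hf1, mul_one] at h1
  have h2 : ‖(1:ℂ)‖ - ‖𝓕⁻ (fun x => (f x : ℂ)) p‖ ≤ _ := norm_sub_norm_le _ _
  rw [norm_one] at h2
  linarith

open FourierTransform in
/-- The Fourier profile equal to that of `κ (· - y)` at momenta below `K`, and to that of the
smeared unit charge around `y` above `K`. -/
def mixedProfile (κ : R3 → ℝ) (R K : ℝ) (y p : R3) : ℂ :=
  if ‖p‖ < K then 𝓕⁻ (fun x => (κ (x - y) : ℂ)) p else 𝓕⁻ (fun x => (charge R (x - y) : ℂ)) p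

/-- The mixed Fourier profile divided by the one of the smeared charge. -/
def mixedMultiplier (κ : R3 → ℝ) (R K : ℝ) (p : R3) : ℂ := open FourierTransform in
  if ‖p‖ < K then 𝓕⁻ (fun x => (κ x : ℂ)) p / 𝓕⁻ (fun x => (charge R x : ℂ)) p else 1

section
variable {κ : R3 → ℝ} {R K : ℝ}

theorem measurableSet_norm_lt (K : ℝ) : MeasurableSet {p : R3 | ‖p‖ < K} :=
  measurableSet_lt measurable_norm measurable_const

open FourierTransform in
theorem half_le_norm_fourierInv_charge (hR : 0 < R) (hK : 4 * π * R * K ≤ 1) {p : R3}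
    (hp : ‖p‖ < K) : 1 / 2 ≤ ‖𝓕⁻ (fun x => (charge R x : ℂ)) p‖ := by
  have := one_sub_le_norm_fourierInv (integrable_charge hR) (charge_nonneg hR) (integral_charge hR)
    (R := R) (fun x hx => charge_eq_zero hR hx.le) p
  have h2 : 2 * π * R * ‖p‖ ≤ 2 * π * R * K := by gcongr
  linarith

open FourierTransform in
theorem norm_fourierInv_density_le (hκ0 : ∀ x, 0 ≤ κ x) (hκ1 : ∫ x, κ x = 1) (y p : R3) :
    ‖𝓕⁻ (fun x => (κ (x - y) : ℂ)) p‖ ≤ 1 := by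
  refine (norm_fourierInv_le _ _).trans (le_of_eq ?_)
  simp only [Complex.norm_real, norm_of_nonneg (hκ0 _)]
  rw [integral_sub_right_eq_self κ y, hκ1]

theorem norm_mixedMultiplier_le (hR : 0 < R) (hK : 4 * π * R * K ≤ 1) (hκ0 : ∀ x, 0 ≤ κ x)
    (hκ1 : ∫ x, κ x = 1) (p : R3) : ‖mixedMultiplier κ R K p‖ ≤ 2 := by
  unfold mixedMultiplier
  split_ifs with h
  · have h1 := half_le_norm_fourierInv_charge hR hK h
    have h2 := norm_fourierInv_density_le hκ0 hκ1 0 p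
    simp only [sub_zero] at h2
    rw [norm_div, div_le_iff₀ (by linarith)]
    linarith
  · simp

theorem measurable_mixedMultiplier (hR : 0 < R) (hκi : Integrable κ) :
    Measurable (mixedMultiplier κ R K) :=
  Measurable.ite (measurableSet_norm_lt K)
    ((continuous_fourierInv_of_integrable hκi.ofReal).measurable.div
      (continuous_fourierInv_of_integrable (integrable_charge hR).ofReal).measurable)
    measurable_const

open FourierTransform in
theorem mixedProfile_eq (hR : 0 < R) (hK : 4 * π * R * K ≤ 1) (y p : R3) :
    mixedProfile κ R K y p =
      𝓕⁻ (fun x => (charge R (x - y) : ℂ)) p * mixedMultiplier κ R K p := by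
  unfold mixedProfile mixedMultiplier
  split_ifs with h
  · rw [fourierInv_translate (fun x => (charge R x : ℂ)), fourierInv_translate (fun x => (κ x : ℂ))]
    have h1 := half_le_norm_fourierInv_charge hR hK h
    have h2 : 𝓕⁻ (fun x => (charge R x : ℂ)) p ≠ 0 := by
      rw [← norm_pos_iff]; linarith
    field_simp
  · simp

/-- Bessel inequality for the translates of the mixed profile. -/
theorem sum_norm_sq_mixedProfile_le {ι : Type*} (s : Finset ι) (y : ι → R3) (hR : 0 < R)
    (hy : ∀ j ∈ s, ∀ k ∈ s, j ≠ k → 2 * R ≤ ‖y j - y k‖) (hK : 4 * π * R * K ≤ 1)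
    (hκi : Integrable κ) (hκ0 : ∀ x, 0 ≤ κ x) (hκ1 : ∫ x, κ x = 1)
    {F : R3 → ℂ} (hF : MemLp F 2) :
    ∑ j ∈ s, ‖∫ p, mixedProfile κ R K (y j) p * F p‖ ^ 2 ≤ 4 / R ^ 3 * ∫ p, ‖F p‖ ^ 2 := by
  have hm := measurable_mixedMultiplier (K := K) hR hκi
  have hb := norm_mixedMultiplier_le hR hK hκ0 hκ1
  have hMF : MemLp (fun p => mixedMultiplier κ R K p * F p) 2 := by
    refine (hF.const_mul 2).mono (hm.aestronglyMeasurable.mul hF.1) (.of_forall fun p => ?_)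
    rw [norm_mul, norm_mul]
    gcongr
    simpa using hb p
  have h := sum_norm_sq_integral_fourierInv_translate_le s y hy (continuous_charge R)
    (fun x hx => charge_eq_zero hR hx) hMF
  have e : ∀ j p, mixedProfile κ R K (y j) p * F p = FourierTransformInv.fourierInv (fun x => (charge R (x - y j) : ℂ)) p *
      (mixedMultiplier κ R K p * F p) := fun j p => by rw [mixedProfile_eq hR hK, mul_assoc]
  simp_rw [e]
  refine h.trans ?_
  have i1 := (memLp_two_iff_integrable_sq_norm hMF.1).1 hMF
  have i2 := (memLp_two_iff_integrable_sq_norm hF.1).1 hF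
  have h2 : ∫ p, ‖mixedMultiplier κ R K p * F p‖ ^ 2 ≤ 4 * ∫ p, ‖F p‖ ^ 2 := by
    rw [← integral_const_mul]
    refine integral_mono i1 (i2.const_mul _) fun p => ?_
    simp only [norm_mul, mul_pow]
    gcongr
    have := hb p
    nlinarith [norm_nonneg (mixedMultiplier κ R K p)]
  have h3 := integral_charge_sq_le hR
  calc _ ≤ 1 / R ^ 3 * (4 * ∫ p, ‖F p‖ ^ 2) := by gcongr
    _ = _ := by ring

theorem integrable_mixedProfile_mul (hR : 0 < R)
    (hκi : Integrable κ) (hκ0 : ∀ x, 0 ≤ κ x) (hκ1 : ∫ x, κ x = 1) (y : R3)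
    {F : R3 → ℂ} (hF : Integrable F) : Integrable fun p => mixedProfile κ R K y p * F p := by
  have hc : Integrable fun x => charge R (x - y) := (integrable_charge hR).comp_sub_right y
  have hk : Integrable fun x => κ (x - y) := hκi.comp_sub_right y
  have hm : Measurable (mixedProfile κ R K y) := Measurable.ite (measurableSet_norm_lt K)
    (continuous_fourierInv_of_integrable hk.ofReal).measurable
    (continuous_fourierInv_of_integrable hc.ofReal).measurable
  refine hF.bdd_mul (c := 1) hm.aestronglyMeasurable (.of_forall fun p => ?_)
  unfold mixedProfile
  split_ifs
  · exact norm_fourierInv_density_le hκ0 hκ1 y p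
  · exact norm_fourierInv_density_le (charge_nonneg hR) (integral_charge hR) y p

end

/-- The momentum weight left over in the one-body operator. -/
def fermiWeight (k k₁ D : ℝ) (p : R3) : ℝ :=
  if ‖p‖ < k then 4 * π ^ 2 * ‖p‖ ^ 2 else if ‖p‖ < k₁ then 4 * π ^ 2 * k ^ 2 - D
    else 4 * π ^ 2 * k ^ 2

theorem measurable_fermiWeight (k k₁ D : ℝ) : Measurable (fermiWeight k k₁ D) :=
  Measurable.ite (measurableSet_norm_lt k) (by fun_prop)
    (Measurable.ite (measurableSet_norm_lt k₁) measurable_const measurable_const)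

open FourierTransform in
set_option maxHeartbeats 1000000 in
theorem IsScatteringSolution.one_body {v φ : R3 → ℝ} {R0 a R K δ k k₁ : ℝ}
    (h : IsScatteringSolution v φ R0 a) (hR : R0 ≤ R) (hK : 4 * π * R * K ≤ 1)
    {κ : R3 → ℝ} (hκ : ∀ᵐ x, v x * φ x = 8 * π * a * κ x) (hκi : Integrable κ)
    (hκs : ∀ x, R0 < ‖x‖ → κ x = 0) (hκ0 : ∀ x, 0 ≤ κ x) (hκ1 : ∫ x, κ x = 1)
    (hδ : 0 < δ) (hδ1 : δ < 1) (hk : 0 ≤ k) (hk₁ : k ≤ k₁) (hkK : k₁ ≤ K)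
    (hD : 16 * π * a / (R ^ 3 * δ) ≤ 4 * π ^ 2 * (k₁ ^ 2 - k ^ 2))
    (hDK : 4 * π ^ 2 * k ^ 2 + 16 * π * a / (R ^ 3 * δ) ≤ δ * (4 * π ^ 2 * K ^ 2))
    {ι : Type*} (s : Finset ι) (y : ι → R3)
    (hy : ∀ j ∈ s, ∀ l ∈ s, j ≠ l → 2 * R ≤ ‖y j - y l‖)
    {u : R3 → ℂ} (hu : ContDiff ℝ (⊤ : ℕ∞) u) (huc : HasCompactSupport u) :
    (∫ p, fermiWeight k k₁ (16 * π * a / (R ^ 3 * δ)) p * ‖𝓕 u p‖ ^ 2) +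
      (1 - δ) ^ 2 * (4 * π * a / (1 + 2 * a / R)) *
        ∑ j ∈ s, ‖∫ p in {p | ‖p‖ < k}, 𝓕⁻ (fun x => (κ (x - y j) : ℂ)) p * 𝓕 u p‖ ^ 2 ≤
    (∫ x, gradSq u x) + (1 / 2) * ∑ j ∈ s, ∫ x, v (x - y j) * ‖u x‖ ^ 2 := by
  have hR' := h.R0_pos.trans_le hR
  have a0 := h.length_nonneg
  have hp := pi_pos
  set F := 𝓕 u with hFdef
  have hF : RapidDecay F := rapidDecay_fourier hu huc
  have huF : 𝓕⁻ F = u := fourierInv_fourier_of_test hu huc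
  set S : Set R3 := {p | ‖p‖ < K} with hS
  have mS : MeasurableSet S := measurableSet_norm_lt K
  set Sk : Set R3 := {p | ‖p‖ < k} with hSk
  have mSk : MeasurableSet Sk := measurableSet_norm_lt k
  have hFl := hF.indicator mS
  have hFh := hF.indicator mS.compl
  set b := 4 * π * a / (1 + 2 * a / R) with hb
  have hden : 0 < 1 + 2 * a / R := by positivity
  have b0 : 0 ≤ b := by positivity
  have b1 : b ≤ 4 * π * a := div_le_self (by positivity) (by
    have : 0 ≤ 2 * a / R := by positivity
    linarith)
  set V := ∑ j ∈ s, ∫ x, v (x - y j) * ‖u x‖ ^ 2 with hV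
  have V0 : 0 ≤ V := Finset.sum_nonneg fun j _ => integral_nonneg fun x =>
    mul_nonneg (h.nonneg _) (by positivity)
  set ℓ : (R3 → ℂ) → ι → ℂ := fun G j => ∫ p, mixedProfile κ R K (y j) p * G p with hℓ
  have ic : ∀ z, Integrable fun x => charge R (x - z) := fun z =>
    (integrable_charge hR').comp_sub_right z
  have ik : ∀ z, Integrable fun x => κ (x - z) := fun z => hκi.comp_sub_right z
  -- the sum of Dyson's inequalities
  have dys : b * ∑ j ∈ s, ‖ℓ F j‖ ^ 2 ≤
      (∫ p in Sᶜ, 4 * π ^ 2 * ‖p‖ ^ 2 * ‖F p‖ ^ 2) + (1 / 2) * V := by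
    set ψ := 𝓕⁻ (Sᶜ.indicator F) with hψ
    have hdiff : ∀ x, u x - ψ x = 𝓕⁻ (S.indicator F) x := by
      intro x
      have e : F = fun p => S.indicator F p + Sᶜ.indicator F p := by
        ext p; by_cases hp : p ∈ S <;> simp [hp]
      have e2 : 𝓕⁻ F x = 𝓕⁻ (S.indicator F) x + 𝓕⁻ (Sᶜ.indicator F) x := by
        simp only [Real.fourierInv_eq]
        rw [← integral_add]
        · congr with p
          rw [← smul_add]
          conv_lhs => rw [e]
        · have := (Real.fourierIntegral_convergent_iff (-x)).2 hFl.integrable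
          simpa using this
        · have := (Real.fourierIntegral_convergent_iff (-x)).2 hFh.integrable
          simpa using this
      rw [← huF, e2]; simp [hψ]
    have hone : ∀ j, (∫ x, charge R (x - y j) • ψ x) + ∫ x, κ (x - y j) • (u x - ψ x) =
        ℓ F j := by
      intro j
      simp_rw [hdiff, Complex.real_smul]
      have e1 : ∫ x, (charge R (x - y j) : ℂ) * ψ x =
          ∫ p, 𝓕⁻ (fun x => (charge R (x - y j) : ℂ)) p * Sᶜ.indicator F p :=
        (integral_fourierInv_mul_eq (ic _).ofReal hFh.integrable).symm
      have e2 : ∫ x, (κ (x - y j) : ℂ) * 𝓕⁻ (S.indicator F) x =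
          ∫ p, 𝓕⁻ (fun x => (κ (x - y j) : ℂ)) p * S.indicator F p :=
        (integral_fourierInv_mul_eq (ik _).ofReal hFl.integrable).symm
      rw [e1, e2, hℓ]
      have e3 : ∀ p, 𝓕⁻ (fun x => (charge R (x - y j) : ℂ)) p * Sᶜ.indicator F p =
          mixedProfile κ R K (y j) p * Sᶜ.indicator F p := by
        intro p
        unfold mixedProfile
        by_cases hp : ‖p‖ < K
        · simp [hS, hp]
        · simp [hp]
      have e4 : ∀ p, 𝓕⁻ (fun x => (κ (x - y j) : ℂ)) p * S.indicator F p =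
          mixedProfile κ R K (y j) p * S.indicator F p := by
        intro p
        unfold mixedProfile
        by_cases hp : ‖p‖ < K
        · simp [hp]
        · simp [hS, hp]
      simp_rw [e3, e4]
      rw [← integral_add (integrable_mixedProfile_mul hR' hκi hκ0 hκ1 _ hFh.integrable)
        (integrable_mixedProfile_mul hR' hκi hκ0 hκ1 _ hFl.integrable)]
      congr with p
      by_cases hp : p ∈ S <;> simp [hp]
    have hgψ := hFh.gradSq_fourierInv
    have h1 : ∑ j ∈ s, 4 * π * a * ‖ℓ F j‖ ^ 2 ≤ ∑ j ∈ s, (1 + 2 * a / R) *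
        ((∫ x in Metric.ball (y j) R, gradSq ψ x) + (1/2) * ∫ x, v (x - y j) * ‖u x‖ ^ 2) := by
      refine Finset.sum_le_sum fun j _ => ?_
      rw [← hone]
      exact h.dyson hR hκ hκi hκs hFh.contDiff_fourierInv hu.continuous (y j)
    rw [← Finset.mul_sum, ← Finset.mul_sum, Finset.sum_add_distrib, ← Finset.mul_sum] at h1
    have h2 : ∑ j ∈ s, ∫ x in Metric.ball (y j) R, gradSq ψ x ≤ ∫ x, gradSq ψ x := by
      rw [← integral_biUnion_finset s (fun j _ => measurableSet_ball) ?_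
        (fun j _ => hgψ.1.integrableOn)]
      · refine setIntegral_le_integral hgψ.1 (.of_forall fun x => ?_)
        exact Finset.sum_nonneg fun j _ => by positivity
      · intro j hj l hl hjl
        refine Metric.ball_disjoint_ball ?_
        rw [dist_eq_norm]
        linarith [hy j hj l hl hjl]
    have h3 : ∫ x, gradSq ψ x = ∫ p in Sᶜ, 4 * π ^ 2 * ‖p‖ ^ 2 * ‖F p‖ ^ 2 := by
      rw [hgψ.2, ← integral_indicator mS.compl]
      congr with p
      by_cases hp : p ∈ S <;> simp [hp]
    rw [h3] at h2
    rw [hb, div_mul_eq_mul_div, div_le_iff₀ hden]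
    refine h1.trans ?_
    rw [mul_comm]
    gcongr
  -- splitting at the Fermi momentum
  have hsplit : (1 - δ) * ∑ j ∈ s, ‖ℓ (Sk.indicator F) j‖ ^ 2 -
      (1 / δ) * (4 / R ^ 3 * ∫ p in Skᶜ, ‖F p‖ ^ 2) ≤ ∑ j ∈ s, ‖ℓ F j‖ ^ 2 := by
    have hB := sum_norm_sq_mixedProfile_le s y hR' hy hK hκi hκ0 hκ1 (hF.indicator mSk.compl).memLp
    have eB : ∫ p, ‖Skᶜ.indicator F p‖ ^ 2 = ∫ p in Skᶜ, ‖F p‖ ^ 2 := by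
      rw [← integral_indicator mSk.compl]
      congr with p
      by_cases hp : p ∈ Sk <;> simp [hp]
    rw [eB] at hB
    have h1 : ∀ j, ℓ F j = ℓ (Sk.indicator F) j + ℓ (Skᶜ.indicator F) j := by
      intro j
      simp only [hℓ]
      rw [← integral_add (integrable_mixedProfile_mul hR' hκi hκ0 hκ1 _
          (hF.indicator mSk).integrable)
        (integrable_mixedProfile_mul hR' hκi hκ0 hκ1 _ (hF.indicator mSk.compl).integrable)]
      congr with p
      by_cases hp : p ∈ Sk <;> simp [hp]
    have h2 : ∀ j, (1 - δ) * ‖ℓ (Sk.indicator F) j‖ ^ 2 - (1 / δ) * ‖ℓ (Skᶜ.indicator F) j‖ ^ 2 ≤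
        ‖ℓ F j‖ ^ 2 := by
      intro j
      rw [h1 j]
      set A := ℓ (Sk.indicator F) j
      set B := ℓ (Skᶜ.indicator F) j
      have t : ‖A‖ - ‖B‖ ≤ ‖A + B‖ := by
        have := norm_sub_norm_le A (-B)
        simpa using this
      have t' : ‖B‖ - ‖A‖ ≤ ‖A + B‖ := by
        have := norm_sub_norm_le B (-A)
        rw [norm_neg, sub_neg_eq_add, add_comm B A] at this
        exact this
      have t2 : (‖A‖ - ‖B‖) ^ 2 ≤ ‖A + B‖ ^ 2 := by
        rw [← sq_abs (‖A‖ - ‖B‖)]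
        gcongr
        exact abs_le.2 ⟨by linarith, t⟩
      refine le_trans ?_ t2
      have t3 : 0 ≤ (δ * ‖A‖ - ‖B‖) ^ 2 / δ := by positivity
      have t4 : (δ * ‖A‖ - ‖B‖) ^ 2 / δ = δ * ‖A‖ ^ 2 - 2 * ‖A‖ * ‖B‖ + 1 / δ * ‖B‖ ^ 2 := by
        field_simp
        ring
      nlinarith [sq_nonneg ‖B‖]
    calc _ ≤ (1 - δ) * ∑ j ∈ s, ‖ℓ (Sk.indicator F) j‖ ^ 2 -
          (1 / δ) * ∑ j ∈ s, ‖ℓ (Skᶜ.indicator F) j‖ ^ 2 := by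
          gcongr
      _ = ∑ j ∈ s, ((1 - δ) * ‖ℓ (Sk.indicator F) j‖ ^ 2 -
          (1 / δ) * ‖ℓ (Skᶜ.indicator F) j‖ ^ 2) := by
          rw [Finset.sum_sub_distrib, Finset.mul_sum, Finset.mul_sum]
      _ ≤ _ := Finset.sum_le_sum fun j _ => h2 j
  have hlow : ∀ j, ℓ (Sk.indicator F) j =
      ∫ p in Sk, 𝓕⁻ (fun x => (κ (x - y j) : ℂ)) p * F p := by
    intro j
    simp only [hℓ]
    rw [← integral_indicator mSk]
    refine integral_congr_ae (.of_forall fun p => ?_)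
    simp only [mixedProfile]
    by_cases hp : p ∈ Sk
    · rw [Set.indicator_of_mem hp, Set.indicator_of_mem hp, if_pos]
      exact lt_of_lt_of_le hp (hk₁.trans hkK)
    · rw [Set.indicator_of_notMem hp, Set.indicator_of_notMem hp, mul_zero]
  have hT : Integrable fun p => 4 * π ^ 2 * ‖p‖ ^ 2 * ‖F p‖ ^ 2 :=
    ((hF.integrable_moment_sq 2).const_mul (4 * π ^ 2)).congr
      (.of_forall fun p => by simp only; ring)
  have hN : Integrable fun p => ‖F p‖ ^ 2 := by simpa using hF.integrable_moment_sq 0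
  have hgu : ∫ x, gradSq u x = ∫ p, 4 * π ^ 2 * ‖p‖ ^ 2 * ‖F p‖ ^ 2 := by
    rw [← hF.gradSq_fourierInv.2, huF]
  set D := 16 * π * a / (R ^ 3 * δ) with hDdef
  have hD0 : 0 ≤ D := by positivity
  have hW : Integrable fun p => fermiWeight k k₁ D p * ‖F p‖ ^ 2 := by
    refine hN.bdd_mul (c := 4 * π ^ 2 * k ^ 2 + D) (measurable_fermiWeight _ _ _).aestronglyMeasurable
      (.of_forall fun p => ?_)
    unfold fermiWeight
    rw [Real.norm_eq_abs, abs_le]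
    have t0 : 0 ≤ 4 * π ^ 2 * k ^ 2 := by positivity
    split_ifs with h1 h2
    · have t1 : 0 ≤ 4 * π ^ 2 * ‖p‖ ^ 2 := by positivity
      have t2 : 4 * π ^ 2 * ‖p‖ ^ 2 ≤ 4 * π ^ 2 * k ^ 2 := by gcongr
      constructor <;> linarith
    · constructor <;> linarith
    · constructor <;> linarith
  -- pointwise comparison of weights
  have hpt : (∫ p, fermiWeight k k₁ D p * ‖F p‖ ^ 2) + D * (∫ p in Skᶜ, ‖F p‖ ^ 2) +
      (1 - δ) * (∫ p in Sᶜ, 4 * π ^ 2 * ‖p‖ ^ 2 * ‖F p‖ ^ 2) ≤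
      ∫ p, 4 * π ^ 2 * ‖p‖ ^ 2 * ‖F p‖ ^ 2 := by
    rw [← integral_indicator mSk.compl, ← integral_indicator mS.compl, ← integral_const_mul,
      ← integral_const_mul]
    have i1 := (hN.indicator mSk.compl).const_mul D
    have i2 := (hT.indicator mS.compl).const_mul (1 - δ)
    have i3 : Integrable fun p => fermiWeight k k₁ D p * ‖F p‖ ^ 2 +
      D * Skᶜ.indicator (fun p => ‖F p‖ ^ 2) p := hW.add i1
    rw [← integral_add hW i1, ← integral_add i3 i2]
    refine integral_mono (i3.add i2) hT fun p => ?_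
    have hn : 0 ≤ ‖F p‖ ^ 2 := by positivity
    simp only [Set.indicator_apply, Set.mem_compl_iff, hS, hSk, Set.mem_ofPred_eq,
      fermiWeight]
    by_cases c1 : ‖p‖ < k
    · have c3 : ‖p‖ < K := by linarith
      simp [c1, c3]
    · by_cases c2 : ‖p‖ < k₁
      · have c3 : ‖p‖ < K := by linarith
        simp only [c1, c2, c3, if_true, if_false, not_true, not_false_iff]
        have : 4 * π ^ 2 * k ^ 2 ≤ 4 * π ^ 2 * ‖p‖ ^ 2 := by
          push Not at c1; gcongr
        nlinarith
      · by_cases c3 : ‖p‖ < K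
        · simp only [c1, c2, c3, if_true, if_false, not_true, not_false_iff]
          have : 4 * π ^ 2 * k₁ ^ 2 ≤ 4 * π ^ 2 * ‖p‖ ^ 2 := by
            push Not at c2; have := hk.trans hk₁; gcongr
          have : 4 * π ^ 2 * k ^ 2 + D ≤ 4 * π ^ 2 * ‖p‖ ^ 2 := by linarith
          have := mul_le_mul_of_nonneg_right this hn
          linarith
        · simp only [c1, c2, c3, if_false, not_false_iff, if_true]
          have : δ * (4 * π ^ 2 * K ^ 2) ≤ δ * (4 * π ^ 2 * ‖p‖ ^ 2) := by
            push Not at c3; have := (hk.trans hk₁).trans hkK; gcongr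
          have := mul_le_mul_of_nonneg_right (hDK.trans this) hn
          linarith
  simp_rw [← hlow]
  rw [hgu]
  have hIk : 0 ≤ ∫ p in Skᶜ, ‖F p‖ ^ 2 := integral_nonneg fun p => by positivity
  have f1 : (1 - δ) * (b * ∑ j ∈ s, ‖ℓ F j‖ ^ 2) ≤ (1 - δ) *
      ((∫ p in Sᶜ, 4 * π ^ 2 * ‖p‖ ^ 2 * ‖F p‖ ^ 2) + (1 / 2) * V) :=
    mul_le_mul_of_nonneg_left dys (by linarith)
  have f2 : (1 - δ) * b * ((1 - δ) * ∑ j ∈ s, ‖ℓ (Sk.indicator F) j‖ ^ 2 -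
      (1 / δ) * (4 / R ^ 3 * ∫ p in Skᶜ, ‖F p‖ ^ 2)) ≤ (1 - δ) * b * ∑ j ∈ s, ‖ℓ F j‖ ^ 2 :=
    mul_le_mul_of_nonneg_left hsplit (mul_nonneg (by linarith) b0)
  have f3 : (1 - δ) * b * ((1 / δ) * (4 / R ^ 3 * ∫ p in Skᶜ, ‖F p‖ ^ 2)) ≤
      D * ∫ p in Skᶜ, ‖F p‖ ^ 2 := by
    have : D * ∫ p in Skᶜ, ‖F p‖ ^ 2 =
        (4 * π * a) * ((1 / δ) * (4 / R ^ 3 * ∫ p in Skᶜ, ‖F p‖ ^ 2)) := by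
      rw [hDdef]; field_simp; ring
    rw [this]
    refine mul_le_mul_of_nonneg_right ?_ (by positivity)
    nlinarith
  have f4 : (1 - δ) * ((1 / 2) * V) ≤ (1 / 2) * V := by nlinarith
  linarith

/-- Bounded measurable complex functions. -/
structure BddMeas {α : Type*} [MeasurableSpace α] (F : α → ℂ) : Prop where
  meas : Measurable F
  bdd : ∃ C, ∀ x, ‖F x‖ ≤ C

namespace BddMeas
variable {α β : Type*} [MeasurableSpace α] [MeasurableSpace β] {F G : α → ℂ}

theorem comp (hF : BddMeas F) {g : β → α} (hg : Measurable g) : BddMeas fun x => F (g x) :=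
  ⟨hF.meas.comp hg, hF.bdd.imp fun _ hC x => hC (g x)⟩

theorem mul (hF : BddMeas F) (hG : BddMeas G) : BddMeas fun x => F x * G x := by
  obtain ⟨C, hC⟩ := hF.bdd
  obtain ⟨D, hD⟩ := hG.bdd
  refine ⟨hF.meas.mul hG.meas, C * D, fun x => ?_⟩
  rw [norm_mul]
  exact mul_le_mul (hC x) (hD x) (norm_nonneg _) ((norm_nonneg _).trans (hC x))

theorem sub (hF : BddMeas F) (hG : BddMeas G) : BddMeas fun x => F x - G x := by
  obtain ⟨C, hC⟩ := hF.bdd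
  obtain ⟨D, hD⟩ := hG.bdd
  exact ⟨hF.meas.sub hG.meas, C + D, fun x => (norm_sub_le _ _).trans (add_le_add (hC x) (hD x))⟩

theorem conj (hF : BddMeas F) : BddMeas fun x => (starRingEnd ℂ) (F x) :=
  ⟨Complex.continuous_conj.measurable.comp hF.meas, hF.bdd.imp fun _ hC x => by simpa using hC x⟩

theorem sum {ι : Type*} {s : Finset ι} {F : ι → α → ℂ} (hF : ∀ i ∈ s, BddMeas (F i)) :
    BddMeas fun x => ∑ i ∈ s, F i x := by
  choose! C hC using fun i hi => (hF i hi).bdd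
  refine ⟨Finset.measurable_fun_sum _ fun i hi => (hF i hi).meas, ∑ i ∈ s, C i, fun x => ?_⟩
  exact norm_sum_le_of_le _ fun i hi => hC i hi x

theorem const_mul (hF : BddMeas F) (c : ℂ) : BddMeas fun x => c * F x :=
  mul ⟨measurable_const, ‖c‖, fun _ => le_rfl⟩ hF

theorem integrable (hF : BddMeas F) (μ : Measure α) [IsFiniteMeasure μ] : Integrable F μ := by
  obtain ⟨C, hC⟩ := hF.bdd
  exact Integrable.of_bound hF.meas.aestronglyMeasurable C (.of_forall hC)

theorem integrable_sq (hF : BddMeas F) (μ : Measure α) [IsFiniteMeasure μ] :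
    Integrable (fun x => ‖F x‖ ^ 2) μ := by
  refine (hF.conj.mul hF).integrable μ |>.norm.congr (.of_forall fun x => ?_)
  simp [sq]

theorem integral_right {F : α × β → ℂ} (hF : BddMeas F) (μ : Measure β) [IsFiniteMeasure μ] :
    BddMeas fun x => ∫ y, F (x, y) ∂μ := by
  obtain ⟨C, hC⟩ := hF.bdd
  refine ⟨(hF.meas.stronglyMeasurable.integral_prod_right').measurable, C * μ.real Set.univ,
    fun x => ?_⟩
  exact norm_integral_le_of_norm_le_const (.of_forall fun y => hC _)

end BddMeas

section ExchangeCoordinate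
variable {E : Type*} [MeasurableSpace E] (ν : Measure E) [IsFiniteMeasure ν] {N : ℕ}

/-- Exchanging the `i`-th coordinate with an additional one preserves the product measure. -/
theorem measurePreserving_exchange (i : Fin N) :
    MeasurePreserving (fun z : (Fin N → E) × E => (Function.update z.1 i z.2, z.1 i))
      ((Measure.pi fun _ => ν).prod ν) ((Measure.pi fun _ => ν).prod ν) := by
  obtain _ | n := N
  · exact i.elim0
  have e := measurePreserving_piFinSuccAbove (fun _ : Fin (n + 1) => ν) i
  have m1 := e.prod (MeasurePreserving.id ν)
  have m2 := Measure.measurePreserving_swap (μ := ν.prod (Measure.pi fun _ : Fin n => ν)) (ν := ν)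
  have m3 := (MeasurePreserving.id ν).prod
    (Measure.measurePreserving_swap (μ := ν) (ν := Measure.pi fun _ : Fin n => ν))
  have m4 := (measurePreserving_prodAssoc ν (Measure.pi fun _ : Fin n => ν) ν).symm
  have m5 := (e.symm).prod (MeasurePreserving.id ν)
  convert m5.comp (m4.comp (m3.comp (m2.comp m1))) using 1
  ext z : 1
  refine Prod.ext ?_ rfl
  simp [MeasurableEquiv.piFinSuccAbove, MeasurableEquiv.prodAssoc, Fin.insertNthEquiv,
    Fin.insertNth_removeNth]

theorem measurable_exchange (i : Fin N) :
    Measurable (fun z : (Fin N → E) × E => (Function.update z.1 i z.2, z.1 i)) :=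
  (measurePreserving_exchange (0 : Measure E) i).measurable

theorem measurable_update_prod (i : Fin N) :
    Measurable (fun z : (Fin N → E) × E => Function.update z.1 i z.2) :=
  (measurable_exchange i).fst

theorem integral_exchange (i : Fin N) {G : (Fin N → E) × E → ℂ} (hG : BddMeas G) :
    ∫ z, G (Function.update z.1 i z.2, z.1 i) ∂((Measure.pi fun _ => ν).prod ν) =
      ∫ z, G z ∂((Measure.pi fun _ => ν).prod ν) := by
  have h := measurePreserving_exchange ν i
  conv_rhs => rw [← h.map_eq]
  rw [integral_map h.measurable.aemeasurable hG.meas.aestronglyMeasurable]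

theorem integral_update (i : Fin N) {H : (Fin N → E) → ℂ} (hH : BddMeas H) :
    ∫ X, ∫ x, H (Function.update X i x) ∂ν ∂(Measure.pi fun _ => ν) =
      ν.real Set.univ * ∫ X, H X ∂(Measure.pi fun _ => ν) := by
  have h1 : BddMeas fun z : (Fin N → E) × E => H z.1 := hH.comp measurable_fst
  have h2 : BddMeas fun z : (Fin N → E) × E => H (Function.update z.1 i z.2) :=
    hH.comp (measurable_update_prod i)
  have h := integral_exchange ν i h1
  rw [integral_prod _ (h2.integrable _)] at h
  rw [h, integral_prod _ (h1.integrable _)]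
  simp [integral_const_mul]

end ExchangeCoordinate

section Hole
variable {E : Type*} [MeasurableSpace E] (ν : Measure E) [IsFiniteMeasure ν] {N : ℕ}
  {f : (Fin N → E) → ℂ} {C : Finset (Fin N)} {g : (Fin N → E) → E → ℂ}

theorem integral_overlap (hν : ν.real Set.univ ≠ 0) (hf : BddMeas f)
    (hg : BddMeas fun z : (Fin N → E) × E => g z.1 z.2)
    {i : Fin N} (hgi : ∀ X z, g (Function.update X i z) = g X) :
    ∫ z, (starRingEnd ℂ) (g z.1 z.2 * f z.1) * (g z.1 (z.1 i) * f (Function.update z.1 i z.2))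
        ∂((Measure.pi fun _ => ν).prod ν) =
      (((ν.real Set.univ)⁻¹ * ∫ X, ‖∫ x, (starRingEnd ℂ) (g X x) * f (Function.update X i x) ∂ν‖ ^ 2
        ∂(Measure.pi fun _ => ν) : ℝ) : ℂ) := by
  set I : (Fin N → E) → ℂ := fun X => ∫ x, (starRingEnd ℂ) (g X x) * f (Function.update X i x) ∂ν
    with hI
  have hfu : BddMeas fun z : (Fin N → E) × E => f (Function.update z.1 i z.2) :=
    hf.comp (measurable_update_prod i)
  have hgfu := hg.conj.mul hfu
  have hIb : BddMeas I := hgfu.integral_right ν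
  have hIu : ∀ X z, I (Function.update X i z) = I X := by
    intro X z
    simp only [hI, hgi, Function.update_idem]
  have hgX : BddMeas fun X : Fin N → E => g X (X i) :=
    hg.comp (measurable_id.prodMk (measurable_pi_apply i))
  set H : (Fin N → E) → ℂ := fun X => (starRingEnd ℂ) (f X) * g X (X i) * I X with hH
  have hHb : BddMeas H := (hf.conj.mul hgX).mul hIb
  have hfst := hf.comp (β := (Fin N → E) × E) measurable_fst
  have hInt : Integrable (fun z : (Fin N → E) × E => (starRingEnd ℂ) (g z.1 z.2 * f z.1) *
      (g z.1 (z.1 i) * f (Function.update z.1 i z.2))) ((Measure.pi fun _ => ν).prod ν) := by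
    have := ((hg.mul hfst).conj.mul ((hgX.comp (β := (Fin N → E) × E) measurable_fst).mul hfu))
    exact this.integrable _
  rw [integral_prod _ hInt]
  have e1 : ∀ X, ∫ x, (starRingEnd ℂ) (g X x * f X) *
      (g X (X i) * f (Function.update X i x)) ∂ν = H X := by
    intro X
    rw [hH, hI]
    simp only
    rw [← integral_const_mul]
    congr with x
    simp only [map_mul]; ring
  simp only [e1]
  have h2 := integral_update ν i hHb
  have e3 : ∀ X, ∫ x, H (Function.update X i x) ∂ν = ((‖I X‖ ^ 2 : ℝ) : ℂ) := by
    intro X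
    simp only [hH, hIu, hgi, Function.update_self]
    rw [integral_mul_const]
    have : ∫ x, (starRingEnd ℂ) (f (Function.update X i x)) * g X x ∂ν = (starRingEnd ℂ) (I X) := by
      rw [hI]
      simp only
      rw [← integral_conj]
      congr with x
      simp [mul_comm]
    rw [this, Complex.conj_mul']
    push_cast; rfl
  simp only [e3] at h2
  rw [integral_complex_ofReal] at h2
  rw [Complex.ofReal_mul, h2]
  push_cast
  rw [← mul_assoc, inv_mul_cancel₀ (by exact_mod_cast hν), one_mul]

/-- The norm of the state with one additional particle in the orbital `g`, for a function
antisymmetric in the coordinates in `C`. -/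
theorem integral_norm_sq_hole (hν : ν.real Set.univ ≠ 0) (hf : BddMeas f)
    (hanti : ∀ i ∈ C, ∀ k ∈ C, i ≠ k → ∀ X, f (X ∘ Equiv.swap i k) = -f X)
    (hg : BddMeas fun z : (Fin N → E) × E => g z.1 z.2)
    (hgC : ∀ i ∈ C, ∀ X z, g (Function.update X i z) = g X) :
    ∫ z, ‖g z.1 z.2 * f z.1 - ∑ i ∈ C, g z.1 (z.1 i) * f (Function.update z.1 i z.2)‖ ^ 2
        ∂((Measure.pi fun _ => ν).prod ν) =
      (C.card + 1) * ((∫ z, ‖g z.1 z.2‖ ^ 2 * ‖f z.1‖ ^ 2 ∂((Measure.pi fun _ => ν).prod ν)) -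
        ∑ i ∈ C, (ν.real Set.univ)⁻¹ *
          ∫ X, ‖∫ x, (starRingEnd ℂ) (g X x) * f (Function.update X i x) ∂ν‖ ^ 2
            ∂(Measure.pi fun _ => ν)) := by
  set P := (Measure.pi fun _ : Fin N => ν).prod ν with hP
  set A : Fin N → ℝ := fun i => (ν.real Set.univ)⁻¹ *
          ∫ X, ‖∫ x, (starRingEnd ℂ) (g X x) * f (Function.update X i x) ∂ν‖ ^ 2
            ∂(Measure.pi fun _ => ν) with hA
  set t₀ : (Fin N → E) × E → ℂ := fun z => g z.1 z.2 * f z.1 with ht₀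
  set t : Fin N → (Fin N → E) × E → ℂ := fun i z =>
    g z.1 (z.1 i) * f (Function.update z.1 i z.2) with ht
  have b₀ : BddMeas t₀ := hg.mul (hf.comp measurable_fst)
  have b : ∀ i, BddMeas (t i) := fun i =>
    (hg.comp (measurable_fst.prodMk ((measurable_pi_apply i).comp measurable_fst))).mul
      (hf.comp (measurable_update_prod i))
  have c0i : ∀ i ∈ C, ∫ z, (starRingEnd ℂ) (t₀ z) * t i z ∂P = (A i : ℂ) := fun i hi =>
    integral_overlap ν hν hf hg (hgC i hi)
  have ci0 : ∀ i ∈ C, ∫ z, (starRingEnd ℂ) (t i z) * t₀ z ∂P = (A i : ℂ) := by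
    intro i hi
    have := congrArg (starRingEnd ℂ) (c0i i hi)
    rw [← integral_conj, Complex.conj_ofReal] at this
    rw [← this]
    congr with z
    simp [mul_comm]
  have hti : ∀ i ∈ C, ∀ z : (Fin N → E) × E, t i (Function.update z.1 i z.2, z.1 i) = t₀ z := by
    intro i hi z
    simp [ht, ht₀, hgC i hi]
  have htk : ∀ i ∈ C, ∀ k ∈ C, i ≠ k → ∀ z : (Fin N → E) × E,
      t k (Function.update z.1 i z.2, z.1 i) = - t k z := by
    intro i hi k hk hik z
    simp only [ht, hgC i hi, Function.update_of_ne hik.symm]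
    rw [← mul_neg, ← hanti i hi k hk hik]
    congr 2
    ext l
    simp only [Function.comp]
    rcases eq_or_ne l i with rfl | h1
    · rw [Equiv.swap_apply_left, Function.update_self, Function.update_of_ne hik,
        Function.update_self]
    · rcases eq_or_ne l k with rfl | h2
      · rw [Equiv.swap_apply_right, Function.update_self, Function.update_of_ne hik]
      · rw [Equiv.swap_apply_of_ne_of_ne h1 h2, Function.update_of_ne h2, Function.update_of_ne h1,
          Function.update_of_ne h2]
  have cii : ∀ i ∈ C, ∫ z, (starRingEnd ℂ) (t i z) * t i z ∂P =
      ∫ z, (starRingEnd ℂ) (t₀ z) * t₀ z ∂P := by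
    intro i hi
    rw [← integral_exchange ν i ((b i).conj.mul (b i))]
    congr with z
    rw [hti i hi]
  have cik : ∀ i ∈ C, ∀ k ∈ C, i ≠ k → ∫ z, (starRingEnd ℂ) (t i z) * t k z ∂P = -(A k : ℂ) := by
    intro i hi k hk hik
    rw [← integral_exchange ν i ((b i).conj.mul (b k)), ← c0i k hk, ← integral_neg]
    congr with z
    rw [hti i hi, htk i hi k hk hik, mul_neg]
  have expand : ∀ z, (((‖t₀ z - ∑ i ∈ C, t i z‖ ^ 2 : ℝ)) : ℂ) =
      (starRingEnd ℂ) (t₀ z) * t₀ z - ∑ i ∈ C, (starRingEnd ℂ) (t₀ z) * t i z -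
      ∑ i ∈ C, (starRingEnd ℂ) (t i z) * t₀ z +
      ∑ i ∈ C, ∑ k ∈ C, (starRingEnd ℂ) (t i z) * t k z := by
    intro z
    push_cast
    rw [← Complex.conj_mul', map_sub, map_sum, ← Finset.mul_sum, ← Finset.sum_mul,
      ← Finset.sum_mul_sum]
    ring
  apply Complex.ofReal_injective
  rw [← integral_complex_ofReal]
  refine (integral_congr_ae (.of_forall expand)).trans ?_
  have i1 := (b₀.conj.mul b₀).integrable P
  have i2 : ∀ i ∈ C, Integrable (fun z => (starRingEnd ℂ) (t₀ z) * t i z) P := fun i _ =>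
    (b₀.conj.mul (b i)).integrable P
  have i3 : ∀ i ∈ C, Integrable (fun z => (starRingEnd ℂ) (t i z) * t₀ z) P := fun i _ =>
    ((b i).conj.mul b₀).integrable P
  have i4 : ∀ i ∈ C, ∀ k ∈ C, Integrable (fun z => (starRingEnd ℂ) (t i z) * t k z) P :=
    fun i _ k _ => ((b i).conj.mul (b k)).integrable P
  have s2 := integrable_finsetSum C i2
  have s3 := integrable_finsetSum C i3
  have s4 : ∀ i ∈ C, Integrable (fun z => ∑ k ∈ C, (starRingEnd ℂ) (t i z) * t k z) P :=
    fun i hi => integrable_finsetSum C (i4 i hi)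
  have s12 : Integrable (fun z => (starRingEnd ℂ) (t₀ z) * t₀ z -
      ∑ i ∈ C, (starRingEnd ℂ) (t₀ z) * t i z) P := i1.sub s2
  have s123 : Integrable (fun z => (starRingEnd ℂ) (t₀ z) * t₀ z -
      ∑ i ∈ C, (starRingEnd ℂ) (t₀ z) * t i z - ∑ i ∈ C, (starRingEnd ℂ) (t i z) * t₀ z) P :=
    s12.sub s3
  rw [integral_add s123 (integrable_finsetSum C s4), integral_sub s12 s3,
    integral_sub i1 s2, integral_finsetSum C i2, integral_finsetSum C i3,
    integral_finsetSum C s4, Finset.sum_congr rfl c0i, Finset.sum_congr rfl ci0]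
  have e4 : ∀ i ∈ C, ∫ z, ∑ k ∈ C, (starRingEnd ℂ) (t i z) * t k z ∂P =
      ∫ z, (starRingEnd ℂ) (t₀ z) * t₀ z ∂P - ∑ k ∈ C, (A k : ℂ) + A i := by
    intro i hi
    rw [integral_finsetSum C (i4 i hi), ← Finset.add_sum_erase C _ hi, cii i hi,
      Finset.sum_congr rfl fun k hk => cik i hi k (Finset.mem_of_mem_erase hk)
        (Finset.ne_of_mem_erase hk).symm, Finset.sum_neg_distrib,
      ← Finset.add_sum_erase C (fun k => (A k : ℂ)) hi]
    ring
  rw [Finset.sum_congr rfl e4, Finset.sum_add_distrib, Finset.sum_const, nsmul_eq_mul]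
  have e0 : ∫ z, (starRingEnd ℂ) (t₀ z) * t₀ z ∂P =
      ((∫ z, ‖g z.1 z.2‖ ^ 2 * ‖f z.1‖ ^ 2 ∂P : ℝ) : ℂ) := by
    rw [← integral_complex_ofReal]
    congr with z
    rw [Complex.conj_mul', ht₀]
    push_cast
    rw [norm_mul]; push_cast; ring
  rw [e0]
  push_cast
  ring

/-- Pauli principle: the occupation of an orbital is at most one. -/
theorem sum_occupation_le (hν : ν.real Set.univ ≠ 0) (hf : BddMeas f)
    (hanti : ∀ i ∈ C, ∀ k ∈ C, i ≠ k → ∀ X, f (X ∘ Equiv.swap i k) = -f X)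
    (hg : BddMeas fun z : (Fin N → E) × E => g z.1 z.2)
    (hgC : ∀ i ∈ C, ∀ X z, g (Function.update X i z) = g X) :
    ∑ i ∈ C, (ν.real Set.univ)⁻¹ *
          ∫ X, ‖∫ x, (starRingEnd ℂ) (g X x) * f (Function.update X i x) ∂ν‖ ^ 2
            ∂(Measure.pi fun _ => ν) ≤
      ∫ z, ‖g z.1 z.2‖ ^ 2 * ‖f z.1‖ ^ 2 ∂((Measure.pi fun _ => ν).prod ν) := by
  have h := integral_norm_sq_hole ν hν hf hanti hg hgC
  have h0 : 0 ≤ ∫ z, ‖g z.1 z.2 * f z.1 - ∑ i ∈ C, g z.1 (z.1 i) *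
      f (Function.update z.1 i z.2)‖ ^ 2 ∂((Measure.pi fun _ => ν).prod ν) :=
    integral_nonneg fun z => by positivity
  rw [h] at h0
  have := nonneg_of_mul_nonneg_right h0 (by positivity)
  linarith

end Hole

namespace BddMeas
variable {α β : Type*} [MeasurableSpace α] [MeasurableSpace β]

theorem swap_integral {F : α × β → ℂ} (hF : BddMeas F) (μ : Measure α) (ν : Measure β)
    [IsFiniteMeasure μ] [IsFiniteMeasure ν] :
    ∫ x, ∫ y, F (x, y) ∂ν ∂μ = ∫ y, ∫ x, F (x, y) ∂μ ∂ν :=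
  integral_integral_swap (f := fun x y => F (x, y)) (hF.integrable _)

theorem integral_right_sq {F : α × β → ℂ} (hF : BddMeas F) (μ : Measure α) (ν : Measure β)
    [IsFiniteMeasure μ] [IsFiniteMeasure ν] :
    Integrable (fun x => ∫ y, ‖F (x, y)‖ ^ 2 ∂ν) μ :=
  (hF.integrable_sq (μ.prod ν)).integral_prod_left

theorem swap_integral_sq {F : α × β → ℂ} (hF : BddMeas F) (μ : Measure α) (ν : Measure β)
    [IsFiniteMeasure μ] [IsFiniteMeasure ν] :
    ∫ x, ∫ y, ‖F (x, y)‖ ^ 2 ∂ν ∂μ = ∫ y, ∫ x, ‖F (x, y)‖ ^ 2 ∂μ ∂ν :=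
  integral_integral_swap (f := fun x y => ‖F (x, y)‖ ^ 2) (hF.integrable_sq _)

end BddMeas

section HoleBessel
variable {E : Type*} [MeasurableSpace E] (ν : Measure E) [IsFiniteMeasure ν] {N : ℕ}
  {f : (Fin N → E) → ℂ} {C : Finset (Fin N)}
  {Q : Type*} [MeasurableSpace Q] (μ : Measure Q) [IsFiniteMeasure μ] {ι : Type*} {s : Finset ι}
  {e : Q → E → ℂ} {b : ι → (Fin N → E) → Q → ℂ} {B : ℝ}

/-- A Bessel inequality for the orbitals `b j` on the holes of an antisymmetric function. -/
theorem sum_hole_le (hν : ν.real Set.univ ≠ 0) (hf : BddMeas f)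
    (hanti : ∀ i ∈ C, ∀ k ∈ C, i ≠ k → ∀ X, f (X ∘ Equiv.swap i k) = -f X)
    (he : BddMeas fun z : Q × E => e z.1 z.2)
    (hb : ∀ j ∈ s, BddMeas fun z : (Fin N → E) × Q => b j z.1 z.2)
    (hbC : ∀ j ∈ s, ∀ i ∈ C, ∀ X z, b j (Function.update X i z) = b j X)
    (hB : ∀ X, ∀ F : Q → ℂ, BddMeas F →
      ∑ j ∈ s, ‖∫ p, b j X p * F p ∂μ‖ ^ 2 ≤ B * ∫ p, ‖F p‖ ^ 2 ∂μ) :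
    ∑ j ∈ s, ((∫ z, ‖∫ p, (starRingEnd ℂ) (b j z.1 p) * e p z.2 ∂μ‖ ^ 2 * ‖f z.1‖ ^ 2
          ∂((Measure.pi fun _ => ν).prod ν)) -
        ∑ i ∈ C, (ν.real Set.univ)⁻¹ * ∫ X, ‖∫ p, b j X p *
          (∫ x, (starRingEnd ℂ) (e p x) * f (Function.update X i x) ∂ν) ∂μ‖ ^ 2
            ∂(Measure.pi fun _ => ν)) ≤
      B * ∫ p, ((∫ z, ‖e p z.2‖ ^ 2 * ‖f z.1‖ ^ 2 ∂((Measure.pi fun _ => ν).prod ν)) -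
        ∑ i ∈ C, (ν.real Set.univ)⁻¹ *
          ∫ X, ‖∫ x, (starRingEnd ℂ) (e p x) * f (Function.update X i x) ∂ν‖ ^ 2
            ∂(Measure.pi fun _ => ν)) ∂μ := by
  set P := (Measure.pi fun _ : Fin N => ν).prod ν with hP
  set G : (Fin N → E) × E → Q → ℂ := fun z p =>
    e p z.2 * f z.1 - ∑ i ∈ C, e p (z.1 i) * f (Function.update z.1 i z.2) with hG
  have hGb : BddMeas fun w : ((Fin N → E) × E) × Q => G w.1 w.2 := by
    refine ((he.comp (measurable_snd.prodMk measurable_fst.snd)).mul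
      (hf.comp measurable_fst.fst)).sub (BddMeas.sum fun i _ => ?_)
    exact (he.comp (measurable_snd.prodMk ((measurable_pi_apply i).comp measurable_fst.fst))).mul
      (hf.comp ((measurable_update_prod i).comp measurable_fst))
  have hcard : (0 : ℝ) < C.card + 1 := by positivity
  refine le_of_mul_le_mul_left ?_ hcard
  rw [← mul_assoc, mul_comm _ B, mul_assoc, ← integral_const_mul, Finset.mul_sum]
  have hep : ∀ p, BddMeas fun z : (Fin N → E) × E => (fun _ : Fin N → E => e p) z.1 z.2 :=
    fun p => he.comp (measurable_const.prodMk measurable_snd)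
  have e2 : ∀ p, (C.card + 1 : ℝ) * ((∫ z, ‖e p z.2‖ ^ 2 * ‖f z.1‖ ^ 2 ∂P) -
        ∑ i ∈ C, (ν.real Set.univ)⁻¹ *
          ∫ X, ‖∫ x, (starRingEnd ℂ) (e p x) * f (Function.update X i x) ∂ν‖ ^ 2
            ∂(Measure.pi fun _ => ν)) = ∫ z, ‖G z p‖ ^ 2 ∂P := fun p =>
    (integral_norm_sq_hole (g := fun _ => e p) ν hν hf hanti (hep p) fun _ _ _ _ => rfl).symm
  rw [integral_congr_ae (.of_forall e2)]
  have hbe : ∀ j ∈ s, BddMeas fun w : ((Fin N → E) × E) × Q =>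
      (starRingEnd ℂ) (b j w.1.1 w.2) * e w.2 w.1.2 := fun j hj =>
    ((hb j hj).comp (measurable_fst.fst.prodMk measurable_snd)).conj.mul
      (he.comp (measurable_snd.prodMk measurable_fst.snd))
  have e1 : ∀ j ∈ s, (C.card + 1 : ℝ) *
      ((∫ z, ‖∫ p, (starRingEnd ℂ) (b j z.1 p) * e p z.2 ∂μ‖ ^ 2 * ‖f z.1‖ ^ 2 ∂P) -
        ∑ i ∈ C, (ν.real Set.univ)⁻¹ * ∫ X, ‖∫ p, b j X p *
          (∫ x, (starRingEnd ℂ) (e p x) * f (Function.update X i x) ∂ν) ∂μ‖ ^ 2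
            ∂(Measure.pi fun _ => ν)) =
      ∫ z, ‖∫ p, b j z.1 p * (starRingEnd ℂ) (G z p) ∂μ‖ ^ 2 ∂P := by
    intro j hj
    have h := integral_norm_sq_hole (C := C)
      (g := fun X x => ∫ p, (starRingEnd ℂ) (b j X p) * e p x ∂μ) ν hν hf hanti
      ((hbe j hj).integral_right μ) (fun i hi X z => by simp only [hbC j hj i hi])
    have h1 : ∀ i X, ∫ x, (starRingEnd ℂ) (∫ p, (starRingEnd ℂ) (b j X p) * e p x ∂μ) *
        f (Function.update X i x) ∂ν = ∫ p, b j X p *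
          (∫ x, (starRingEnd ℂ) (e p x) * f (Function.update X i x) ∂ν) ∂μ := by
      intro i X
      have hF : BddMeas fun w : Q × E =>
          b j X w.1 * ((starRingEnd ℂ) (e w.1 w.2) * f (Function.update X i w.2)) :=
        ((hb j hj).comp (measurable_const.prodMk measurable_fst)).mul
          (he.conj.mul (hf.comp ((measurable_update_prod i).comp
            (measurable_const.prodMk measurable_snd))))
      have := hF.swap_integral μ ν
      simp only [integral_const_mul] at this
      rw [this]
      congr with x
      rw [← integral_conj, ← integral_mul_const]
      congr with p
      simp only [map_mul, Complex.conj_conj]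
      ring
    simp only [h1] at h
    rw [← h]
    congr with z
    congr 1
    rw [← Complex.norm_conj, ← integral_mul_const]
    have hbf : ∀ x : E, BddMeas fun p => (starRingEnd ℂ) (b j z.1 p) * e p x := fun x =>
      (hbe j hj).comp (g := fun p => ((z.1, x), p)) (measurable_const.prodMk measurable_id)
    have h2 : ∀ i ∈ C, (∫ p, (starRingEnd ℂ) (b j z.1 p) * e p (z.1 i) ∂μ) *
        f (Function.update z.1 i z.2) =
        ∫ p, (starRingEnd ℂ) (b j z.1 p) * e p (z.1 i) * f (Function.update z.1 i z.2) ∂μ :=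
      fun i _ => (integral_mul_const _ _).symm
    have i2 : ∀ i ∈ C, Integrable (fun p => (starRingEnd ℂ) (b j z.1 p) * e p (z.1 i) *
        f (Function.update z.1 i z.2)) μ := fun i _ => ((hbf _).integrable μ).mul_const _
    rw [Finset.sum_congr rfl h2, ← integral_finsetSum _ i2,
      ← integral_sub (((hbf _).integrable μ).mul_const _) (integrable_finsetSum _ i2),
      ← integral_conj]
    congr 1
    congr with p
    simp only [hG, map_sub, map_mul, map_sum, Complex.conj_conj, mul_sub, Finset.mul_sum]
    congr 1
    · ring
    · exact Finset.sum_congr rfl fun i _ => by ring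
  rw [Finset.sum_congr rfl e1]
  have hbG : ∀ j ∈ s, BddMeas fun w : ((Fin N → E) × E) × Q =>
      b j w.1.1 w.2 * (starRingEnd ℂ) (G w.1 w.2) := fun j hj =>
    ((hb j hj).comp (measurable_fst.fst.prodMk measurable_snd)).mul hGb.conj
  rw [← integral_finsetSum _ fun j hj => ((hbG j hj).integral_right μ).integrable_sq P,
    ← hGb.swap_integral_sq P μ, ← integral_const_mul]
  refine integral_mono (integrable_finsetSum _ fun j hj =>
    ((hbG j hj).integral_right μ).integrable_sq P) ((hGb.integral_right_sq P μ).const_mul B)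
    fun z => ?_
  have := hB z.1 (fun p => (starRingEnd ℂ) (G z p))
    (hGb.conj.comp (g := fun p => (z, p)) (measurable_const.prodMk measurable_id))
  simpa using this

end HoleBessel

/-- The function of the `i`-th coordinate, the other ones being frozen. -/
def slice {N : ℕ} (f : (Fin N → R3) → ℂ) (i : Fin N) (X : Fin N → R3) : R3 → ℂ :=
  fun x => f (Function.update X i x)

/-- Squared gradient in the `i`-th coordinate. -/
def gradSqAt {N : ℕ} (f : (Fin N → R3) → ℂ) (i : Fin N) (X : Fin N → R3) : ℝ :=
  gradSq (slice f i X) (X i)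

/-- Smooth functions supported in the box. -/
structure IsTest {N : ℕ} (L : ℝ) (f : (Fin N → R3) → ℂ) : Prop where
  smooth : ContDiff ℝ (⊤ : ℕ∞) f
  supp : tsupport f ⊆ {X | ∀ i, X i ∈ openCube L}

theorem isBounded_openCube (L : ℝ) : Bornology.IsBounded (openCube L) := by
  have h : openCube L ⊆ (EuclideanSpace.equiv (Fin 3) ℝ) ⁻¹' (Set.Icc 0 (fun _ => L)) := by
    intro x hx
    exact ⟨fun j => (hx j).1.le, fun j => (hx j).2.le⟩
  refine Bornology.IsBounded.subset ?_ h
  exact ((EuclideanSpace.equiv (Fin 3) ℝ).toHomeomorph.isCompact_preimage.2 isCompact_Icc).isBounded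

namespace IsTest
variable {N : ℕ} {L : ℝ} {f : (Fin N → R3) → ℂ}

theorem hasCompactSupport (h : IsTest L f) : HasCompactSupport f := by
  have hb : Bornology.IsBounded {X : Fin N → R3 | ∀ i, X i ∈ openCube L} := by
    have := Bornology.IsBounded.pi (fun _ : Fin N => isBounded_openCube L)
    refine this.subset fun X hX i _ => hX i
  exact Metric.isCompact_of_isClosed_isBounded (isClosed_tsupport f) (hb.subset h.supp)

theorem bddMeas (h : IsTest L f) : BddMeas f := by
  refine ⟨h.smooth.continuous.measurable, ?_⟩
  exact h.hasCompactSupport.exists_bound_of_continuous h.smooth.continuous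

theorem eq_zero (h : IsTest L f) {X : Fin N → R3} {i : Fin N} (hX : X i ∉ openCube L) : f X = 0 := by
  by_contra h0
  exact hX (h.supp (subset_tsupport f h0) i)

theorem smooth_slice (h : IsTest L f) (i : Fin N) (X : Fin N → R3) :
    ContDiff ℝ (⊤ : ℕ∞) (slice f i X) :=
  h.smooth.comp (contDiff_update _ X i)

theorem hasCompactSupport_slice (h : IsTest L f) (i : Fin N) (X : Fin N → R3) :
    HasCompactSupport (slice f i X) := by
  refine HasCompactSupport.of_support_subset_isCompact
    (K := closure (openCube L)) (isBounded_openCube L).isCompact_closure ?_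
  intro x hx
  refine subset_closure ?_
  by_contra hc
  exact hx (h.eq_zero (i := i) (by simpa using hc))

theorem gradSqAt_eq (h : IsTest L f) (i : Fin N) (X : Fin N → R3) :
    gradSqAt f i X =
      ∑ j : Fin 3, ‖fderiv ℝ f X (Pi.single i (EuclideanSpace.single j 1))‖ ^ 2 := by
  unfold gradSqAt gradSq slice
  refine Finset.sum_congr rfl fun j _ => ?_
  have h1 : HasFDerivAt (fun x => f (Function.update X i x))
      ((fderiv ℝ f X).comp (ContinuousLinearMap.pi (Pi.single i (.id ℝ R3)))) (X i) := by
    refine HasFDerivAt.comp (X i) ?_ (hasFDerivAt_update X (X i))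
    rw [Function.update_eq_self]
    exact (h.smooth.differentiable (by simp)).differentiableAt.hasFDerivAt
  rw [h1.fderiv]
  congr 2
  rw [ContinuousLinearMap.comp_apply]
  congr 1
  ext k : 1
  rcases eq_or_ne k i with rfl | hk
  · simp
  · simp [hk]

theorem gradSq_slice (f : (Fin N → R3) → ℂ) (i : Fin N) (X : Fin N → R3) (x : R3) :
    gradSq (slice f i X) x = gradSqAt f i (Function.update X i x) := by
  have : slice f i (Function.update X i x) = slice f i X := by
    funext y
    simp [slice]
  rw [gradSqAt, this, Function.update_self]

theorem continuous_gradSqAt (h : IsTest L f) (i : Fin N) : Continuous (gradSqAt f i) := by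
  rw [funext (h.gradSqAt_eq i)]
  have := h.smooth.continuous_fderiv (by simp)
  fun_prop

theorem gradSqAt_eq_zero (h : IsTest L f) (i : Fin N) {X : Fin N → R3} {k : Fin N}
    (hX : X k ∉ openCube L) : gradSqAt f i X = 0 := by
  have : fderiv ℝ f X = 0 := by
    by_contra h0
    exact hX (h.supp (support_fderiv_subset ℝ h0) k)
  simp [h.gradSqAt_eq, this]

theorem bddMeas_gradSqAt (h : IsTest L f) (i : Fin N) :
    BddMeas fun X => (gradSqAt f i X : ℂ) := by
  refine ⟨Complex.measurable_ofReal.comp (h.continuous_gradSqAt i).measurable, ?_⟩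
  have : HasCompactSupport (gradSqAt f i) := by
    refine HasCompactSupport.of_support_subset_isCompact h.hasCompactSupport fun X hX => ?_
    by_contra hc
    refine hX ?_
    have : fderiv ℝ f X = 0 := by
      by_contra h0
      exact hc (support_fderiv_subset ℝ h0)
    simp [h.gradSqAt_eq, this]
  obtain ⟨C, hC⟩ := this.exists_bound_of_continuous (h.continuous_gradSqAt i)
  exact ⟨C, fun X => by simpa using hC X⟩

end IsTest

theorem setIntegral_eq_of_supported {E : Type*} [NormedAddCommGroup E] [NormedSpace ℝ E]
    {L : ℝ} {B : Set R3} (hB : openCube L ⊆ B) {g : R3 → E}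
    (hg : ∀ x, x ∉ openCube L → g x = 0) : ∫ x in B, g x = ∫ x, g x :=
  setIntegral_eq_integral_of_forall_compl_eq_zero fun x hx => hg x fun hc => hx (hB hc)

theorem integral_pi_eq_of_supported {E : Type*} [NormedAddCommGroup E] [NormedSpace ℝ E]
    {N : ℕ} {L : ℝ} {B : Set R3} (hB : openCube L ⊆ B) {g : (Fin N → R3) → E}
    (hg : ∀ X, (∃ i, X i ∉ openCube L) → g X = 0) :
    ∫ X, g X ∂(Measure.pi fun _ => (volume : Measure R3).restrict B) = ∫ X, g X := by
  rw [← Measure.restrict_pi_pi, volume_pi]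
  refine setIntegral_eq_integral_of_forall_compl_eq_zero fun X hX => hg X ?_
  by_contra hc
  push Not at hc
  exact hX fun i _ => hB (hc i)

/-- The lower bound on the one-body operator with scatterers at separated positions. -/
def OneBodyBound (v κ : R3 → ℝ) (R k k₁ D c : ℝ) : Prop := open FourierTransform in
  ∀ {N : ℕ} (s : Finset (Fin N)) (y : Fin N → R3),
    (∀ j ∈ s, ∀ l ∈ s, j ≠ l → 2 * R ≤ ‖y j - y l‖) →
    ∀ {u : R3 → ℂ}, ContDiff ℝ (⊤ : ℕ∞) u → HasCompactSupport u →
    (∫ p, fermiWeight k k₁ D p * ‖𝓕 u p‖ ^ 2) +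
      c * ∑ j ∈ s, ‖∫ p in {p | ‖p‖ < k}, 𝓕⁻ (fun x => (κ (x - y j) : ℂ)) p * 𝓕 u p‖ ^ 2 ≤
    (∫ x, gradSq u x) + (1 / 2) * ∑ j ∈ s, ∫ x, v (x - y j) * ‖u x‖ ^ 2

/-- The plane wave. -/
def wave (p x : R3) : ℂ := (fourierChar ⟪x, p⟫ : ℂ)

theorem norm_wave (p x : R3) : ‖wave p x‖ = 1 := Circle.norm_coe _

theorem bddMeas_wave : BddMeas fun z : R3 × R3 => wave z.1 z.2 := by
  refine ⟨?_, 1, fun z => (norm_wave _ _).le⟩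
  have : Continuous fun z : R3 × R3 => wave z.1 z.2 :=
    continuous_subtype_val.comp (continuous_fourierChar.comp (continuous_snd.inner continuous_fst))
  exact this.measurable

open Classical in
/-- The indices outside `C` of particles separated from all others outside `C`. -/
def goodSet {N : ℕ} (R : ℝ) (C : Finset (Fin N)) (X : Fin N → R3) : Finset (Fin N) :=
  Cᶜ.filter fun j => ∀ l ∈ Cᶜ, j ≠ l → 2 * R ≤ ‖X j - X l‖

open Classical in
/-- Fourier profile of the scatterer `j`, if that is well separated from the other ones. -/
def goodProfile {N : ℕ} (κ : R3 → ℝ) (R : ℝ) (C : Finset (Fin N)) (j : Fin N) (X : Fin N → R3)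
    (p : R3) : ℂ := open FourierTransform in
  if j ∈ goodSet R C X then 𝓕⁻ (fun x => (κ (x - X j) : ℂ)) p else 0

theorem goodSet_update {N : ℕ} (R : ℝ) (C : Finset (Fin N)) {i : Fin N} (hi : i ∈ C)
    (X : Fin N → R3) (z : R3) : goodSet R C (Function.update X i z) = goodSet R C X := by
  ext j
  simp only [goodSet, Finset.mem_filter, Finset.mem_compl]
  refine and_congr_right fun hj => forall₂_congr fun l hl => ?_
  rw [Function.update_of_ne (by rintro rfl; exact hj hi),
    Function.update_of_ne (by rintro rfl; exact hl hi)]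

theorem goodProfile_update {N : ℕ} (κ : R3 → ℝ) (R : ℝ) (C : Finset (Fin N)) {j : Fin N}
    (hj : j ∈ Cᶜ) {i : Fin N} (hi : i ∈ C) (X : Fin N → R3) (z : R3) :
    goodProfile κ R C j (Function.update X i z) = goodProfile κ R C j X := by
  funext p
  unfold goodProfile
  rw [goodSet_update R C hi, Function.update_of_ne]
  rintro rfl
  exact Finset.mem_compl.1 hj hi

theorem measurableSet_mem_goodSet {N : ℕ} (R : ℝ) (C : Finset (Fin N)) (j : Fin N) :
    MeasurableSet {X : Fin N → R3 | j ∈ goodSet R C X} := by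
  classical
  simp only [goodSet, Finset.mem_filter, Set.ofPred_and, Set.ofPred_forall]
  refine .inter (.const _) (.iInter fun l => .iInter fun _ => .iInter fun _ => ?_)
  exact measurableSet_le measurable_const (by fun_prop)

open FourierTransform in
theorem bddMeas_goodProfile {N : ℕ} {κ : R3 → ℝ} (hκi : Integrable κ) (R : ℝ)
    (C : Finset (Fin N)) (j : Fin N) :
    BddMeas fun z : (Fin N → R3) × R3 => goodProfile κ R C j z.1 z.2 := by
  classical
  constructor
  · refine Measurable.ite (measurable_fst (measurableSet_mem_goodSet R C j)) ?_ measurable_const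
    have : (fun z : (Fin N → R3) × R3 => 𝓕⁻ (fun x => (κ (x - z.1 j) : ℂ)) z.2) =
        fun z => wave z.2 (z.1 j) * 𝓕⁻ (fun x => (κ x : ℂ)) z.2 := by
      funext z
      exact fourierInv_translate (fun x => (κ x : ℂ)) (z.1 j) z.2
    rw [this]
    have hg : Measurable fun z : (Fin N → R3) × R3 => (z.2, z.1 j) := by fun_prop
    have h1 : Measurable fun z : (Fin N → R3) × R3 => wave z.2 (z.1 j) := by
      have := bddMeas_wave.comp hg
      exact this.meas
    refine h1.mul ?_
    exact (continuous_fourierInv_of_integrable hκi.ofReal).measurable.comp measurable_snd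
  · refine ⟨∫ x, ‖κ x‖, fun z => ?_⟩
    unfold goodProfile
    split_ifs
    · refine (norm_fourierInv_le _ _).trans (le_of_eq ?_)
      simp only [Complex.norm_real]
      exact integral_sub_right_eq_self (fun x => ‖κ x‖) _
    · simp only [norm_zero]
      positivity

open FourierTransform in
theorem sum_norm_sq_goodProfile_le {N : ℕ} {κ : R3 → ℝ} {R k : ℝ} (C : Finset (Fin N))
    (X : Fin N → R3) (hR : 0 < R) (hK : 4 * π * R * k ≤ 1)
    (hκi : Integrable κ) (hκ0 : ∀ x, 0 ≤ κ x) (hκ1 : ∫ x, κ x = 1)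
    {F : R3 → ℂ} (hF : BddMeas F) :
    ∑ j ∈ Cᶜ, ‖∫ p in {p | ‖p‖ < k}, goodProfile κ R C j X p * F p‖ ^ 2 ≤
      4 / R ^ 3 * ∫ p in {p | ‖p‖ < k}, ‖F p‖ ^ 2 := by
  classical
  have mS := measurableSet_norm_lt k
  have hfin : volume {p : R3 | ‖p‖ < k} ≠ ⊤ := by
    have : {p : R3 | ‖p‖ < k} = Metric.ball 0 k := by ext; simp
    rw [this]; exact measure_ball_lt_top.ne
  have hFm : MemLp ({p : R3 | ‖p‖ < k}.indicator F) 2 := by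
    obtain ⟨c, hc⟩ := hF.bdd
    have : IsFiniteMeasure (volume.restrict {p : R3 | ‖p‖ < k}) := ⟨by
      simpa [lt_top_iff_ne_top] using hfin⟩
    rw [memLp_indicator_iff_restrict mS]
    exact MemLp.of_bound hF.meas.aestronglyMeasurable c (.of_forall hc)
  have h := sum_norm_sq_mixedProfile_le (goodSet R C X) X hR
    (fun j hj l hl hjl => (Finset.mem_filter.1 hj).2 l (Finset.mem_filter.1 hl).1 hjl)
    hK hκi hκ0 hκ1 hFm
  have e1 : ∫ p, ‖{p : R3 | ‖p‖ < k}.indicator F p‖ ^ 2 = ∫ p in {p | ‖p‖ < k}, ‖F p‖ ^ 2 := by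
    rw [← integral_indicator mS]
    congr with p
    by_cases hp : p ∈ {p : R3 | ‖p‖ < k} <;> simp [hp]
  rw [e1] at h
  refine le_trans (le_of_eq ?_) h
  rw [← Finset.sum_subset (Finset.filter_subset _ _ : goodSet R C X ⊆ Cᶜ)]
  · refine Finset.sum_congr rfl fun j hj => ?_
    rw [← integral_indicator mS]
    congr 3
    funext p
    by_cases hp : p ∈ {p : R3 | ‖p‖ < k}
    · have hp' : ‖p‖ < k := hp
      simp [hp, goodProfile, hj, mixedProfile, hp']
    · simp [hp]
  · intro j _ hj
    have hj' : j ∉ goodSet R C X := hj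
    simp [goodProfile, hj']

/-- The part of the constant weight missing in `fermiWeight`. -/
def fermiDeficit (k D : ℝ) (p : R3) : ℝ :=
  if ‖p‖ < k then 4 * π ^ 2 * (k ^ 2 - ‖p‖ ^ 2) else D

theorem fermiDeficit_nonneg {k D : ℝ} (hD : 0 ≤ D) (p : R3) :
    0 ≤ fermiDeficit k D p := by
  unfold fermiDeficit
  split_ifs with h
  · have := norm_nonneg p
    have : ‖p‖ ^ 2 ≤ k ^ 2 := by gcongr
    have : 0 ≤ k ^ 2 - ‖p‖ ^ 2 := by linarith
    positivity
  · exact hD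

theorem measurable_fermiDeficit (k D : ℝ) : Measurable (fermiDeficit k D) :=
  Measurable.ite (measurableSet_norm_lt k) (by fun_prop) measurable_const

theorem fermiDeficit_le {k D : ℝ} (hD : 0 ≤ D) (p : R3) :
    fermiDeficit k D p ≤ 4 * π ^ 2 * k ^ 2 + D := by
  unfold fermiDeficit
  split_ifs with h
  · have : 0 ≤ 4 * π ^ 2 * ‖p‖ ^ 2 := by positivity
    linarith
  · have : 0 ≤ 4 * π ^ 2 * k ^ 2 := by positivity
    linarith

theorem bddMeas_sqrt_fermiDeficit {k D : ℝ} (hD : 0 ≤ D) :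
    BddMeas fun p => (√(fermiDeficit k D p) : ℂ) := by
  refine ⟨Complex.measurable_ofReal.comp (measurable_fermiDeficit k D).sqrt,
    √(4 * π ^ 2 * k ^ 2 + D), fun p => ?_⟩
  rw [Complex.norm_real, norm_of_nonneg (Real.sqrt_nonneg _)]
  exact Real.sqrt_le_sqrt (fermiDeficit_le hD p)

theorem volume_norm_lt_ne_top (k : ℝ) : volume {p : R3 | ‖p‖ < k} ≠ ⊤ := by
  have : {p : R3 | ‖p‖ < k} = Metric.ball 0 k := by ext; simp
  rw [this]; exact measure_ball_lt_top.ne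

instance (k : ℝ) : IsFiniteMeasure ((volume : Measure R3).restrict {p : R3 | ‖p‖ < k}) :=
  ⟨by simpa [lt_top_iff_ne_top] using volume_norm_lt_ne_top k⟩

open FourierTransform in
theorem integral_fermiWeight_mul {u : R3 → ℂ} (hu : ContDiff ℝ (⊤ : ℕ∞) u)
    (huc : HasCompactSupport u) {k k₁ D : ℝ} (hk₁ : k ≤ k₁) (hD : 0 ≤ D) :
    ∫ p, fermiWeight k k₁ D p * ‖𝓕 u p‖ ^ 2 = 4 * π ^ 2 * k ^ 2 * (∫ x, ‖u x‖ ^ 2) -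
      ∫ p in {p | ‖p‖ < k₁}, ‖(√(fermiDeficit k D p) : ℂ) * 𝓕 u p‖ ^ 2 := by
  have mS := measurableSet_norm_lt k₁
  have hF := rapidDecay_fourier hu huc
  have hN : Integrable fun p => ‖𝓕 u p‖ ^ 2 := by simpa using hF.integrable_moment_sq 0
  have hP := integral_norm_sq_fourier_eq (hu.continuous.integrable_of_hasCompactSupport huc)
    (hu.continuous.memLp_of_hasCompactSupport huc)
  have e : ∀ p, ‖(√(fermiDeficit k D p) : ℂ) * 𝓕 u p‖ ^ 2 =
      fermiDeficit k D p * ‖𝓕 u p‖ ^ 2 := by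
    intro p
    rw [norm_mul, Complex.norm_real, norm_of_nonneg (Real.sqrt_nonneg _), mul_pow,
      Real.sq_sqrt (fermiDeficit_nonneg hD p)]
  have i2 : Integrable (fun p => fermiDeficit k D p * ‖𝓕 u p‖ ^ 2) := by
    refine hN.bdd_mul (c := 4 * π ^ 2 * k ^ 2 + D) (measurable_fermiDeficit _ _).aestronglyMeasurable
      (.of_forall fun p => ?_)
    rw [norm_of_nonneg (fermiDeficit_nonneg hD p)]
    exact fermiDeficit_le hD p
  rw [← hP, ← integral_const_mul, ← integral_indicator mS]
  simp only [e]
  rw [← integral_sub (hN.const_mul _) (i2.indicator mS)]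
  congr with p
  unfold fermiWeight fermiDeficit
  by_cases h1 : ‖p‖ < k₁
  · rw [Set.indicator_of_mem (by exact h1)]
    simp only [h1, if_true]
    split_ifs <;> ring
  · rw [Set.indicator_of_notMem (by exact h1), if_neg (by linarith), if_neg h1]
    ring

section
variable {N : ℕ} {L : ℝ} {f : (Fin N → R3) → ℂ} {B : Set R3}

open FourierTransform in
theorem IsTest.fourier_slice (h : IsTest L f) (hB : openCube L ⊆ B) (i : Fin N)
    (X : Fin N → R3) (p : R3) :
    𝓕 (slice f i X) p =
      ∫ x, (starRingEnd ℂ) (wave p x) * f (Function.update X i x) ∂(volume.restrict B) := by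
  rw [setIntegral_eq_of_supported hB, Real.fourier_eq]
  · refine integral_congr_ae (.of_forall fun x => ?_)
    simp only [wave, slice, Circle.smul_def, smul_eq_mul]
    rw [← Circle.coe_inv_eq_conj, ← AddChar.map_neg_eq_inv]
  · intro x hx
    rw [h.eq_zero (i := i) (by simpa using hx), mul_zero]

open FourierTransform in
theorem IsTest.bddMeas_fourier_slice (h : IsTest L f) (i : Fin N) :
    BddMeas fun z : (Fin N → R3) × R3 => 𝓕 (slice f i z.1) z.2 := by
  have hfin : volume (openCube L) ≠ ⊤ := (isBounded_openCube L).measure_lt_top.ne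
  have : IsFiniteMeasure ((volume : Measure R3).restrict (openCube L)) :=
    ⟨by simpa [lt_top_iff_ne_top] using hfin⟩
  rw [funext fun z : (Fin N → R3) × R3 => h.fourier_slice subset_rfl i z.1 z.2]
  refine BddMeas.integral_right (F := fun w : ((Fin N → R3) × R3) × R3 =>
    (starRingEnd ℂ) (wave w.1.2 w.2) * f (Function.update w.1.1 i w.2)) ?_ _
  have h1 : Measurable fun w : ((Fin N → R3) × R3) × R3 => (w.1.1, w.2) := by fun_prop
  have h2 : Measurable fun w : ((Fin N → R3) × R3) × R3 => (w.1.2, w.2) := by fun_prop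
  have h3 := (bddMeas_wave.comp h2).conj
  have h4 := h.bddMeas.comp ((measurable_update_prod i).comp h1)
  exact h3.mul h4

end

namespace BddMeas
variable {α : Type*} [MeasurableSpace α]

theorem integrable_real {H : α → ℝ} (hH : BddMeas fun x => (H x : ℂ)) (μ : Measure α)
    [IsFiniteMeasure μ] : Integrable H μ := by
  simpa using (hH.integrable μ).re

theorem norm_sq {F : α → ℂ} (hF : BddMeas F) : BddMeas fun x => ((‖F x‖ ^ 2 : ℝ) : ℂ) := by
  have := hF.conj.mul hF
  simpa [Complex.conj_mul'] using this

end BddMeas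

theorem integral_update_real {E : Type*} [MeasurableSpace E] (ν : Measure E) [IsFiniteMeasure ν]
    {N : ℕ} (i : Fin N) {H : (Fin N → E) → ℝ} (hH : BddMeas fun X => (H X : ℂ)) :
    ∫ X, ∫ x, H (Function.update X i x) ∂ν ∂(Measure.pi fun _ => ν) =
      ν.real Set.univ * ∫ X, H X ∂(Measure.pi fun _ => ν) := by
  have := integral_update ν i hH
  simp only [integral_complex_ofReal] at this
  exact_mod_cast this

/-- Kinetic energy of the particles in `C` and half their interaction with the other ones. -/
def classEnergy {N : ℕ} (v : R3 → ℝ) (C : Finset (Fin N)) (f : (Fin N → R3) → ℂ) : ℝ :=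
  ∑ i ∈ C, ((∫ X, gradSqAt f i X) + (1 / 2) * ∑ j ∈ Cᶜ, ∫ X, v (X i - X j) * ‖f X‖ ^ 2)

/-- Momentum distribution of the particles in `C`, in the region `B`. -/
def occupation {N : ℕ} (B : Set R3) (C : Finset (Fin N)) (f : (Fin N → R3) → ℂ) (p : R3) : ℝ :=
  ∑ i ∈ C, ((volume.restrict B).real Set.univ)⁻¹ *
    ∫ X, ‖∫ x, (starRingEnd ℂ) (wave p x) * f (Function.update X i x) ∂(volume.restrict B)‖ ^ 2
      ∂(Measure.pi fun _ => volume.restrict B)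

section
variable {N : ℕ} {L : ℝ} {f : (Fin N → R3) → ℂ} {B : Set R3}
  {C : Finset (Fin N)} {v κ : R3 → ℝ} {R k k₁ D c : ℝ}

open FourierTransform in
theorem class_pointwise_le [IsFiniteMeasure ((volume : Measure R3).restrict B)]
    (h : IsTest L f) (hB : openCube L ⊆ B)
    (hv0 : ∀ x, 0 ≤ v x) (hOB : OneBodyBound v κ R k k₁ D c) (hk₁ : k ≤ k₁) (hD : 0 ≤ D)
    {i : Fin N} (hi : i ∈ C) (X : Fin N → R3) :
    4 * π ^ 2 * k ^ 2 * (∫ x, ‖f (Function.update X i x)‖ ^ 2 ∂(volume.restrict B)) -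
      (∫ p in {p | ‖p‖ < k₁}, ‖(√(fermiDeficit k D p) : ℂ) * 𝓕 (slice f i X) p‖ ^ 2) +
      c * ∑ j ∈ Cᶜ, ‖∫ p in {p | ‖p‖ < k}, goodProfile κ R C j X p * 𝓕 (slice f i X) p‖ ^ 2 ≤
    (∫ x, gradSqAt f i (Function.update X i x) ∂(volume.restrict B)) +
      (1 / 2) * ∑ j ∈ Cᶜ, ∫ x, v ((Function.update X i x) i - (Function.update X i x) j) *
        ‖f (Function.update X i x)‖ ^ 2 ∂(volume.restrict B) := by
  classical
  have hu := h.smooth_slice i X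
  have huc := h.hasCompactSupport_slice i X
  have h1 := hOB (goodSet R C X) X
    (fun j hj l hl hjl => (Finset.mem_filter.1 hj).2 l (Finset.mem_filter.1 hl).1 hjl) hu huc
  rw [integral_fermiWeight_mul hu huc hk₁ hD] at h1
  have h0 : ∀ x, x ∉ openCube L → f (Function.update X i x) = 0 := fun x hx =>
    h.eq_zero (i := i) (by simpa using hx)
  have e1 : ∫ x, ‖f (Function.update X i x)‖ ^ 2 ∂(volume.restrict B) =
      ∫ x, ‖slice f i X x‖ ^ 2 :=
    setIntegral_eq_of_supported hB fun x hx => by simp [h0 x hx]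
  have e2 : ∫ x, gradSqAt f i (Function.update X i x) ∂(volume.restrict B) =
      ∫ x, gradSq (slice f i X) x := by
    simp only [IsTest.gradSq_slice]
    exact setIntegral_eq_of_supported hB fun x hx =>
      h.gradSqAt_eq_zero i (k := i) (by simpa using hx)
  have e3 : ∀ j ∈ Cᶜ, ∫ x, v ((Function.update X i x) i - (Function.update X i x) j) *
        ‖f (Function.update X i x)‖ ^ 2 ∂(volume.restrict B) =
      ∫ x, v (x - X j) * ‖slice f i X x‖ ^ 2 := by
    intro j hj
    have hij : j ≠ i := by rintro rfl; exact Finset.mem_compl.1 hj hi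
    simp only [Function.update_self, Function.update_of_ne hij]
    exact setIntegral_eq_of_supported hB fun x hx => by simp [h0 x hx]
  have e4 : ∑ j ∈ Cᶜ, ‖∫ p in {p | ‖p‖ < k}, goodProfile κ R C j X p * 𝓕 (slice f i X) p‖ ^ 2 =
      ∑ j ∈ goodSet R C X, ‖∫ p in {p | ‖p‖ < k},
        𝓕⁻ (fun x => (κ (x - X j) : ℂ)) p * 𝓕 (slice f i X) p‖ ^ 2 := by
    rw [← Finset.sum_subset (Finset.filter_subset _ _ : goodSet R C X ⊆ Cᶜ)]
    · exact Finset.sum_congr rfl fun j hj => by simp [goodProfile, hj]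
    · intro j _ hj
      have hj' : j ∉ goodSet R C X := hj
      simp [goodProfile, hj']
  rw [e1, e2, e4, Finset.sum_congr rfl e3]
  refine h1.trans ?_
  have hs : goodSet R C X ⊆ Cᶜ := Finset.filter_subset _ _
  have := Finset.sum_le_sum_of_subset_of_nonneg (f := fun j =>
    ∫ x, v (x - X j) * ‖slice f i X x‖ ^ 2) hs fun j _ _ => ?_
  · linarith
  exact integral_nonneg fun x => mul_nonneg (hv0 _) (by positivity)

theorem bddMeas_pair (h : IsTest L f) (hv : Measurable v) (hv0 : ∀ x, 0 ≤ v x)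
    (hvC : ∃ c, ∀ x, v x ≤ c) (i j : Fin N) :
    BddMeas fun X => ((v (X i - X j) * ‖f X‖ ^ 2 : ℝ) : ℂ) := by
  have hvb : BddMeas fun x => (v x : ℂ) := by
    refine ⟨Complex.measurable_ofReal.comp hv, hvC.imp fun c hc x => ?_⟩
    rw [Complex.norm_real, norm_of_nonneg (hv0 x)]
    exact hc x
  have hm : Measurable fun X : Fin N → R3 => X i - X j := by fun_prop
  have := (hvb.comp hm).mul h.bddMeas.norm_sq
  simpa using this

open FourierTransform in
theorem le_classEnergy [IsFiniteMeasure ((volume : Measure R3).restrict B)]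
    (hV : ((volume : Measure R3).restrict B).real Set.univ ≠ 0)
    (h : IsTest L f) (hB : openCube L ⊆ B)
    (hv : Measurable v) (hv0 : ∀ x, 0 ≤ v x) (hvC : ∃ c, ∀ x, v x ≤ c) (hκi : Integrable κ)
    (hOB : OneBodyBound v κ R k k₁ D c) (hk₁ : k ≤ k₁) (hD : 0 ≤ D) :
    4 * π ^ 2 * k ^ 2 * (C.card * ∫ X, ‖f X‖ ^ 2) -
      (∫ p in {p | ‖p‖ < k₁}, fermiDeficit k D p * occupation B C f p) +
      c * ∑ j ∈ Cᶜ, ∑ i ∈ C, ((volume.restrict B).real Set.univ)⁻¹ *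
        ∫ X, ‖∫ p in {p | ‖p‖ < k}, goodProfile κ R C j X p *
          (∫ x, (starRingEnd ℂ) (wave p x) * f (Function.update X i x) ∂(volume.restrict B))‖ ^ 2
            ∂(Measure.pi fun _ => volume.restrict B) ≤ classEnergy v C f := by
  set ν := (volume : Measure R3).restrict B with hν
  set V := ν.real Set.univ with hVdef
  have V0 : 0 < V := lt_of_le_of_ne measureReal_nonneg hV.symm
  set Pi₀ := Measure.pi fun _ : Fin N => ν with hPi₀
  set μ := (volume : Measure R3).restrict {p | ‖p‖ < k} with hμ
  set μ₁ := (volume : Measure R3).restrict {p | ‖p‖ < k₁} with hμ₁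
  have hhat := fun i => h.bddMeas_fourier_slice i
  have hfu : ∀ i, BddMeas fun z : (Fin N → R3) × R3 => f (Function.update z.1 i z.2) := fun i =>
    h.bddMeas.comp (measurable_update_prod i)
  have hm : ∀ i, BddMeas fun z : (Fin N → R3) × R3 =>
      (√(fermiDeficit k D z.2) : ℂ) * 𝓕 (slice f i z.1) z.2 := fun i =>
    ((bddMeas_sqrt_fermiDeficit hD).comp measurable_snd).mul (hhat i)
  have hg : ∀ i j, BddMeas fun z : (Fin N → R3) × R3 =>
      goodProfile κ R C j z.1 z.2 * 𝓕 (slice f i z.1) z.2 := fun i j =>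
    (bddMeas_goodProfile hκi R C j).mul (hhat i)
  have j1 : ∀ i, Integrable (fun X => 4 * π ^ 2 * k ^ 2 *
      ∫ x, ‖f (Function.update X i x)‖ ^ 2 ∂ν) Pi₀ := fun i =>
    ((hfu i).integral_right_sq Pi₀ ν).const_mul _
  have j2 : ∀ i, Integrable (fun X => ∫ p, ‖(√(fermiDeficit k D p) : ℂ) *
      𝓕 (slice f i X) p‖ ^ 2 ∂μ₁) Pi₀ := fun i => (hm i).integral_right_sq Pi₀ μ₁
  have j3 : ∀ i j, Integrable (fun X => ‖∫ p, goodProfile κ R C j X p *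
      𝓕 (slice f i X) p ∂μ‖ ^ 2) Pi₀ := fun i j => ((hg i j).integral_right μ).integrable_sq Pi₀
  have j3s : ∀ i, Integrable (fun X => ∑ j ∈ Cᶜ, ‖∫ p, goodProfile κ R C j X p *
      𝓕 (slice f i X) p ∂μ‖ ^ 2) Pi₀ := fun i => integrable_finsetSum _ fun j _ => j3 i j
  have j12 : ∀ i, Integrable (fun X => 4 * π ^ 2 * k ^ 2 *
      (∫ x, ‖f (Function.update X i x)‖ ^ 2 ∂ν) - ∫ p, ‖(√(fermiDeficit k D p) : ℂ) *
      𝓕 (slice f i X) p‖ ^ 2 ∂μ₁) Pi₀ := fun i => (j1 i).sub (j2 i)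
  have j123 : ∀ i, Integrable (fun X => 4 * π ^ 2 * k ^ 2 *
      (∫ x, ‖f (Function.update X i x)‖ ^ 2 ∂ν) - (∫ p, ‖(√(fermiDeficit k D p) : ℂ) *
      𝓕 (slice f i X) p‖ ^ 2 ∂μ₁) + c * ∑ j ∈ Cᶜ, ‖∫ p, goodProfile κ R C j X p *
      𝓕 (slice f i X) p ∂μ‖ ^ 2) Pi₀ := fun i => (j12 i).add ((j3s i).const_mul c)
  have u1 : ∀ i, Integrable (fun X => ∫ x, gradSqAt f i (Function.update X i x) ∂ν) Pi₀ := fun i => by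
    have b := ((h.bddMeas_gradSqAt i).comp (measurable_update_prod i))
    exact (b.integrable_real (Pi₀.prod ν)).integral_prod_left
  have u2 : ∀ i j, Integrable (fun X => ∫ x, v ((Function.update X i x) i -
      (Function.update X i x) j) * ‖f (Function.update X i x)‖ ^ 2 ∂ν) Pi₀ := fun i j => by
    have b := ((bddMeas_pair h hv hv0 hvC i j).comp (measurable_update_prod i))
    exact (b.integrable_real (Pi₀.prod ν)).integral_prod_left
  have u2s : ∀ i, Integrable (fun X => (1 / 2) * ∑ j ∈ Cᶜ, ∫ x, v ((Function.update X i x) i -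
      (Function.update X i x) j) * ‖f (Function.update X i x)‖ ^ 2 ∂ν) Pi₀ := fun i =>
    (integrable_finsetSum _ fun j _ => u2 i j).const_mul _
  have main : ∀ i ∈ C, 4 * π ^ 2 * k ^ 2 * (∫ X, ‖f X‖ ^ 2) -
      V⁻¹ * (∫ X, ∫ p, ‖(√(fermiDeficit k D p) : ℂ) * 𝓕 (slice f i X) p‖ ^ 2 ∂μ₁ ∂Pi₀) +
      c * ∑ j ∈ Cᶜ, V⁻¹ * ∫ X, ‖∫ p, goodProfile κ R C j X p * 𝓕 (slice f i X) p ∂μ‖ ^ 2 ∂Pi₀ ≤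
      (∫ X, gradSqAt f i X) + (1 / 2) * ∑ j ∈ Cᶜ, ∫ X, v (X i - X j) * ‖f X‖ ^ 2 := by
    intro i hi
    have hI := integral_mono (j123 i) ((u1 i).add (u2s i)) fun X =>
      class_pointwise_le h hB hv0 hOB hk₁ hD hi X
    rw [integral_add (j12 i) ((j3s i).const_mul c), integral_sub (j1 i) (j2 i),
      integral_const_mul, integral_const_mul, integral_finsetSum _ fun j _ => j3 i j,
      integral_update_real ν i h.bddMeas.norm_sq] at hI
    have hr : ∫ X, ((fun X => ∫ x, gradSqAt f i (Function.update X i x) ∂ν) + fun X =>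
        (1 / 2) * ∑ j ∈ Cᶜ, ∫ x, v ((Function.update X i x) i -
      (Function.update X i x) j) * ‖f (Function.update X i x)‖ ^ 2 ∂ν) X ∂Pi₀ =
        V * ((∫ X, gradSqAt f i X) + (1 / 2) * ∑ j ∈ Cᶜ, ∫ X, v (X i - X j) * ‖f X‖ ^ 2) := by
      rw [integral_add' (u1 i) (u2s i), integral_const_mul, integral_finsetSum _ fun j _ => u2 i j,
        integral_update_real ν i (h.bddMeas_gradSqAt i)]
      have : ∀ j ∈ Cᶜ, ∫ X, ∫ x, v ((Function.update X i x) i -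
          (Function.update X i x) j) * ‖f (Function.update X i x)‖ ^ 2 ∂ν ∂Pi₀ =
          V * ∫ X, v (X i - X j) * ‖f X‖ ^ 2 := by
        intro j _
        rw [integral_update_real ν i (H := fun X => v (X i - X j) * ‖f X‖ ^ 2)
          (bddMeas_pair h hv hv0 hvC i j)]
        congr 1
        refine integral_pi_eq_of_supported hB fun X ⟨k, hX⟩ => ?_
        simp [h.eq_zero hX]
      rw [Finset.sum_congr rfl this, ← Finset.mul_sum, integral_pi_eq_of_supported hB]
      · ring
      · exact fun X ⟨k, hX⟩ => h.gradSqAt_eq_zero i hX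
    rw [hr, integral_pi_eq_of_supported hB (fun X ⟨k, hX⟩ => by simp [h.eq_zero hX])] at hI
    refine le_of_mul_le_mul_left (le_trans (le_of_eq ?_) hI) V0
    rw [← Finset.mul_sum, ← hVdef]
    field_simp
  have hsum := Finset.sum_le_sum main
  refine le_trans (le_of_eq ?_) hsum
  rw [Finset.sum_add_distrib, Finset.sum_sub_distrib, Finset.sum_const, nsmul_eq_mul,
    ← Finset.mul_sum C, ← Finset.mul_sum C, Finset.sum_comm (s := C)]
  have e1 : ∫ p, fermiDeficit k D p * occupation B C f p ∂μ₁ = ∑ i ∈ C, V⁻¹ *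
      ∫ X, ∫ p, ‖(√(fermiDeficit k D p) : ℂ) * 𝓕 (slice f i X) p‖ ^ 2 ∂μ₁ ∂Pi₀ := by
    have : ∀ i ∈ C, V⁻¹ * ∫ X, ∫ p, ‖(√(fermiDeficit k D p) : ℂ) * 𝓕 (slice f i X) p‖ ^ 2 ∂μ₁ ∂Pi₀ =
        ∫ p, V⁻¹ * ∫ X, ‖(√(fermiDeficit k D p) : ℂ) * 𝓕 (slice f i X) p‖ ^ 2 ∂Pi₀ ∂μ₁ := by
      intro i _
      rw [(hm i).swap_integral_sq Pi₀ μ₁, integral_const_mul]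
    rw [Finset.sum_congr rfl this, ← integral_finsetSum]
    · congr with p
      rw [occupation, Finset.mul_sum]
      refine Finset.sum_congr rfl fun i _ => ?_
      simp only [norm_mul, mul_pow, Complex.norm_real, norm_of_nonneg (Real.sqrt_nonneg _),
        Real.sq_sqrt (fermiDeficit_nonneg hD p)]
      rw [integral_const_mul]
      simp only [h.fourier_slice hB]
      ring
    · intro i _
      have hsw : Measurable fun z : R3 × (Fin N → R3) => (z.2, z.1) := by fun_prop
      have hs := (hm i).comp hsw
      exact (hs.integral_right_sq μ₁ Pi₀).const_mul _
  rw [e1, Finset.mul_sum (s := C)]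
  simp only [h.fourier_slice hB]
  ring
end

theorem measureReal_norm_lt {r : ℝ} (hr : 0 ≤ r) :
    (volume : Measure R3).real {p | ‖p‖ < r} = 4 / 3 * π * r ^ 3 := by
  have : {p : R3 | ‖p‖ < r} = Metric.ball 0 r := by ext; simp
  rw [this, measureReal_def, EuclideanSpace.volume_ball_fin_three, ENNReal.toReal_mul,
    ENNReal.toReal_pow, ENNReal.toReal_ofReal hr, ENNReal.toReal_ofReal (by positivity)]
  ring

theorem integral_norm_sq_norm_lt {k : ℝ} (hk : 0 ≤ k) :
    ∫ p in {p : R3 | ‖p‖ < k}, ‖p‖ ^ 2 = 4 * π / 5 * k ^ 5 := by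
  have h := integral_fun_norm_addHaar (volume : Measure R3)
    (fun r => if r < k then r ^ 2 else 0)
  have e : ∫ p in {p : R3 | ‖p‖ < k}, ‖p‖ ^ 2 = ∫ p : R3, (if ‖p‖ < k then ‖p‖ ^ 2 else 0) := by
    rw [← integral_indicator (measurableSet_norm_lt k)]
    congr with p
  rw [e, h]
  have h2 : ∫ y in Set.Ioi (0:ℝ), y ^ (Module.finrank ℝ R3 - 1) • (if y < k then y ^ 2 else 0) =
      ∫ y in (0:ℝ)..k, y ^ 4 := by
    rw [intervalIntegral.integral_of_le hk, integral_Ioc_eq_integral_Ioo,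
      ← integral_indicator measurableSet_Ioi, ← integral_indicator measurableSet_Ioo]
    congr with y
    by_cases hy : 0 < y <;> by_cases hyk : y < k <;> simp [hy, hyk]
    ring
  rw [h2, integral_pow, measureReal_def, EuclideanSpace.volume_ball_fin_three]
  simp
  rw [ENNReal.toReal_ofReal (by positivity)]
  ring

section
variable {N : ℕ} {L : ℝ} {f : (Fin N → R3) → ℂ} {B : Set R3}
  {C : Finset (Fin N)} {v κ : R3 → ℝ} {R k k₁ D c : ℝ}

theorem integral_wave_mul [IsFiniteMeasure ((volume : Measure R3).restrict B)]
    (h : IsTest L f) (hB : openCube L ⊆ B) (p : R3) :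
    ∫ z, ‖wave p z.2‖ ^ 2 * ‖f z.1‖ ^ 2
      ∂((Measure.pi fun _ : Fin N => (volume : Measure R3).restrict B).prod (volume.restrict B)) =
    ((volume : Measure R3).restrict B).real Set.univ * ∫ X, ‖f X‖ ^ 2 := by
  have := integral_prod_mul (μ := Measure.pi fun _ : Fin N => (volume : Measure R3).restrict B)
    (ν := (volume : Measure R3).restrict B) (fun X => ‖f X‖ ^ 2) (fun _ => (1 : ℝ))
  simp only [norm_wave, one_pow, one_mul]
  simp only [mul_one, integral_const, smul_eq_mul] at this
  rw [this, integral_pi_eq_of_supported hB (fun X ⟨k, hX⟩ => by simp [h.eq_zero hX])]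
  ring

theorem occupation_nonneg (p : R3) : 0 ≤ occupation B C f p :=
  Finset.sum_nonneg fun i _ => mul_nonneg (inv_nonneg.2 measureReal_nonneg)
    (integral_nonneg fun _ => by positivity)

theorem occupation_le [IsFiniteMeasure ((volume : Measure R3).restrict B)]
    (hV : ((volume : Measure R3).restrict B).real Set.univ ≠ 0)
    (h : IsTest L f) (hB : openCube L ⊆ B)
    (hanti : ∀ i ∈ C, ∀ k ∈ C, i ≠ k → ∀ X, f (X ∘ Equiv.swap i k) = -f X) (p : R3) :
    occupation B C f p ≤
      ((volume : Measure R3).restrict B).real Set.univ * ∫ X, ‖f X‖ ^ 2 := by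
  have hg : BddMeas fun z : (Fin N → R3) × R3 => (fun _ : Fin N → R3 => wave p) z.1 z.2 := by
    have hm : Measurable fun z : (Fin N → R3) × R3 => (p, z.2) := by fun_prop
    have := bddMeas_wave.comp hm
    exact this
  have := sum_occupation_le (g := fun _ => wave p) (volume.restrict B) hV h.bddMeas hanti hg
    fun _ _ _ _ => rfl
  rw [integral_wave_mul h hB] at this
  exact this

theorem integrable_occupation [IsFiniteMeasure ((volume : Measure R3).restrict B)]
    (h : IsTest L f) (μ : Measure R3) [IsFiniteMeasure μ] :
    Integrable (occupation B C f) μ := by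
  refine integrable_finsetSum _ fun i _ => Integrable.const_mul ?_ _
  have h1 : Measurable fun w : (R3 × (Fin N → R3)) × R3 => (w.1.1, w.2) := by fun_prop
  have h2 : Measurable fun w : (R3 × (Fin N → R3)) × R3 => (w.1.2, w.2) := by fun_prop
  have h3 := (bddMeas_wave.comp h1).conj
  have h4 := h.bddMeas.comp ((measurable_update_prod i).comp h2)
  have h5 := (h3.mul h4).integral_right (volume.restrict B)
  exact h5.integral_right_sq μ _

/-- Density of the scatterer `j` at the positions of the plane waves below momentum `k`. -/
def scattererOverlap {N : ℕ} (κ : R3 → ℝ) (R k : ℝ) (B : Set R3) (C : Finset (Fin N))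
    (f : (Fin N → R3) → ℂ) (j : Fin N) : ℝ :=
  ∫ z, ‖∫ p in {p | ‖p‖ < k}, (starRingEnd ℂ) (goodProfile κ R C j z.1 p) * wave p z.2‖ ^ 2 *
    ‖f z.1‖ ^ 2 ∂((Measure.pi fun _ : Fin N => (volume : Measure R3).restrict B).prod
      (volume.restrict B))

theorem deficit_integral_le [IsFiniteMeasure ((volume : Measure R3).restrict B)]
    (hV : ((volume : Measure R3).restrict B).real Set.univ ≠ 0)
    (h : IsTest L f) (hB : openCube L ⊆ B)
    (hanti : ∀ i ∈ C, ∀ k ∈ C, i ≠ k → ∀ X, f (X ∘ Equiv.swap i k) = -f X)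
    {d : ℝ} (hk : 0 ≤ k) (hd : 0 ≤ d) (hk₁0 : 0 ≤ k₁) (hk₁ : k₁ ^ 2 = k ^ 2 + d) :
    (∫ p in {p | ‖p‖ < k₁}, fermiDeficit k (4 * π ^ 2 * d) p * occupation B C f p) +
      4 * π ^ 2 * d * ∫ p in {p | ‖p‖ < k},
        (((volume : Measure R3).restrict B).real Set.univ * (∫ X, ‖f X‖ ^ 2) -
          occupation B C f p) ≤
    ((volume : Measure R3).restrict B).real Set.univ * (∫ X, ‖f X‖ ^ 2) *
      (16 * π ^ 3 / 3 * k ^ 5 - 16 * π ^ 3 / 5 * k ^ 5 + 16 * π ^ 3 * d ^ 2 * k₁) := by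
  set M := ((volume : Measure R3).restrict B).real Set.univ * ∫ X, ‖f X‖ ^ 2 with hM
  set D := 4 * π ^ 2 * d with hDdef
  have hD : 0 ≤ D := by positivity
  have hkk : k ≤ k₁ := by
    refine le_of_sq_le_sq ?_ hk₁0
    linarith
  have hM0 : 0 ≤ M := mul_nonneg measureReal_nonneg (integral_nonneg fun _ => by positivity)
  set S := {p : R3 | ‖p‖ < k} with hS
  set S₁ := {p : R3 | ‖p‖ < k₁} with hS₁
  have mS : MeasurableSet S := measurableSet_norm_lt k
  set s := √(k ^ 2 - d) with hs
  have hs0 : 0 ≤ s := Real.sqrt_nonneg _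
  have hsk : s ≤ k₁ := by
    refine le_trans (Real.sqrt_le_sqrt (by linarith : k ^ 2 - d ≤ k ^ 2)) ?_
    rwa [Real.sqrt_sq hk]
  set T := {p : R3 | ‖p‖ < s} with hT
  have mT : MeasurableSet T := measurableSet_norm_lt s
  have hTS : T ⊆ S₁ := fun p hp => lt_of_lt_of_le hp hsk
  have hSS : S ⊆ S₁ := fun p hp => lt_of_lt_of_le hp hkk
  have i1 : Integrable (fun p => fermiDeficit k D p * occupation B C f p)
      (volume.restrict S₁) := by
    refine (integrable_occupation h _).bdd_mul (c := 4 * π ^ 2 * k ^ 2 + D)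
      (measurable_fermiDeficit _ _).aestronglyMeasurable (.of_forall fun p => ?_)
    rw [norm_of_nonneg (fermiDeficit_nonneg hD p)]
    exact fermiDeficit_le hD p
  have i2 : Integrable (fun p => M - occupation B C f p) (volume.restrict S₁) :=
    (integrable_const _).sub (integrable_occupation h _)
  have i2' : Integrable (S.indicator fun p => D * (M - occupation B C f p)) (volume.restrict S₁) :=
    (i2.const_mul D).indicator mS
  have hin : ∀ {A : Set R3} (_ : MeasurableSet A) (_ : A ⊆ S₁) (g : R3 → ℝ),
      ∫ p in S₁, A.indicator g p = ∫ p in A, g p := by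
    intro A mA hA g
    rw [setIntegral_indicator mA, Set.inter_eq_right.2 hA]
  have i3 : IntegrableOn (fun p : R3 => ‖p‖ ^ 2) S₁ := by
    refine Measure.integrableOn_of_bounded (M := k₁ ^ 2) (volume_norm_lt_ne_top k₁)
      (by fun_prop) ?_
    refine (ae_restrict_iff' (measurableSet_norm_lt k₁)).2 (.of_forall fun p hp => ?_)
    rw [norm_of_nonneg (by positivity)]
    exact pow_le_pow_left₀ (norm_nonneg _) (le_of_lt hp) 2
  have i4 : Integrable (S.indicator fun p : R3 => M * (4 * π ^ 2 * (k ^ 2 - ‖p‖ ^ 2)))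
      (volume.restrict S₁) :=
    (((integrable_const (k ^ 2)).sub i3).const_mul (4 * π ^ 2) |>.const_mul M).indicator mS
  have i5 : Integrable (fun p => M * D - T.indicator (fun _ => M * D) p) (volume.restrict S₁) :=
    (integrable_const _).sub ((integrable_const _).indicator mT)
  have key : ∀ p ∈ S₁, fermiDeficit k D p * occupation B C f p +
      S.indicator (fun p => D * (M - occupation B C f p)) p ≤
      S.indicator (fun p : R3 => M * (4 * π ^ 2 * (k ^ 2 - ‖p‖ ^ 2))) p +
        (M * D - T.indicator (fun _ => M * D) p) := by
    intro p _
    have o0 := occupation_nonneg (B := B) (C := C) (f := f) p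
    have o1 : occupation B C f p ≤ M := occupation_le hV h hB hanti p
    have hMD : 0 ≤ M * D := mul_nonneg hM0 hD
    by_cases hp : ‖p‖ < k
    · rw [Set.indicator_of_mem (by exact hp), Set.indicator_of_mem (by exact hp), fermiDeficit,
        if_pos hp]
      have hq : ‖p‖ ^ 2 ≤ k ^ 2 := pow_le_pow_left₀ (norm_nonneg _) hp.le 2
      set E := 4 * π ^ 2 * (k ^ 2 - ‖p‖ ^ 2) with hE
      have hE0 : 0 ≤ E := mul_nonneg (by positivity) (by linarith)
      by_cases hps : ‖p‖ < s
      · rw [Set.indicator_of_mem (by exact hps)]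
        have : ‖p‖ ^ 2 < k ^ 2 - d := (Real.lt_sqrt (norm_nonneg _)).1 hps
        have hED : D ≤ E := mul_le_mul_of_nonneg_left (by linarith) (by positivity)
        nlinarith [mul_nonneg (sub_nonneg.2 hED) (sub_nonneg.2 o1)]
      · rw [Set.indicator_of_notMem (by exact hps)]
        nlinarith [mul_nonneg hE0 (sub_nonneg.2 o1), mul_nonneg hD o0]
    · have hps : ¬ ‖p‖ < s := by
        intro hh
        have : s ≤ k := by
          rw [hs, ← Real.sqrt_sq hk]; exact Real.sqrt_le_sqrt (by simp [Real.sq_sqrt, sq_nonneg, hd])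
        exact hp (hh.trans_le this)
      rw [Set.indicator_of_notMem (by exact hp), Set.indicator_of_notMem (by exact hp),
        Set.indicator_of_notMem (by exact hps), fermiDeficit, if_neg hp]
      nlinarith [mul_nonneg hD (sub_nonneg.2 o1)]
  have hI := setIntegral_mono_on (i1.add i2') (i4.add i5) (measurableSet_norm_lt k₁) key
  rw [integral_add' i1 i2', integral_add' i4 i5, hin mS hSS, hin mS hSS, integral_const_mul,
    integral_sub (integrable_const (M * D)) ((integrable_const (M * D)).indicator mT), hin mT hTS,
    setIntegral_const, setIntegral_const, integral_const_mul, integral_const_mul,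
    integral_sub (integrable_const _) (i3.mono_set hSS), setIntegral_const,
    measureReal_norm_lt hk, measureReal_norm_lt hk₁0, measureReal_norm_lt hs0,
    integral_norm_sq_norm_lt hk] at hI
  refine hI.trans ?_
  simp only [smul_eq_mul]
  have hs2 : k₁ ^ 2 - s ^ 2 ≤ 2 * d := by
    have : k ^ 2 - d ≤ s ^ 2 := by
      rw [hs, Real.sq_sqrt']; exact le_max_left _ _
    linarith
  have hcub : k₁ ^ 3 - s ^ 3 ≤ 3 * k₁ * d := by
    have : k₁ ^ 3 - s ^ 3 ≤ 3 / 2 * k₁ * (k₁ ^ 2 - s ^ 2) := by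
      nlinarith [mul_nonneg (sub_nonneg.2 hsk) (mul_nonneg (sub_nonneg.2 hsk) hk₁0),
        mul_nonneg (sub_nonneg.2 hsk) (mul_nonneg (sub_nonneg.2 hsk) hs0)]
    nlinarith [mul_nonneg hk₁0 (sub_nonneg.2 hs2)]
  have hfin : M * D * (4 / 3 * π) * (k₁ ^ 3 - s ^ 3) ≤ M * D * (4 / 3 * π) * (3 * k₁ * d) :=
    mul_le_mul_of_nonneg_left hcub (by positivity)
  rw [hDdef] at hfin ⊢
  nlinarith [hfin]

theorem classEnergy_ge_overlap [IsFiniteMeasure ((volume : Measure R3).restrict B)]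
    (hV : ((volume : Measure R3).restrict B).real Set.univ ≠ 0)
    (h : IsTest L f) (hB : openCube L ⊆ B)
    (hanti : ∀ i ∈ C, ∀ k ∈ C, i ≠ k → ∀ X, f (X ∘ Equiv.swap i k) = -f X)
    (hv : Measurable v) (hv0 : ∀ x, 0 ≤ v x) (hvC : ∃ c, ∀ x, v x ≤ c)
    (hκi : Integrable κ) (hκ0 : ∀ x, 0 ≤ κ x) (hκ1 : ∫ x, κ x = 1) (hR : 0 < R)
    (hK : 4 * π * R * k ≤ 1) {d : ℝ} (hk : 0 ≤ k) (hd : 0 ≤ d) (hk₁0 : 0 ≤ k₁)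
    (hk₁ : k₁ ^ 2 = k ^ 2 + d) (hOB : OneBodyBound v κ R k k₁ (4 * π ^ 2 * d) c)
    (hc : 0 ≤ c) (hcd : c * (4 / R ^ 3) ≤ 4 * π ^ 2 * d)
    (hcard : (C.card : ℝ) =
      ((volume : Measure R3).restrict B).real Set.univ * (4 / 3 * π * k ^ 3)) :
    ((volume : Measure R3).restrict B).real Set.univ * (∫ X, ‖f X‖ ^ 2) *
      (16 * π ^ 3 / 5 * k ^ 5 - 16 * π ^ 3 * d ^ 2 * k₁) +
      c * ∑ j ∈ Cᶜ, scattererOverlap κ R k B C f j ≤ classEnergy v C f := by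
  have hkk : k ≤ k₁ := le_of_sq_le_sq (by linarith) hk₁0
  have h1 := le_classEnergy (C := C) hV h hB hv hv0 hvC hκi hOB hkk (by positivity)
  have h2 := deficit_integral_le hV h hB hanti hk hd hk₁0 hk₁
  have h3 := sum_hole_le (C := C) (s := Cᶜ) (volume.restrict B)
    ((volume : Measure R3).restrict {p : R3 | ‖p‖ < k})
    hV h.bddMeas hanti bddMeas_wave (fun j _ => bddMeas_goodProfile hκi R C j)
    (fun j hj i hi X z => goodProfile_update κ R C hj hi X z)
    (fun X F hF => sum_norm_sq_goodProfile_le C X hR hK hκi hκ0 hκ1 hF)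
  simp only [integral_wave_mul h hB] at h3
  rw [Finset.sum_sub_distrib] at h3
  have h4 : 0 ≤ ∫ p in {p : R3 | ‖p‖ < k},
      (((volume : Measure R3).restrict B).real Set.univ * (∫ X, ‖f X‖ ^ 2) -
        occupation B C f p) :=
    integral_nonneg fun p => sub_nonneg.2 (occupation_le hV h hB hanti p)
  have h5 := mul_le_mul_of_nonneg_right hcd h4
  have h6 := mul_le_mul_of_nonneg_left h3 hc
  rw [mul_sub] at h6
  rw [mul_assoc] at h5
  change _ - _ ≤ c * (4 / R ^ 3 * ∫ p in {p : R3 | ‖p‖ < k},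
      (((volume : Measure R3).restrict B).real Set.univ * (∫ X, ‖f X‖ ^ 2) -
        occupation B C f p)) at h6
  have h8 : (c * ∑ j ∈ Cᶜ, scattererOverlap κ R k B C f j) - c * ∑ j ∈ Cᶜ, ∑ i ∈ C,
      ((volume.restrict B).real Set.univ)⁻¹ *
        ∫ X, ‖∫ p in {p | ‖p‖ < k}, goodProfile κ R C j X p *
          (∫ x, (starRingEnd ℂ) (wave p x) * f (Function.update X i x) ∂(volume.restrict B))‖ ^ 2
            ∂(Measure.pi fun _ => volume.restrict B) ≤ _ := h6.trans h5
  rw [hcard] at h1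
  linarith
end

/-- The low-momentum part of the density `κ`. -/
def lowProfile (κ : R3 → ℝ) (k : ℝ) : R3 → ℂ := open FourierTransform in
  {p : R3 | ‖p‖ < k}.indicator fun p => (starRingEnd ℂ) (𝓕⁻ (fun x => (κ x : ℂ)) p)

section
variable {κ : R3 → ℝ}

open FourierTransform in
theorem norm_fourierInv_density_le_one (hκ0 : ∀ x, 0 ≤ κ x) (hκ1 : ∫ x, κ x = 1) (p : R3) :
    ‖𝓕⁻ (fun x => (κ x : ℂ)) p‖ ≤ 1 := by
  have := norm_fourierInv_density_le hκ0 hκ1 0 p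
  simpa using this

theorem norm_lowProfile_le (hκ0 : ∀ x, 0 ≤ κ x) (hκ1 : ∫ x, κ x = 1) (k : ℝ) (p : R3) :
    ‖lowProfile κ k p‖ ≤ {p : R3 | ‖p‖ < k}.indicator (fun _ => (1 : ℝ)) p := by
  unfold lowProfile
  by_cases hp : p ∈ {p : R3 | ‖p‖ < k}
  · rw [Set.indicator_of_mem hp, Set.indicator_of_mem hp, RCLike.norm_conj]
    exact norm_fourierInv_density_le_one hκ0 hκ1 p
  · rw [Set.indicator_of_notMem hp, Set.indicator_of_notMem hp, norm_zero]

theorem measurable_lowProfile (hκi : Integrable κ) (k : ℝ) : Measurable (lowProfile κ k) := by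
  refine Measurable.indicator ?_ (measurableSet_norm_lt k)
  exact Complex.continuous_conj.measurable.comp
    (continuous_fourierInv_of_integrable hκi.ofReal).measurable

theorem integrable_indicator_norm_lt (k : ℝ) :
    Integrable ({p : R3 | ‖p‖ < k}.indicator (fun _ => (1 : ℝ))) :=
  (integrable_indicator_iff (measurableSet_norm_lt k)).2 (integrable_const _)

theorem integrable_lowProfile (hκi : Integrable κ) (hκ0 : ∀ x, 0 ≤ κ x) (hκ1 : ∫ x, κ x = 1)
    (k : ℝ) : Integrable (lowProfile κ k) :=
  (integrable_indicator_norm_lt k).mono' (measurable_lowProfile hκi k).aestronglyMeasurable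
    (.of_forall (norm_lowProfile_le hκ0 hκ1 k))

theorem memLp_lowProfile (hκi : Integrable κ) (hκ0 : ∀ x, 0 ≤ κ x) (hκ1 : ∫ x, κ x = 1)
    (k : ℝ) : MemLp (lowProfile κ k) 2 := by
  have h1 : MemLp ({p : R3 | ‖p‖ < k}.indicator (fun _ => (1 : ℝ))) 2 :=
    memLp_indicator_const 2 (measurableSet_norm_lt k) 1 (.inr (volume_norm_lt_ne_top k))
  refine h1.mono (measurable_lowProfile hκi k).aestronglyMeasurable (.of_forall fun p => ?_)
  rw [norm_of_nonneg (Set.indicator_nonneg (by simp) p)]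
  exact norm_lowProfile_le hκ0 hκ1 k p

open FourierTransform in
theorem integral_norm_sq_lowProfile_ge {R : ℝ} (hκi : Integrable κ) (hκ0 : ∀ x, 0 ≤ κ x)
    (hκ1 : ∫ x, κ x = 1) (hR : 0 ≤ R) (hκR : ∀ x, R < ‖x‖ → κ x = 0) {k : ℝ} (hk : 0 ≤ k) :
    (1 - 4 * π * R * k) * (4 / 3 * π * k ^ 3) ≤ ∫ p, ‖𝓕⁻ (lowProfile κ k) p‖ ^ 2 := by
  rw [integral_norm_sq_fourierInv_eq (integrable_lowProfile hκi hκ0 hκ1 k)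
    (memLp_lowProfile hκi hκ0 hκ1 k), ← measureReal_norm_lt hk, mul_comm, ← smul_eq_mul,
    ← setIntegral_const, ← integral_indicator (measurableSet_norm_lt k)]
  refine integral_mono ?_ (memLp_lowProfile hκi hκ0 hκ1 k).norm.integrable_sq fun p => ?_
  · exact (integrable_indicator_iff (measurableSet_norm_lt k)).2 (integrable_const _)
  · by_cases hp : p ∈ {p : R3 | ‖p‖ < k}
    · rw [Set.indicator_of_mem hp]
      simp only [lowProfile, Set.indicator_of_mem hp, RCLike.norm_conj]
      have h1 := one_sub_le_norm_fourierInv hκi hκ0 hκ1 hκR p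
      have h2 : 2 * π * R * ‖p‖ ≤ 2 * π * R * k :=
        mul_le_mul_of_nonneg_left (le_of_lt hp) (by positivity)
      have h3 := norm_nonneg (𝓕⁻ (fun x => (κ x : ℂ)) p)
      nlinarith [sq_nonneg (1 - ‖𝓕⁻ (fun x => (κ x : ℂ)) p‖)]
    · rw [Set.indicator_of_notMem hp]
      positivity

open FourierTransform in
theorem integral_norm_sq_lowProfile_sub_le (hκi : Integrable κ) (hκ0 : ∀ x, 0 ≤ κ x)
    (hκ1 : ∫ x, κ x = 1) {k l : ℝ} (hk : 0 ≤ k) (hl : 0 ≤ l) :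
    ∫ p, ‖𝓕⁻ (lowProfile κ k) p - 𝓕⁻ (lowProfile κ l) p‖ ^ 2 ≤
      |4 / 3 * π * k ^ 3 - 4 / 3 * π * l ^ 3| := by
  wlog hkl : l ≤ k generalizing k l
  · have := this hl hk (le_of_not_ge hkl)
    rw [abs_sub_comm]
    refine le_trans (le_of_eq ?_) this
    congr with p
    rw [norm_sub_rev]
  have ik := integrable_lowProfile hκi hκ0 hκ1 k
  have il := integrable_lowProfile hκi hκ0 hκ1 l
  have e : ∀ p, 𝓕⁻ (lowProfile κ k) p - 𝓕⁻ (lowProfile κ l) p =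
      𝓕⁻ (lowProfile κ k - lowProfile κ l) p := by
    intro p
    rw [sub_eq_add_neg, sub_eq_add_neg]
    simp only [Real.fourierInv_eq]
    rw [← integral_neg, ← integral_add]
    · congr with x
      simp [smul_add]
    · exact (Real.fourierIntegral_convergent_iff (-p)).2 ik |>.congr (.of_forall fun x => by simp)
    · exact ((Real.fourierIntegral_convergent_iff (-p)).2 il).neg.congr (.of_forall fun x => by simp)
  simp only [e]
  rw [integral_norm_sq_fourierInv_eq (ik.sub il)
    ((memLp_lowProfile hκi hκ0 hκ1 k).sub (memLp_lowProfile hκi hκ0 hκ1 l)),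
    ← measureReal_norm_lt hk, ← measureReal_norm_lt hl]
  refine le_trans ?_ (le_abs_self _)
  have hi : ∀ r : ℝ, ∫ p, {p : R3 | ‖p‖ < r}.indicator (fun _ => (1 : ℝ)) p =
      (volume : Measure R3).real {p : R3 | ‖p‖ < r} := fun r => by
    rw [integral_indicator (measurableSet_norm_lt r), setIntegral_const, smul_eq_mul, mul_one]
  rw [← hi, ← hi, ← integral_sub (integrable_indicator_norm_lt k) (integrable_indicator_norm_lt l)]
  refine integral_mono ((memLp_lowProfile hκi hκ0 hκ1 k).sub
    (memLp_lowProfile hκi hκ0 hκ1 l)).norm.integrable_sq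
    ((integrable_indicator_norm_lt k).sub (integrable_indicator_norm_lt l)) fun p => ?_
  have h1 := norm_fourierInv_density_le_one hκ0 hκ1 p
  simp only [lowProfile, Pi.sub_apply]
  by_cases hp : ‖p‖ < l
  · have hp' : ‖p‖ < k := hp.trans_le hkl
    simp [hp, hp']
  · by_cases hp' : ‖p‖ < k
    · simp only [Set.indicator, Set.mem_ofPred_eq, hp, hp', if_true, if_false, sub_zero,
        RCLike.norm_conj]
      exact pow_le_one₀ (norm_nonneg _) h1
    · simp [hp, hp']

open FourierTransform in
theorem exists_overlap_radius {R : ℝ} (hκi : Integrable κ) (hκ0 : ∀ x, 0 ≤ κ x)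
    (hκ1 : ∫ x, κ x = 1) (hR : 0 ≤ R) (hκR : ∀ x, R < ‖x‖ → κ x = 0) (K : ℝ) {η : ℝ}
    (hη : 0 < η) : ∃ T : ℝ, 0 < T ∧ ∀ k, 0 ≤ k → k ≤ K →
      (1 - 4 * π * R * k) * (4 / 3 * π * k ^ 3) - η ≤
        ∫ z in {z | ‖z‖ < T}, ‖𝓕⁻ (lowProfile κ k) z‖ ^ 2 := by
  have hm : ∀ k, MemLp (𝓕⁻ (lowProfile κ k)) 2 := fun k =>
    memLp_fourierInv (integrable_lowProfile hκi hκ0 hκ1 k) (memLp_lowProfile hκi hκ0 hκ1 k)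
  have hsq : ∀ k, Integrable (fun z => ‖𝓕⁻ (lowProfile κ k) z‖ ^ 2) := fun k =>
    (hm k).norm.integrable_sq
  have hloc : ∀ k, 0 ≤ k → ∃ T : ℝ, ∀ t ≥ T,
      ∫ z in {z : R3 | ‖z‖ < t}ᶜ, ‖𝓕⁻ (lowProfile κ k) z‖ ^ 2 ≤ η / 4 := by
    intro k _
    have h1 := tendsto_setIntegral_of_monotone (μ := (volume : Measure R3))
      (s := fun n : ℕ => {z : R3 | ‖z‖ < n}) (f := fun z => ‖𝓕⁻ (lowProfile κ k) z‖ ^ 2)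
      (fun n => measurableSet_norm_lt n)
      (fun m n hmn z (hz : ‖z‖ < m) => show ‖z‖ < (n : ℝ) from
        hz.trans_le (Nat.cast_le.2 hmn)) (hsq k).integrableOn
    have hU : ⋃ n : ℕ, {z : R3 | ‖z‖ < n} = Set.univ := by
      ext z
      simpa using exists_nat_gt ‖z‖
    rw [hU, setIntegral_univ] at h1
    obtain ⟨n, hn⟩ := (h1.eventually
      (eventually_ge_nhds (show (∫ z, ‖𝓕⁻ (lowProfile κ k) z‖ ^ 2) - η / 4 < _ by linarith))).exists
    refine ⟨n, fun t ht => ?_⟩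
    have h2 := integral_add_compl (measurableSet_norm_lt t) (hsq k)
    have h3 : ∫ z in {z : R3 | ‖z‖ < n}, ‖𝓕⁻ (lowProfile κ k) z‖ ^ 2 ≤
        ∫ z in {z : R3 | ‖z‖ < t}, ‖𝓕⁻ (lowProfile κ k) z‖ ^ 2 :=
      setIntegral_mono_set (hsq k).integrableOn (.of_forall fun _ => by positivity)
        (.of_forall fun z hz => lt_of_lt_of_le hz ht)
    linarith
  have hc : ∃ T : ℝ, ∀ t ≥ T, ∀ k ∈ Set.Icc 0 K,
      ∫ z in {z : R3 | ‖z‖ < t}ᶜ, ‖𝓕⁻ (lowProfile κ k) z‖ ^ 2 ≤ η := by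
    refine isCompact_Icc.induction_on (p := fun S => ∃ T : ℝ, ∀ t ≥ T, ∀ k ∈ S,
      ∫ z in {z : R3 | ‖z‖ < t}ᶜ, ‖𝓕⁻ (lowProfile κ k) z‖ ^ 2 ≤ η) ⟨0, by simp⟩ ?_ ?_ ?_
    · rintro S S' hS ⟨T, hT⟩
      exact ⟨T, fun t ht k hk => hT t ht k (hS hk)⟩
    · rintro S S' ⟨T, hT⟩ ⟨T', hT'⟩
      refine ⟨max T T', fun t ht k hk => hk.elim (fun hk => ?_) fun hk => ?_⟩
      · exact hT t ((le_max_left _ _).trans ht) k hk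
      · exact hT' t ((le_max_right _ _).trans ht) k hk
    · intro k hk
      obtain ⟨T, hT⟩ := hloc k hk.1
      refine ⟨{l | 0 ≤ l ∧ |4 / 3 * π * l ^ 3 - 4 / 3 * π * k ^ 3| < η / 4}, ?_, T, ?_⟩
      · have hcont : Continuous fun l : ℝ => |4 / 3 * π * l ^ 3 - 4 / 3 * π * k ^ 3| := by fun_prop
        have h1 : ∀ᶠ l in nhdsWithin k (Set.Icc 0 K),
            |4 / 3 * π * l ^ 3 - 4 / 3 * π * k ^ 3| < η / 4 :=
          nhdsWithin_le_nhds (hcont.continuousAt.eventually_lt_const (by simpa using by positivity))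
        filter_upwards [h1, self_mem_nhdsWithin] with l hl hl'
        exact ⟨hl'.1, hl⟩
      · rintro t ht l ⟨hl0, hl⟩
        have h1 := hT t ht
        have h2 := (integral_norm_sq_lowProfile_sub_le hκi hκ0 hκ1 hl0 hk.1).trans hl.le
        have isub : Integrable (fun z => ‖𝓕⁻ (lowProfile κ l) z - 𝓕⁻ (lowProfile κ k) z‖ ^ 2) :=
          ((hm l).sub (hm k)).norm.integrable_sq
        have h3 : ∫ z in {z : R3 | ‖z‖ < t}ᶜ, ‖𝓕⁻ (lowProfile κ l) z -
            𝓕⁻ (lowProfile κ k) z‖ ^ 2 ≤ _ :=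
          (setIntegral_le_integral isub (.of_forall fun _ => by positivity)).trans h2
        have h4 : ∫ z in {z : R3 | ‖z‖ < t}ᶜ, ‖𝓕⁻ (lowProfile κ l) z‖ ^ 2 ≤
            ∫ z in {z : R3 | ‖z‖ < t}ᶜ, (2 * ‖𝓕⁻ (lowProfile κ l) z -
            𝓕⁻ (lowProfile κ k) z‖ ^ 2 + 2 * ‖𝓕⁻ (lowProfile κ k) z‖ ^ 2) := by
          refine setIntegral_mono (hsq l).integrableOn
            ((isub.const_mul 2).add ((hsq k).const_mul 2)).integrableOn fun z => ?_
          have := norm_add_le (𝓕⁻ (lowProfile κ l) z - 𝓕⁻ (lowProfile κ k) z)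
            (𝓕⁻ (lowProfile κ k) z)
          rw [sub_add_cancel] at this
          have h0 := norm_nonneg (𝓕⁻ (lowProfile κ l) z)
          nlinarith [sq_nonneg (‖𝓕⁻ (lowProfile κ l) z - 𝓕⁻ (lowProfile κ k) z‖ -
            ‖𝓕⁻ (lowProfile κ k) z‖)]
        rw [integral_add (isub.const_mul 2).integrableOn ((hsq k).const_mul 2).integrableOn,
          integral_const_mul, integral_const_mul] at h4
        linarith
  obtain ⟨T, hT⟩ := hc
  refine ⟨max T 1, by positivity, fun k hk hkK => ?_⟩
  have h1 := hT (max T 1) (le_max_left _ _) k ⟨hk, hkK⟩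
  have h2 := integral_add_compl (measurableSet_norm_lt (max T 1)) (hsq k)
  have h3 := integral_norm_sq_lowProfile_ge hκi hκ0 hκ1 hR hκR hk
  linarith
end

open FourierTransform in
theorem setIntegral_conj_mul_wave (κ : R3 → ℝ) (k : ℝ) (x y : R3) :
    ∫ p in {p | ‖p‖ < k}, (starRingEnd ℂ) (𝓕⁻ (fun x => (κ (x - y) : ℂ)) p) * wave p x =
      𝓕⁻ (lowProfile κ k) (x - y) := by
  rw [Real.fourierInv_eq, ← integral_indicator (measurableSet_norm_lt k)]
  congr with p
  by_cases hp : p ∈ {p : R3 | ‖p‖ < k}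
  · rw [lowProfile, Set.indicator_of_mem hp, Set.indicator_of_mem hp,
      fourierInv_translate (fun x => (κ x : ℂ)), map_mul, Circle.smul_def, smul_eq_mul,
      inner_sub_right, sub_eq_neg_add, AddChar.map_add_eq_mul, AddChar.map_neg_eq_inv,
      Circle.coe_mul, Circle.coe_inv_eq_conj, wave, real_inner_comm x p, real_inner_comm y p]
    ring
  · rw [lowProfile, Set.indicator_of_notMem hp, Set.indicator_of_notMem hp, smul_zero]

section
variable {N : ℕ} {L : ℝ} {f : (Fin N → R3) → ℂ} {B : Set R3}
  {C : Finset (Fin N)} {κ : R3 → ℝ} {R k T : ℝ}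

open Classical in
/-- The probability that particle `j` is separated from the other ones outside `C`. -/
def goodWeight {N : ℕ} (R : ℝ) (C : Finset (Fin N)) (f : (Fin N → R3) → ℂ) (j : Fin N) : ℝ :=
  ∫ X, if j ∈ goodSet R C X then ‖f X‖ ^ 2 else 0

open FourierTransform in
theorem le_scattererOverlap [IsFiniteMeasure ((volume : Measure R3).restrict B)]
    (h : IsTest L f) (hB : openCube L ⊆ B)
    (hBm : MeasurableSet B) (hBT : ∀ y ∈ openCube L, ∀ x, ‖x - y‖ < T → x ∈ B)
    (hκi : Integrable κ) (hκ0 : ∀ x, 0 ≤ κ x) (hκ1 : ∫ x, κ x = 1) (j : Fin N) :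
    (∫ z in {z | ‖z‖ < T}, ‖𝓕⁻ (lowProfile κ k) z‖ ^ 2) * goodWeight R C f j ≤
      scattererOverlap κ R k B C f j := by
  classical
  set M := ∫ z in {z : R3 | ‖z‖ < T}, ‖𝓕⁻ (lowProfile κ k) z‖ ^ 2 with hM
  have hw : Measurable fun w : ((Fin N → R3) × R3) × R3 => (w.2, w.1.2) := by fun_prop
  have hw' : Measurable fun w : ((Fin N → R3) × R3) × R3 => (w.1.1, w.2) := by fun_prop
  have h1 := (((bddMeas_goodProfile hκi R C j).comp hw').conj.mul (bddMeas_wave.comp hw)).integral_right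
    ((volume : Measure R3).restrict {p | ‖p‖ < k})
  have hf1 := h.bddMeas.comp (measurable_fst (α := Fin N → R3) (β := R3))
  have h2 := h1.mul hf1
  have h3 := h2.integrable_sq ((Measure.pi fun _ : Fin N => (volume : Measure R3).restrict B).prod
      (volume.restrict B))
  simp only [norm_mul, mul_pow] at h3
  have hg : BddMeas fun X => (((if j ∈ goodSet R C X then ‖f X‖ ^ 2 else 0 : ℝ)) : ℂ) := by
    constructor
    · exact Complex.measurable_ofReal.comp
        (Measurable.ite (measurableSet_mem_goodSet R C j) (h.bddMeas.meas.norm.pow_const 2)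
          measurable_const)
    · obtain ⟨c, hc⟩ := h.bddMeas.norm_sq.bdd
      refine ⟨c, fun X => ?_⟩
      split_ifs
      · exact hc X
      · simpa using (norm_nonneg _).trans (hc X)
  rw [goodWeight, scattererOverlap, integral_prod _ h3, ← integral_pi_eq_of_supported hB
    (fun X ⟨i, hX⟩ => by simp [h.eq_zero hX]), ← integral_const_mul]
  refine integral_mono ((hg.integrable_real _).const_mul M) h3.integral_prod_left fun X => ?_
  simp only
  rw [integral_mul_const]
  by_cases hX : X j ∈ openCube L
  · split_ifs with hj
    · refine mul_le_mul_of_nonneg_right ?_ (by positivity)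
      have e : ∀ x, ∫ p in {p | ‖p‖ < k}, (starRingEnd ℂ) (goodProfile κ R C j X p) * wave p x =
          𝓕⁻ (lowProfile κ k) (x - X j) := by
        intro x
        rw [← setIntegral_conj_mul_wave]
        simp [goodProfile, hj]
      simp only [e]
      have hsq : Integrable (fun z => ‖𝓕⁻ (lowProfile κ k) z‖ ^ 2) :=
        (memLp_fourierInv (integrable_lowProfile hκi hκ0 hκ1 k)
          (memLp_lowProfile hκi hκ0 hκ1 k)).norm.integrable_sq
      rw [hM, ← integral_indicator (measurableSet_norm_lt T), ← integral_sub_right_eq_self _ (X j),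
        ← integral_indicator hBm]
      refine integral_mono ((hsq.indicator (measurableSet_norm_lt T)).comp_sub_right (X j))
        ((hsq.comp_sub_right (X j)).indicator hBm) fun x => ?_
      simp only
      by_cases hx : ‖x - X j‖ < T
      · rw [Set.indicator_of_mem (by exact hx), Set.indicator_of_mem (hBT _ hX x hx)]
      · rw [Set.indicator_of_notMem (by exact hx)]
        exact Set.indicator_nonneg (fun _ _ => by positivity) _
    · rw [mul_zero]
      exact mul_nonneg (integral_nonneg fun _ => by positivity) (by positivity)
  · simp [h.eq_zero hX]

end

open FourierTransform in
theorem fourierInv_indicator_eq (F : R3 → ℂ) (Q : ℝ) (x : R3) :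
    𝓕⁻ ({p : R3 | ‖p‖ < Q}.indicator F) x = ∫ p in {p | ‖p‖ < Q}, wave p x * F p := by
  rw [Real.fourierInv_eq, ← integral_indicator (measurableSet_norm_lt Q)]
  congr with p
  by_cases hp : p ∈ {p : R3 | ‖p‖ < Q}
  · rw [Set.indicator_of_mem hp, Set.indicator_of_mem hp, Circle.smul_def, smul_eq_mul, wave,
      real_inner_comm]
  · rw [Set.indicator_of_notMem hp, Set.indicator_of_notMem hp, smul_zero]

open FourierTransform in
/-- Cutting a test function into low and high momenta. -/
theorem setIntegral_weight_mul_norm_sq_le {u : R3 → ℂ} (hu : ContDiff ℝ (⊤ : ℕ∞) u)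
    (hc : HasCompactSupport u) {Q : ℝ} (hQ : 0 < Q) {w : R3 → ℝ} (hw : Measurable w)
    (hw0 : ∀ x, 0 ≤ w x) (hw1 : ∀ x, w x ≤ 1) (B : Set R3) :
    ∫ x in B, w x * ‖u x‖ ^ 2 ≤
      2 * (∫ x in B, w x * ‖∫ p in {p | ‖p‖ < Q}, wave p x * 𝓕 u p‖ ^ 2) +
        1 / (2 * π ^ 2 * Q ^ 2) * ∫ x, gradSq u x := by
  have hF := rapidDecay_fourier hu hc
  set S := {p : R3 | ‖p‖ < Q} with hS
  have mS : MeasurableSet S := measurableSet_norm_lt Q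
  have hFl := hF.indicator mS
  have hFh := hF.indicator mS.compl
  have il : Integrable (fun x => ‖𝓕⁻ (S.indicator (𝓕 u)) x‖ ^ 2) :=
    (memLp_fourierInv hFl.integrable hFl.memLp).norm.integrable_sq
  have ih : Integrable (fun x => ‖𝓕⁻ (Sᶜ.indicator (𝓕 u)) x‖ ^ 2) :=
    (memLp_fourierInv hFh.integrable hFh.memLp).norm.integrable_sq
  have hsplit : ∀ x, u x = 𝓕⁻ (S.indicator (𝓕 u)) x + 𝓕⁻ (Sᶜ.indicator (𝓕 u)) x := by
    intro x
    conv_lhs => rw [← fourierInv_fourier_of_test hu hc]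
    simp only [Real.fourierInv_eq]
    rw [← integral_add]
    · congr with p
      rw [← smul_add, ← Pi.add_apply, Set.indicator_self_add_compl]
    · exact (Real.fourierIntegral_convergent_iff (-x)).2 hFl.integrable |>.congr
        (.of_forall fun x => by simp)
    · exact (Real.fourierIntegral_convergent_iff (-x)).2 hFh.integrable |>.congr
        (.of_forall fun x => by simp)
  have hwl : Integrable (fun x => w x * ‖𝓕⁻ (S.indicator (𝓕 u)) x‖ ^ 2) :=
    il.bdd_mul (c := 1) hw.aestronglyMeasurable
      (.of_forall fun x => by rw [norm_of_nonneg (hw0 x)]; exact hw1 x)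
  have iu : Integrable (fun x => ‖u x‖ ^ 2) :=
    (hu.continuous.memLp_of_hasCompactSupport (p := 2) hc).norm.integrable_sq
  have hwu : Integrable (fun x => w x * ‖u x‖ ^ 2) :=
    iu.bdd_mul (c := 1) hw.aestronglyMeasurable
      (.of_forall fun x => by rw [norm_of_nonneg (hw0 x)]; exact hw1 x)
  have hsum : Integrable (fun x => 2 * (w x * ‖𝓕⁻ (S.indicator (𝓕 u)) x‖ ^ 2) +
      2 * ‖𝓕⁻ (Sᶜ.indicator (𝓕 u)) x‖ ^ 2) := (hwl.const_mul 2).add (ih.const_mul 2)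
  have h1 : ∫ x in B, w x * ‖u x‖ ^ 2 ≤ ∫ x in B, (2 * (w x * ‖𝓕⁻ (S.indicator (𝓕 u)) x‖ ^ 2) +
      2 * ‖𝓕⁻ (Sᶜ.indicator (𝓕 u)) x‖ ^ 2) := by
    refine setIntegral_mono hwu.integrableOn hsum.integrableOn fun x => ?_
    simp only
    set A := 𝓕⁻ (S.indicator (𝓕 u)) x with hA
    set E := 𝓕⁻ (Sᶜ.indicator (𝓕 u)) x with hE
    have h2 : ‖u x‖ ≤ ‖A‖ + ‖E‖ := by rw [hsplit x]; exact norm_add_le _ _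
    have h3 : ‖u x‖ ^ 2 ≤ 2 * ‖A‖ ^ 2 + 2 * ‖E‖ ^ 2 := by
      nlinarith [sq_nonneg (‖A‖ - ‖E‖), norm_nonneg (u x)]
    have h4 := mul_le_mul_of_nonneg_left h3 (hw0 x)
    have h5 := mul_le_mul_of_nonneg_right (hw1 x) (sq_nonneg ‖E‖)
    linarith
  rw [integral_add (hwl.const_mul 2).integrableOn (ih.const_mul 2).integrableOn,
    integral_const_mul, integral_const_mul] at h1
  have h2 : ∫ x in B, ‖𝓕⁻ (Sᶜ.indicator (𝓕 u)) x‖ ^ 2 ≤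
      1 / (4 * π ^ 2 * Q ^ 2) * ∫ x, gradSq u x := by
    refine (setIntegral_le_integral ih (.of_forall fun _ => by positivity)).trans ?_
    rw [integral_norm_sq_fourierInv_eq hFh.integrable hFh.memLp]
    have hg := hF.gradSq_fourierInv.2
    rw [fourierInv_fourier_of_test hu hc] at hg
    rw [hg, ← integral_const_mul]
    have hN2 := hF.integrable_moment_sq 2
    have i2 : Integrable fun p => 1 / (4 * π ^ 2 * Q ^ 2) *
        (4 * π ^ 2 * ‖p‖ ^ 2 * ‖𝓕 u p‖ ^ 2) := by
      refine (hN2.const_mul (1 / Q ^ 2)).congr (.of_forall fun p => ?_)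
      simp only
      field_simp
    refine integral_mono hFh.memLp.norm.integrable_sq i2 fun p => ?_
    by_cases hp : p ∈ S
    · rw [Set.indicator_of_notMem (by simpa using hp)]
      rw [norm_zero, zero_pow two_ne_zero]
      exact mul_nonneg (by positivity) (by positivity)
    · rw [Set.indicator_of_mem (by exact hp)]
      have hp' : Q ≤ ‖p‖ := not_lt.1 hp
      have : Q ^ 2 ≤ ‖p‖ ^ 2 := pow_le_pow_left₀ hQ.le hp' 2
      have e : 1 / (4 * π ^ 2 * Q ^ 2) * (4 * π ^ 2 * ‖p‖ ^ 2 * ‖𝓕 u p‖ ^ 2) =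
          ‖p‖ ^ 2 / Q ^ 2 * ‖𝓕 u p‖ ^ 2 := by field_simp
      simp only [e]
      refine le_mul_of_one_le_left (by positivity) ?_
      rwa [one_le_div (by positivity)]
  have e3 : 1 / (2 * π ^ 2 * Q ^ 2) = 2 * (1 / (4 * π ^ 2 * Q ^ 2)) := by
    field_simp; norm_num
  simp only [hS, fourierInv_indicator_eq] at h1 ⊢
  rw [e3]
  linarith

open Classical in
/-- Indicator of the points close to some `X k`, `k ∉ A`. -/
def nearIndicator {N : ℕ} (r : ℝ) (A : Finset (Fin N)) (X : Fin N → R3) (x : R3) : ℝ :=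
  if ∃ k ∈ Aᶜ, ‖x - X k‖ < r then 1 else 0

section
variable {N : ℕ} {L : ℝ} {f : (Fin N → R3) → ℂ} {B : Set R3}
  {C A : Finset (Fin N)} {r : ℝ}

theorem nearIndicator_nonneg (X : Fin N → R3) (x : R3) : 0 ≤ nearIndicator r A X x := by
  unfold nearIndicator; split_ifs <;> norm_num

theorem nearIndicator_le_one (X : Fin N → R3) (x : R3) : nearIndicator r A X x ≤ 1 := by
  unfold nearIndicator; split_ifs <;> norm_num

theorem nearIndicator_sq (X : Fin N → R3) (x : R3) :
    nearIndicator r A X x ^ 2 = nearIndicator r A X x := by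
  unfold nearIndicator; split_ifs <;> norm_num

theorem nearIndicator_update {i : Fin N} (hi : i ∈ A) (X : Fin N → R3) (z : R3) :
    nearIndicator r A (Function.update X i z) = nearIndicator r A X := by
  funext x
  unfold nearIndicator
  congr 1
  refine propext (exists_congr fun k => and_congr_right fun hk => ?_)
  rw [Function.update_of_ne (by rintro rfl; exact Finset.mem_compl.1 hk hi)]

theorem measurable_nearIndicator (r : ℝ) (A : Finset (Fin N)) :
    Measurable fun z : (Fin N → R3) × R3 => nearIndicator r A z.1 z.2 := by
  classical
  refine Measurable.ite ?_ measurable_const measurable_const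
  simp only [Set.ofPred_exists, Set.ofPred_and]
  refine .iUnion fun k => .inter (.const _) ?_
  exact measurableSet_lt (by fun_prop) measurable_const

theorem bddMeas_nearIndicator (r : ℝ) (A : Finset (Fin N)) :
    BddMeas fun z : (Fin N → R3) × R3 => (nearIndicator r A z.1 z.2 : ℂ) := by
  refine ⟨Complex.measurable_ofReal.comp (measurable_nearIndicator r A), 1, fun z => ?_⟩
  rw [Complex.norm_real, norm_of_nonneg (nearIndicator_nonneg _ _)]
  exact nearIndicator_le_one _ _

theorem setIntegral_nearIndicator_le (hr : 0 ≤ r)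
    [IsFiniteMeasure ((volume : Measure R3).restrict B)] (X : Fin N → R3) :
    ∫ x in B, nearIndicator r A X x ≤ N * (4 / 3 * π * r ^ 3) := by
  classical
  have hI : ∀ k : Fin N, Integrable ((Metric.ball (X k) r).indicator fun _ => (1 : ℝ)) := fun k =>
    (integrable_indicator_iff measurableSet_ball).2
      (integrableOn_const measure_ball_lt_top.ne)
  have hm : Measurable (nearIndicator r A X) := by
    have hg : Measurable fun x : R3 => (X, x) := by fun_prop
    have := (measurable_nearIndicator r A).comp hg
    exact this
  have h1 : ∫ x in B, nearIndicator r A X x ≤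
      ∫ x in B, ∑ k : Fin N, (Metric.ball (X k) r).indicator (fun _ => (1 : ℝ)) x := by
    refine integral_mono ?_ (integrable_finsetSum _ fun k _ => (hI k).integrableOn) fun x => ?_
    · refine Integrable.of_bound hm.aestronglyMeasurable 1 (.of_forall fun x => ?_)
      rw [norm_of_nonneg (nearIndicator_nonneg _ _)]
      exact nearIndicator_le_one _ _
    · have h0 : ∀ k ∈ Finset.univ, 0 ≤ (Metric.ball (X k) r).indicator (fun _ => (1 : ℝ)) x :=
        fun k _ => Set.indicator_nonneg (fun _ _ => zero_le_one) x
      unfold nearIndicator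
      split_ifs with h
      · obtain ⟨k, -, hk⟩ := h
        refine le_trans ?_ (Finset.single_le_sum h0 (Finset.mem_univ k))
        rw [Set.indicator_of_mem (by simpa [dist_eq_norm] using hk)]
      · exact Finset.sum_nonneg h0
  refine h1.trans ?_
  refine (setIntegral_le_integral (integrable_finsetSum _ fun k _ => hI k)
    (.of_forall fun x => Finset.sum_nonneg fun k _ =>
      Set.indicator_nonneg (fun _ _ => zero_le_one) x)).trans (le_of_eq ?_)
  rw [integral_finsetSum _ fun k _ => hI k]
  have : ∀ k : Fin N, ∫ x, (Metric.ball (X k) r).indicator (fun _ => (1 : ℝ)) x =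
      4 / 3 * π * r ^ 3 := by
    intro k
    rw [integral_indicator measurableSet_ball, setIntegral_const, smul_eq_mul, mul_one,
      measureReal_def, EuclideanSpace.volume_ball_fin_three, ENNReal.toReal_mul,
      ENNReal.toReal_pow, ENNReal.toReal_ofReal hr, ENNReal.toReal_ofReal (by positivity)]
    ring
  simp [this]

open FourierTransform in
theorem setIntegral_norm_sq_kernel_le (Q : ℝ) (hQ : 0 ≤ Q) (x : R3) (B : Set R3) :
    ∫ z in B, ‖∫ p in {p | ‖p‖ < Q}, wave p z * (starRingEnd ℂ) (wave p x)‖ ^ 2 ≤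
      4 / 3 * π * Q ^ 3 := by
  set S := {p : R3 | ‖p‖ < Q} with hS
  have mS : MeasurableSet S := measurableSet_norm_lt Q
  set F : R3 → ℂ := S.indicator fun p => (starRingEnd ℂ) (wave p x) with hF
  have hm : Measurable fun p => (starRingEnd ℂ) (wave p x) := by
    have hg : Measurable fun p : R3 => (p, x) := by fun_prop
    have := (bddMeas_wave.comp hg).conj.meas
    exact this
  have hn : ∀ p, ‖F p‖ = S.indicator (fun _ => (1 : ℝ)) p := by
    intro p
    rw [hF, norm_indicator_eq_indicator_norm]
    simp [norm_wave]
  have hL : MemLp F 2 := by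
    have h1 : MemLp (S.indicator (fun _ => (1 : ℝ))) 2 :=
      memLp_indicator_const 2 mS 1 (.inr (volume_norm_lt_ne_top Q))
    exact h1.mono (hm.indicator mS).aestronglyMeasurable (.of_forall fun p => by
      rw [hn p, norm_of_nonneg (Set.indicator_nonneg (by simp) p)])
  have hI : Integrable F := (integrable_indicator_norm_lt Q).mono'
    (hm.indicator mS).aestronglyMeasurable (.of_forall fun p => (hn p).le)
  have h1 : ∫ z in B, ‖𝓕⁻ F z‖ ^ 2 ≤ ∫ z, ‖𝓕⁻ F z‖ ^ 2 :=
    setIntegral_le_integral (memLp_fourierInv hI hL).norm.integrable_sq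
      (.of_forall fun _ => by positivity)
  rw [integral_norm_sq_fourierInv_eq hI hL] at h1
  simp only [hF, hS, fourierInv_indicator_eq] at h1
  rw [hS]
  refine h1.trans (le_of_eq ?_)
  rw [← measureReal_norm_lt hQ, ← mul_one (volume.real _), ← smul_eq_mul, ← setIntegral_const,
    ← integral_indicator mS]
  congr with p
  have := hn p
  rw [hF] at this
  rw [this]
  by_cases hp : p ∈ S <;> simp [hp]
end

section
variable {N : ℕ} {L : ℝ} {f : (Fin N → R3) → ℂ} {B : Set R3}
  {C A : Finset (Fin N)} {r : ℝ}

theorem bddMeas_nearIndicator_mul (h : IsTest L f) (i : Fin N) :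
    BddMeas fun X => ((nearIndicator r A X (X i) * ‖f X‖ ^ 2 : ℝ) : ℂ) := by
  have hg : Measurable fun X : Fin N → R3 => (X, X i) := by fun_prop
  have := ((bddMeas_nearIndicator r A).comp hg).mul h.bddMeas.norm_sq
  simpa using this

/-- The Pauli principle at a point: low-momentum particles are dilute. -/
theorem sum_low_momentum_near_le [IsFiniteMeasure ((volume : Measure R3).restrict B)]
    (hV : ((volume : Measure R3).restrict B).real Set.univ ≠ 0)
    (h : IsTest L f) (hCA : C ⊆ A)
    (hanti : ∀ i ∈ C, ∀ k ∈ C, i ≠ k → ∀ X, f (X ∘ Equiv.swap i k) = -f X)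
    {Q : ℝ} (hQ : 0 ≤ Q) (x : R3) :
    ∑ i ∈ C, ((volume.restrict B).real Set.univ)⁻¹ * ∫ X, nearIndicator r A X x *
      ‖∫ p in {p | ‖p‖ < Q}, wave p x * ∫ z, (starRingEnd ℂ) (wave p z) *
        f (Function.update X i z) ∂(volume.restrict B)‖ ^ 2
        ∂(Measure.pi fun _ => volume.restrict B) ≤
    4 / 3 * π * Q ^ 3 * ∫ X, nearIndicator r A X x * ‖f X‖ ^ 2
      ∂(Measure.pi fun _ => volume.restrict B) := by
  set ν := (volume : Measure R3).restrict B with hν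
  set μ := (volume : Measure R3).restrict {p | ‖p‖ < Q} with hμ
  set J : R3 → ℂ := fun z => ∫ p, wave p z * (starRingEnd ℂ) (wave p x) ∂μ with hJ
  have hw1 : Measurable fun w : R3 × R3 => (w.2, w.1) := by fun_prop
  have hw2 : Measurable fun w : R3 × R3 => (w.2, x) := by fun_prop
  have hJb : BddMeas J := by
    have := ((bddMeas_wave.comp hw1).mul (bddMeas_wave.comp hw2).conj).integral_right μ
    exact this
  have hnx : BddMeas fun X : Fin N → R3 => (nearIndicator r A X x : ℂ) := by
    have hg : Measurable fun X : Fin N → R3 => (X, x) := by fun_prop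
    have := (bddMeas_nearIndicator r A).comp hg
    exact this
  set g : (Fin N → R3) → R3 → ℂ := fun X z => (nearIndicator r A X x : ℂ) * J z with hg
  have hgb : BddMeas fun z : (Fin N → R3) × R3 => g z.1 z.2 :=
    (hnx.comp measurable_fst).mul (hJb.comp measurable_snd)
  have hgC : ∀ i ∈ C, ∀ X z, g (Function.update X i z) = g X := by
    intro i hi X z
    simp only [hg, nearIndicator_update (hCA hi)]
  have main := sum_occupation_le ν hV h.bddMeas hanti hgb hgC
  have e1 : ∀ i X, ‖∫ z, (starRingEnd ℂ) (g X z) * f (Function.update X i z) ∂ν‖ ^ 2 =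
      nearIndicator r A X x * ‖∫ p, wave p x * ∫ z, (starRingEnd ℂ) (wave p z) *
        f (Function.update X i z) ∂ν ∂μ‖ ^ 2 := by
    intro i X
    have hfu : BddMeas fun w : R3 × R3 => f (Function.update X i w.1) := by
      have hh : Measurable fun w : R3 × R3 => Function.update X i w.1 := by fun_prop
      exact h.bddMeas.comp hh
    have hsw := (((bddMeas_wave.comp hw2).mul (bddMeas_wave.comp hw1).conj).mul hfu).swap_integral
      ν μ
    have e2 : ∫ z, (starRingEnd ℂ) (g X z) * f (Function.update X i z) ∂ν =
        (nearIndicator r A X x : ℂ) * ∫ p, wave p x * ∫ z, (starRingEnd ℂ) (wave p z) *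
        f (Function.update X i z) ∂ν ∂μ := by
      rw [← integral_const_mul]
      simp only [hg, hJ, map_mul, Complex.conj_ofReal, mul_assoc, ← integral_conj,
        RingHomCompTriple.comp_apply, RingHom.id_apply]
      rw [integral_const_mul]
      simp only [← integral_mul_const]
      rw [integral_const_mul]
      congr 1
      simp only [← integral_const_mul]
      refine Eq.trans ?_ (hsw.trans ?_)
      · simp only
        refine integral_congr_ae (.of_forall fun z => integral_congr_ae (.of_forall fun p => ?_))
        simp only
        ring
      · refine integral_congr_ae (.of_forall fun z => integral_congr_ae (.of_forall fun p => ?_))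
        simp only
        ring
    rw [e2, norm_mul, mul_pow, Complex.norm_real, norm_of_nonneg (nearIndicator_nonneg _ _),
      nearIndicator_sq]
  simp only [e1] at main
  refine main.trans ?_
  have e3 : ∫ z, ‖g z.1 z.2‖ ^ 2 * ‖f z.1‖ ^ 2 ∂((Measure.pi fun _ => ν).prod ν) =
      (∫ X, nearIndicator r A X x * ‖f X‖ ^ 2 ∂(Measure.pi fun _ => ν)) * ∫ z, ‖J z‖ ^ 2 ∂ν := by
    rw [← integral_prod_mul]
    congr with z
    rw [hg, norm_mul, mul_pow, Complex.norm_real, norm_of_nonneg (nearIndicator_nonneg _ _),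
      nearIndicator_sq]
    ring
  rw [e3, mul_comm]
  refine mul_le_mul_of_nonneg_right (setIntegral_norm_sq_kernel_le Q hQ x B)
    (integral_nonneg fun X => mul_nonneg (nearIndicator_nonneg _ _) (by positivity))

open FourierTransform in
/-- Particles in `C` are rarely close to particles outside `A`. -/
theorem sum_near_le [IsFiniteMeasure ((volume : Measure R3).restrict B)]
    (hV : ((volume : Measure R3).restrict B).real Set.univ ≠ 0)
    (h : IsTest L f) (hB : openCube L ⊆ B) (hCA : C ⊆ A)
    (hanti : ∀ i ∈ C, ∀ k ∈ C, i ≠ k → ∀ X, f (X ∘ Equiv.swap i k) = -f X)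
    {Q : ℝ} (hQ : 0 < Q) (hr : 0 ≤ r) :
    ∑ i ∈ C, ∫ X, nearIndicator r A X (X i) * ‖f X‖ ^ 2 ≤
      2 * (4 / 3 * π * Q ^ 3) * (N * (4 / 3 * π * r ^ 3)) * (∫ X, ‖f X‖ ^ 2) +
        1 / (2 * π ^ 2 * Q ^ 2) * ∑ i ∈ C, ∫ X, gradSqAt f i X := by
  set ν := (volume : Measure R3).restrict B with hν
  set V := ν.real Set.univ with hVdef
  have V0 : 0 < V := lt_of_le_of_ne measureReal_nonneg hV.symm
  set P := Measure.pi fun _ : Fin N => ν with hP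
  set c := 1 / (2 * π ^ 2 * Q ^ 2) with hc
  set Lw : Fin N → (Fin N → R3) → R3 → ℂ := fun i X x =>
    ∫ p in {p | ‖p‖ < Q}, wave p x * 𝓕 (slice f i X) p with hLw
  have hLb : ∀ i, BddMeas fun z : (Fin N → R3) × R3 => Lw i z.1 z.2 := by
    intro i
    have h1 : Measurable fun w : ((Fin N → R3) × R3) × R3 => (w.2, w.1.2) := by fun_prop
    have h2 : Measurable fun w : ((Fin N → R3) × R3) × R3 => (w.1.1, w.2) := by fun_prop
    have := ((bddMeas_wave.comp h1).mul ((h.bddMeas_fourier_slice i).comp h2)).integral_right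
      ((volume : Measure R3).restrict {p | ‖p‖ < Q})
    exact this
  have hLn : ∀ i, BddMeas fun z : (Fin N → R3) × R3 =>
      ((nearIndicator r A z.1 z.2 * ‖Lw i z.1 z.2‖ ^ 2 : ℝ) : ℂ) := by
    intro i
    have := (bddMeas_nearIndicator r A).mul (hLb i).norm_sq
    simpa using this
  have step1 : ∀ i ∈ C, ∫ X, nearIndicator r A X (X i) * ‖f X‖ ^ 2 ≤
      2 * (V⁻¹ * ∫ x, ∫ X, nearIndicator r A X x * ‖Lw i X x‖ ^ 2 ∂P ∂ν) +
        c * ∫ X, gradSqAt f i X := by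
    intro i hi
    have i1 : Integrable (fun X => ∫ x, nearIndicator r A X x * ‖Lw i X x‖ ^ 2 ∂ν) P :=
      ((hLn i).integrable_real (P.prod ν)).integral_prod_left
    have i2 : Integrable (fun X => ∫ x, gradSqAt f i (Function.update X i x) ∂ν) P := by
      have b := ((h.bddMeas_gradSqAt i).comp (measurable_update_prod i))
      exact (b.integrable_real (P.prod ν)).integral_prod_left
    have b0 := (bddMeas_nearIndicator_mul (r := r) (A := A) h i)
    have i0 : Integrable (fun X => ∫ x, nearIndicator r A (Function.update X i x)
        (Function.update X i x i) * ‖f (Function.update X i x)‖ ^ 2 ∂ν) P := by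
      have b := b0.comp (measurable_update_prod i)
      exact (b.integrable_real (P.prod ν)).integral_prod_left
    have hpt : ∀ X, ∫ x, nearIndicator r A (Function.update X i x)
        (Function.update X i x i) * ‖f (Function.update X i x)‖ ^ 2 ∂ν ≤
        2 * (∫ x, nearIndicator r A X x * ‖Lw i X x‖ ^ 2 ∂ν) +
          c * ∫ x, gradSqAt f i (Function.update X i x) ∂ν := by
      intro X
      have hm : Measurable (nearIndicator r A X) := by
        have hg : Measurable fun x : R3 => (X, x) := by fun_prop
        have := (measurable_nearIndicator r A).comp hg
        exact this
      have := setIntegral_weight_mul_norm_sq_le (h.smooth_slice i X)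
        (h.hasCompactSupport_slice i X) hQ hm (nearIndicator_nonneg X) (nearIndicator_le_one X) B
      have e2 : ∫ x, gradSqAt f i (Function.update X i x) ∂ν = ∫ x, gradSq (slice f i X) x := by
        simp only [IsTest.gradSq_slice]
        exact setIntegral_eq_of_supported hB fun x hx =>
          h.gradSqAt_eq_zero i (k := i) (by simpa using hx)
      rw [e2]
      refine le_trans (le_of_eq ?_) this
      simp only [nearIndicator_update (hCA hi), Function.update_self, slice, hν]
    have hI := integral_mono i0 ((i1.const_mul 2).add (i2.const_mul c)) hpt
    rw [integral_add' (i1.const_mul 2) (i2.const_mul c), integral_const_mul, integral_const_mul,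
      integral_update_real ν i b0, integral_update_real ν i (h.bddMeas_gradSqAt i),
      integral_pi_eq_of_supported hB (fun X ⟨k, hX⟩ => by simp [h.eq_zero hX]),
      integral_pi_eq_of_supported hB (fun X ⟨k, hX⟩ => h.gradSqAt_eq_zero i hX)] at hI
    have hsw : ∫ X, ∫ x, nearIndicator r A X x * ‖Lw i X x‖ ^ 2 ∂ν ∂P =
        ∫ x, ∫ X, nearIndicator r A X x * ‖Lw i X x‖ ^ 2 ∂P ∂ν :=
      integral_integral_swap (f := fun X x => nearIndicator r A X x * ‖Lw i X x‖ ^ 2)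
        ((hLn i).integrable_real (P.prod ν))
    rw [hsw] at hI
    refine le_of_mul_le_mul_left (hI.trans (le_of_eq ?_)) V0
    rw [← hVdef]
    field_simp
  refine (Finset.sum_le_sum step1).trans ?_
  rw [Finset.sum_add_distrib]
  have hsum : ∑ i ∈ C, V⁻¹ * ∫ x, ∫ X, nearIndicator r A X x * ‖Lw i X x‖ ^ 2 ∂P ∂ν ≤
      (4 / 3 * π * Q ^ 3) * (N * (4 / 3 * π * r ^ 3)) * (∫ X, ‖f X‖ ^ 2) := by
    have hswm : Measurable fun z : R3 × (Fin N → R3) => (z.2, z.1) := by fun_prop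
    have j1 : ∀ i ∈ C, Integrable (fun x => V⁻¹ *
        ∫ X, nearIndicator r A X x * ‖Lw i X x‖ ^ 2 ∂P) ν := by
      intro i _
      have b := (hLn i).comp hswm
      exact ((b.integrable_real (ν.prod P)).integral_prod_left).const_mul _
    have bn : BddMeas fun z : (Fin N → R3) × R3 =>
        ((nearIndicator r A z.1 z.2 * ‖f z.1‖ ^ 2 : ℝ) : ℂ) := by
      have := (bddMeas_nearIndicator r A).mul (h.bddMeas.norm_sq.comp measurable_fst)
      simpa using this
    have j2 : Integrable (fun x => ∫ X, nearIndicator r A X x * ‖f X‖ ^ 2 ∂P) ν := by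
      have b := bn.comp hswm
      exact (b.integrable_real (ν.prod P)).integral_prod_left
    have j3 : Integrable (fun X => ∫ x, nearIndicator r A X x * ‖f X‖ ^ 2 ∂ν) P :=
      (bn.integrable_real (P.prod ν)).integral_prod_left
    simp only [← integral_const_mul] at j1 ⊢
    rw [← integral_finsetSum _ j1]
    have hpt : ∀ x, ∑ i ∈ C, ∫ X, V⁻¹ * (nearIndicator r A X x * ‖Lw i X x‖ ^ 2) ∂P ≤
        4 / 3 * π * Q ^ 3 * ∫ X, nearIndicator r A X x * ‖f X‖ ^ 2 ∂P := by
      intro x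
      simp only [integral_const_mul, hLw, h.fourier_slice hB]
      exact sum_low_momentum_near_le hV h hCA hanti hQ.le x
    refine (integral_mono (integrable_finsetSum _ j1) (j2.const_mul _) hpt).trans ?_
    rw [integral_const_mul, integral_const_mul]
    refine (mul_le_mul_of_nonneg_left ?_ (by positivity)).trans (mul_assoc _ _ _).ge
    have hsw : ∫ x, ∫ X, nearIndicator r A X x * ‖f X‖ ^ 2 ∂P ∂ν =
        ∫ X, ∫ x, nearIndicator r A X x * ‖f X‖ ^ 2 ∂ν ∂P :=
      (integral_integral_swap (f := fun X x => nearIndicator r A X x * ‖f X‖ ^ 2)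
        (bn.integrable_real (P.prod ν))).symm
    have hz : ∀ X : Fin N → R3, (∃ k, X k ∉ openCube L) → ‖f X‖ ^ 2 = 0 := fun X ⟨k, hX⟩ => by
      simp [h.eq_zero hX]
    rw [hsw, ← integral_pi_eq_of_supported hB hz,
      ← integral_const_mul]
    refine integral_mono j3 ((h.bddMeas.integrable_sq P).const_mul _) fun X => ?_
    simp only
    rw [integral_mul_const]
    exact mul_le_mul_of_nonneg_right (setIntegral_nearIndicator_le hr X) (by positivity)
  refine add_le_add ?_ (Finset.mul_sum _ _ _).ge
  refine (Finset.mul_sum _ _ _).ge.trans ?_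
  linarith
end

section
variable {N q : ℕ} {L : ℝ} {f : (Fin N → R3) → ℂ} {B : Set R3} {r : ℝ}

/-- Averaging over all splittings of the particles into two groups. -/
theorem card_close_le (r : ℝ) (X : Fin N → R3) (S : Finset (Fin N))
    (hS : ∀ j ∈ S, ∃ k, k ≠ j ∧ ‖X j - X k‖ < r) :
    2 ^ N * (S.card : ℝ) ≤ 4 * ∑ A : Finset (Fin N), ∑ i ∈ A, nearIndicator r A X (X i) := by
  classical
  have e : ∑ A : Finset (Fin N), ∑ i ∈ A, nearIndicator r A X (X i) =
      ∑ i, ∑ A : Finset (Fin N), if i ∈ A then nearIndicator r A X (X i) else 0 := by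
    rw [Finset.sum_comm]
    refine Finset.sum_congr rfl fun A _ => ?_
    rw [← Finset.sum_filter]
    congr 1
    ext; simp
  have hpos : ∀ i, 0 ≤ ∑ A : Finset (Fin N), if i ∈ A then nearIndicator r A X (X i) else 0 :=
    fun i => Finset.sum_nonneg fun A _ => by
      split_ifs
      · exact nearIndicator_nonneg _ _
      · exact le_rfl
  have key : ∀ j ∈ S, 2 ^ N ≤
      4 * ∑ A : Finset (Fin N), if j ∈ A then nearIndicator r A X (X j) else 0 := by
    intro j hj
    obtain ⟨k, hkj, hk⟩ := hS j hj
    have hsub : ({j} : Finset (Fin N)) ⊆ Finset.univ.erase k := by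
      simp [Finset.subset_iff, hkj.symm]
    have hcard := Finset.card_Icc_finset hsub
    rw [Finset.card_erase_of_mem (Finset.mem_univ k), Finset.card_univ, Fintype.card_fin,
      Finset.card_singleton] at hcard
    have hN : 2 ≤ N := by
      have := Fintype.one_lt_card_iff.2 ⟨k, j, hkj⟩
      rw [Fintype.card_fin] at this
      omega
    have hle : ((Finset.Icc ({j} : Finset (Fin N)) (Finset.univ.erase k)).card : ℝ) ≤
        ∑ A : Finset (Fin N), if j ∈ A then nearIndicator r A X (X j) else 0 := by
      rw [Finset.card_eq_sum_ones, Nat.cast_sum]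
      refine (Finset.sum_le_sum fun A hA => ?_).trans
        (Finset.sum_le_sum_of_subset_of_nonneg (Finset.subset_univ _) fun A _ _ => by
          split_ifs
          · exact nearIndicator_nonneg _ _
          · exact le_rfl)
      rw [Finset.mem_Icc] at hA
      have hjA : j ∈ A := hA.1 (Finset.mem_singleton_self j)
      have hkA : k ∈ Aᶜ := Finset.mem_compl.2 fun h => (Finset.mem_erase.1 (hA.2 h)).1 rfl
      rw [if_pos hjA, nearIndicator, if_pos ⟨k, hkA, hk⟩, Nat.cast_one]
    rw [hcard] at hle
    obtain ⟨m, rfl⟩ := Nat.exists_eq_add_of_le' hN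
    push_cast at hle
    rw [pow_add]
    linarith
  rw [e, mul_comm, ← nsmul_eq_mul, ← Finset.sum_const, Finset.mul_sum]
  refine (Finset.sum_le_sum key).trans ?_
  exact Finset.sum_le_sum_of_subset_of_nonneg (Finset.subset_univ _) fun i _ _ =>
    mul_nonneg (by norm_num) (hpos i)

theorem IsTest.integrable_norm_sq (h : IsTest L f) : Integrable fun X => ‖f X‖ ^ 2 := by
  have hc : Continuous fun X => ‖f X‖ ^ 2 := h.smooth.continuous.norm.pow 2
  have hs : HasCompactSupport fun X => ‖f X‖ ^ 2 := by
    refine h.hasCompactSupport.mono fun X hX => ?_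
    contrapose! hX
    simp at hX
    simp [hX]
  exact hc.integrable_of_hasCompactSupport hs

theorem integrable_nearIndicator_mul (h : IsTest L f) (A : Finset (Fin N)) (i : Fin N) :
    Integrable fun X => nearIndicator r A X (X i) * ‖f X‖ ^ 2 := by
  have hg : Measurable fun X : Fin N → R3 => (X, X i) := by fun_prop
  have hm : Measurable fun X : Fin N → R3 => nearIndicator r A X (X i) := by
    have := (measurable_nearIndicator r A).comp hg
    exact this
  have hf : Measurable fun X => ‖f X‖ ^ 2 := h.bddMeas.meas.norm.pow_const 2
  have hmf : Measurable fun X => nearIndicator r A X (X i) * ‖f X‖ ^ 2 := hm.mul hf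
  refine h.integrable_norm_sq.mono' hmf.aestronglyMeasurable (.of_forall fun X => ?_)
  rw [norm_mul, norm_of_nonneg (nearIndicator_nonneg _ _), norm_pow, norm_norm]
  exact mul_le_of_le_one_left (by positivity) (nearIndicator_le_one _ _)

theorem gradSqAt_nonneg (f : (Fin N → R3) → ℂ) (i : Fin N) (X : Fin N → R3) :
    0 ≤ gradSqAt f i X := by
  unfold gradSqAt gradSq
  positivity

/-- The particles with a given spin. -/
def spinClass (σ : Fin N → Fin q) (s : Fin q) : Finset (Fin N) := Finset.univ.filter (σ · = s)

theorem sum_spinClass {E : Type*} [AddCommMonoid E] (σ : Fin N → Fin q) (A : Finset (Fin N))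
    (g : Fin N → E) : ∑ s, ∑ i ∈ spinClass σ s ∩ A, g i = ∑ i ∈ A, g i := by
  rw [← Finset.sum_fiberwise A σ g]
  refine Finset.sum_congr rfl fun s _ => Finset.sum_congr ?_ fun _ _ => rfl
  ext i
  simp [spinClass, and_comm]

/-- Few particles are close to other ones. -/
theorem sum_goodWeight_ge [IsFiniteMeasure ((volume : Measure R3).restrict B)]
    (hV : ((volume : Measure R3).restrict B).real Set.univ ≠ 0)
    (h : IsTest L f) (hB : openCube L ⊆ B) (σ : Fin N → Fin q)
    (hanti : ∀ i k, i ≠ k → σ i = σ k → ∀ X, f (X ∘ Equiv.swap i k) = -f X)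
    {Q R : ℝ} (hQ : 0 < Q) (hR : 0 ≤ R) :
    (∑ s, ((spinClass σ s)ᶜ.card : ℝ)) * (∫ X, ‖f X‖ ^ 2) -
      4 * q * (q * (2 * (4 / 3 * π * Q ^ 3) * (N * (4 / 3 * π * (2 * R) ^ 3)) * (∫ X, ‖f X‖ ^ 2)) +
        1 / (2 * π ^ 2 * Q ^ 2) * ∑ i, ∫ X, gradSqAt f i X) ≤
      ∑ s, ∑ j ∈ (spinClass σ s)ᶜ, goodWeight R (spinClass σ s) f j := by
  classical
  set F := ∫ X, ‖f X‖ ^ 2 with hF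
  set c := 1 / (2 * π ^ 2 * Q ^ 2) with hc
  set K := 2 * (4 / 3 * π * Q ^ 3) * (N * (4 / 3 * π * (2 * R) ^ 3)) * F with hK
  have hR2 : 0 ≤ 2 * R := by positivity
  have hA : ∀ A : Finset (Fin N), ∑ i ∈ A, ∫ X, nearIndicator (2 * R) A X (X i) * ‖f X‖ ^ 2 ≤
      q * K + c * ∑ i, ∫ X, gradSqAt f i X := by
    intro A
    rw [← sum_spinClass σ A]
    have h1 : ∀ s ∈ Finset.univ, ∑ i ∈ spinClass σ s ∩ A,
        ∫ X, nearIndicator (2 * R) A X (X i) * ‖f X‖ ^ 2 ≤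
        K + c * ∑ i ∈ spinClass σ s ∩ A, ∫ X, gradSqAt f i X := by
      intro s _
      refine sum_near_le hV h hB Finset.inter_subset_right ?_ hQ hR2
      intro i hi k hk hik
      simp only [Finset.mem_inter, spinClass, Finset.mem_filter] at hi hk
      exact hanti i k hik (hi.1.2.trans hk.1.2.symm)
    refine (Finset.sum_le_sum h1).trans ?_
    rw [Finset.sum_add_distrib, Finset.sum_const, Finset.card_univ, Fintype.card_fin,
      nsmul_eq_mul, ← Finset.mul_sum, sum_spinClass]
    have : ∑ i ∈ A, ∫ X, gradSqAt f i X ≤ ∑ i, ∫ X, gradSqAt f i X :=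
      Finset.sum_le_sum_of_subset_of_nonneg (Finset.subset_univ _) fun i _ _ =>
        integral_nonneg fun X => gradSqAt_nonneg f i X
    have hc0 : 0 ≤ c := by positivity
    linarith [mul_le_mul_of_nonneg_left this hc0]
  have hgi : ∀ s j, Integrable fun X => if j ∈ goodSet R (spinClass σ s) X then ‖f X‖ ^ 2 else 0 := by
    intro s j
    refine h.integrable_norm_sq.mono' (Measurable.ite (measurableSet_mem_goodSet R _ j)
      (h.bddMeas.meas.norm.pow_const 2) measurable_const).aestronglyMeasurable
      (.of_forall fun X => ?_)
    split_ifs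
    · simp
    · simp
  have hpt : ∀ X, (∑ s, ((spinClass σ s)ᶜ.card : ℝ)) * ‖f X‖ ^ 2 -
      4 * q / 2 ^ N * ∑ A : Finset (Fin N), ∑ i ∈ A, nearIndicator (2 * R) A X (X i) * ‖f X‖ ^ 2 ≤
      ∑ s, ∑ j ∈ (spinClass σ s)ᶜ, if j ∈ goodSet R (spinClass σ s) X then ‖f X‖ ^ 2 else 0 := by
    intro X
    set S := Finset.univ.filter fun j => ∃ k, k ≠ j ∧ ‖X j - X k‖ < 2 * R with hS
    have h2 := card_close_le (2 * R) X S fun j hj => by simpa [hS] using hj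
    have h3 : ∀ s, ((spinClass σ s)ᶜ.card : ℝ) - S.card ≤ (goodSet R (spinClass σ s) X).card := by
      intro s
      have : (spinClass σ s)ᶜ ⊆ goodSet R (spinClass σ s) X ∪ S := by
        intro j hj
        by_cases hg : j ∈ goodSet R (spinClass σ s) X
        · exact Finset.mem_union_left _ hg
        · refine Finset.mem_union_right _ ?_
          simp only [goodSet, Finset.mem_filter, not_and, not_forall, not_le] at hg
          obtain ⟨l, _, hjl, hl⟩ := hg hj
          simp only [hS, Finset.mem_filter, Finset.mem_univ, true_and]
          exact ⟨l, Ne.symm hjl, hl⟩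
      have h4 := (Finset.card_le_card this).trans (Finset.card_union_le _ _)
      have h5 : ((spinClass σ s)ᶜ.card : ℝ) ≤ (goodSet R (spinClass σ s) X).card + S.card := by
        exact_mod_cast h4
      linarith
    have h6 : ∀ s, ∑ j ∈ (spinClass σ s)ᶜ,
        (if j ∈ goodSet R (spinClass σ s) X then ‖f X‖ ^ 2 else 0) =
        (goodSet R (spinClass σ s) X).card * ‖f X‖ ^ 2 := by
      intro s
      rw [← Finset.sum_filter, Finset.sum_const, nsmul_eq_mul]
      congr 3
      ext j
      simp only [Finset.mem_filter, goodSet]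
      tauto
    simp only [h6, ← Finset.sum_mul]
    have h7 := Finset.sum_le_sum fun s (_ : s ∈ (Finset.univ : Finset (Fin q))) => h3 s
    rw [Finset.sum_sub_distrib, Finset.sum_const, Finset.card_univ, Fintype.card_fin,
      nsmul_eq_mul] at h7
    rw [← mul_assoc, ← sub_mul]
    refine mul_le_mul_of_nonneg_right ?_ (by positivity)
    have h8 : (S.card : ℝ) ≤ 4 / 2 ^ N *
        ∑ A : Finset (Fin N), ∑ i ∈ A, nearIndicator (2 * R) A X (X i) := by
      rw [div_mul_eq_mul_div, le_div_iff₀ (by positivity)]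
      linarith
    have h9 := mul_le_mul_of_nonneg_left h8 (Nat.cast_nonneg (α := ℝ) q)
    have h10 : 4 * q / 2 ^ N * ∑ A : Finset (Fin N), ∑ i ∈ A, nearIndicator (2 * R) A X (X i) =
      q * (4 / 2 ^ N * ∑ A : Finset (Fin N), ∑ i ∈ A, nearIndicator (2 * R) A X (X i)) := by ring
    rw [h10]
    linarith
  have i1 : Integrable fun X => ∑ A : Finset (Fin N), ∑ i ∈ A,
      nearIndicator (2 * R) A X (X i) * ‖f X‖ ^ 2 :=
    integrable_finsetSum _ fun A _ => integrable_finsetSum _ fun i _ =>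
      integrable_nearIndicator_mul h A i
  have i2 : Integrable fun X => ∑ s, ∑ j ∈ (spinClass σ s)ᶜ,
      if j ∈ goodSet R (spinClass σ s) X then ‖f X‖ ^ 2 else 0 :=
    integrable_finsetSum _ fun s _ => integrable_finsetSum _ fun j _ => hgi s j
  have hI := integral_mono ((h.integrable_norm_sq.const_mul _).sub (i1.const_mul _)) i2 hpt
  rw [integral_sub' (h.integrable_norm_sq.const_mul _) (i1.const_mul _), integral_const_mul,
    integral_const_mul, integral_finsetSum _ fun A _ => integrable_finsetSum _ fun i _ =>
      integrable_nearIndicator_mul h A i,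
    integral_finsetSum _ fun s _ => integrable_finsetSum _ fun j _ => hgi s j] at hI
  have e1 : ∀ A : Finset (Fin N), ∫ X, ∑ i ∈ A, nearIndicator (2 * R) A X (X i) * ‖f X‖ ^ 2 =
      ∑ i ∈ A, ∫ X, nearIndicator (2 * R) A X (X i) * ‖f X‖ ^ 2 := fun A =>
    integral_finsetSum _ fun i _ => integrable_nearIndicator_mul h A i
  have e2 : ∀ s, ∫ X, ∑ j ∈ (spinClass σ s)ᶜ,
      (if j ∈ goodSet R (spinClass σ s) X then ‖f X‖ ^ 2 else 0) =
      ∑ j ∈ (spinClass σ s)ᶜ, goodWeight R (spinClass σ s) f j := fun s =>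
    integral_finsetSum _ fun j _ => hgi s j
  simp only [e1, e2] at hI
  refine le_trans (sub_le_sub_left ?_ _) hI
  have hs := Finset.sum_le_sum fun A (_ : A ∈ (Finset.univ : Finset (Finset (Fin N)))) => hA A
  rw [Finset.sum_const, Finset.card_univ, Fintype.card_finset, Fintype.card_fin,
    nsmul_eq_mul] at hs
  push_cast at hs
  have h2N : (0:ℝ) < 2 ^ N := by positivity
  refine (mul_le_mul_of_nonneg_left hs (by positivity)).trans (le_of_eq ?_)
  field_simp
end

section
variable {N q : ℕ} {L : ℝ} {f : (Fin N → R3) → ℂ} {B : Set R3} {v κ : R3 → ℝ}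

theorem goodWeight_nonneg (R : ℝ) (C : Finset (Fin N)) (f : (Fin N → R3) → ℂ) (j : Fin N) :
    0 ≤ goodWeight R C f j := by
  classical
  exact integral_nonneg fun X => by split_ifs <;> positivity

theorem IsTest.goodWeight_le (h : IsTest L f) (R : ℝ) (C : Finset (Fin N)) (j : Fin N) :
    goodWeight R C f j ≤ ∫ X, ‖f X‖ ^ 2 := by
  classical
  refine integral_mono_of_nonneg (.of_forall fun X => ?_) h.integrable_norm_sq
    (.of_forall fun X => ?_)
  · simp only; split_ifs <;> simp
  · simp only; split_ifs <;> simp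

theorem card_spinClass_le (σ : Fin N → Fin q) (s : Fin q) : ((spinClass σ s).card : ℝ) ≤ N := by
  have := Finset.card_le_univ (spinClass σ s)
  rw [Fintype.card_fin] at this
  exact_mod_cast this

theorem card_compl_spinClass (σ : Fin N → Fin q) (s : Fin q) :
    ((spinClass σ s)ᶜ.card : ℝ) = N - (spinClass σ s).card := by
  rw [Finset.card_compl, Nat.cast_sub (Finset.card_le_univ _), Fintype.card_fin]

open FourierTransform in
/-- Lower bound for the energy of one spin configuration. -/
theorem sum_classEnergy_ge [IsFiniteMeasure ((volume : Measure R3).restrict B)]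
    (hV : ((volume : Measure R3).restrict B).real Set.univ ≠ 0)
    (h : IsTest L f) (hB : openCube L ⊆ B) (hBm : MeasurableSet B) {T : ℝ}
    (hBT : ∀ y ∈ openCube L, ∀ x, ‖x - y‖ < T → x ∈ B) (σ : Fin N → Fin q)
    (hanti : ∀ i k, i ≠ k → σ i = σ k → ∀ X, f (X ∘ Equiv.swap i k) = -f X)
    (hv : Measurable v) (hv0 : ∀ x, 0 ≤ v x) (hvC : ∃ c, ∀ x, v x ≤ c)
    (hκi : Integrable κ) (hκ0 : ∀ x, 0 ≤ κ x) (hκ1 : ∫ x, κ x = 1)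
    {R x θ d c Q : ℝ} (hR : 0 < R) (hK : 4 * π * R * x ≤ 1) (hx : 0 ≤ x) (hθ : 0 ≤ θ)
    (hd : 0 ≤ d) (hc : 0 ≤ c) (hcd : c * (4 / R ^ 3) ≤ 4 * π ^ 2 * d) (hQ : 0 < Q)
    {k k₁ : Fin q → ℝ} (hk : ∀ s, 0 ≤ k s) (hkx : ∀ s, k s ≤ x) (hk₁0 : ∀ s, 0 ≤ k₁ s)
    (hk₁ : ∀ s, k₁ s ^ 2 = k s ^ 2 + d)
    (hOB : ∀ s, OneBodyBound v κ R (k s) (k₁ s) (4 * π ^ 2 * d) c)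
    (hcard : ∀ s, ((spinClass σ s).card : ℝ) =
      ((volume : Measure R3).restrict B).real Set.univ * (4 / 3 * π * k s ^ 3))
    (hN : N ≤ ((volume : Measure R3).restrict B).real Set.univ * x ^ 3)
    (hT : ∀ s, 4 / 3 * π * k s ^ 3 - 2 * θ * x ^ 3 ≤
      ∫ z in {z | ‖z‖ < T}, ‖𝓕⁻ (lowProfile κ (k s)) z‖ ^ 2) :
    (∫ X, ‖f X‖ ^ 2) * (((volume : Measure R3).restrict B).real Set.univ *
        ∑ s, (16 * π ^ 3 / 5 * k s ^ 5 - 16 * π ^ 3 * d ^ 2 * k₁ s) +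
      c * (∑ s, 4 / 3 * π * k s ^ 3 * (N - (spinClass σ s).card) - 2 * q * θ * x ^ 3 * N)) -
      c * x ^ 3 * (4 * q * (q * (2 * (4 / 3 * π * Q ^ 3) * (N * (4 / 3 * π * (2 * R) ^ 3)) *
        (∫ X, ‖f X‖ ^ 2)) + 1 / (2 * π ^ 2 * Q ^ 2) * ∑ i, ∫ X, gradSqAt f i X)) ≤
    ∑ s, classEnergy v (spinClass σ s) f := by
  have hp := pi_pos
  set ν := (volume : Measure R3).restrict B with hν
  set V := ν.real Set.univ with hVdef
  have V0 : 0 < V := lt_of_le_of_ne measureReal_nonneg hV.symm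
  set F := ∫ X, ‖f X‖ ^ 2 with hF
  have F0 : 0 ≤ F := integral_nonneg fun X => by positivity
  set Bd := 4 * q * (q * (2 * (4 / 3 * π * Q ^ 3) * (N * (4 / 3 * π * (2 * R) ^ 3)) * F) +
    1 / (2 * π ^ 2 * Q ^ 2) * ∑ i, ∫ X, gradSqAt f i X) with hBd
  set G : Fin q → ℝ := fun s => ∑ j ∈ (spinClass σ s)ᶜ, goodWeight R (spinClass σ s) f j with hG
  have hG0 : ∀ s, 0 ≤ G s := fun s => Finset.sum_nonneg fun j _ => goodWeight_nonneg _ _ _ _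
  have hG1 : ∀ s, G s ≤ (N - (spinClass σ s).card) * F := by
    intro s
    refine (Finset.sum_le_sum fun j _ => h.goodWeight_le R _ j).trans ?_
    rw [Finset.sum_const, nsmul_eq_mul, card_compl_spinClass]
  have hGsum : ∑ s, ((N - (spinClass σ s).card) * F - G s) ≤ Bd := by
    have := sum_goodWeight_ge hV h hB σ hanti hQ hR.le
    simp only [card_compl_spinClass] at this
    rw [Finset.sum_sub_distrib, ← Finset.sum_mul]
    linarith
  have ht : ∀ s, 4 / 3 * π * k s ^ 3 ≤ x ^ 3 := by
    intro s
    have h1 := (card_spinClass_le σ s).trans hN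
    rw [hcard s] at h1
    exact le_of_mul_le_mul_left h1 V0
  have hx3 : 0 ≤ x ^ 3 := by positivity
  have key : ∀ s ∈ Finset.univ, V * F * (16 * π ^ 3 / 5 * k s ^ 5 - 16 * π ^ 3 * d ^ 2 * k₁ s) +
      c * (4 / 3 * π * k s ^ 3 * (N - (spinClass σ s).card) * F -
        x ^ 3 * ((N - (spinClass σ s).card) * F - G s) - 2 * θ * x ^ 3 * (N * F)) ≤
      classEnergy v (spinClass σ s) f := by
    intro s _
    have hKs : 4 * π * R * k s ≤ 1 :=
      (mul_le_mul_of_nonneg_left (hkx s) (by positivity)).trans hK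
    have h1 := classEnergy_ge_overlap hV h hB (C := spinClass σ s) (by
      intro i hi l hl hil
      simp only [spinClass, Finset.mem_filter] at hi hl
      exact hanti i l hil (hi.2.trans hl.2.symm)) hv hv0 hvC hκi hκ0 hκ1 hR hKs (hk s) hd (hk₁0 s)
      (hk₁ s) (hOB s) hc hcd (hcard s)
    refine le_trans (add_le_add le_rfl (mul_le_mul_of_nonneg_left ?_ hc)) h1
    have h2 : (∫ z in {z | ‖z‖ < T}, ‖𝓕⁻ (lowProfile κ (k s)) z‖ ^ 2) * G s ≤
        ∑ j ∈ (spinClass σ s)ᶜ, scattererOverlap κ R (k s) B (spinClass σ s) f j := by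
      rw [hG, Finset.mul_sum]
      exact Finset.sum_le_sum fun j _ => le_scattererOverlap h hB hBm hBT hκi hκ0 hκ1 j
    have h3 := (mul_le_mul_of_nonneg_right (hT s) (hG0 s)).trans h2
    refine le_trans ?_ h3
    have h4 : G s ≤ N * F := (hG1 s).trans
      (mul_le_mul_of_nonneg_right (sub_le_self _ (Nat.cast_nonneg _)) F0)
    have h5 := mul_le_mul_of_nonneg_left h4 (mul_nonneg (mul_nonneg zero_le_two hθ) hx3)
    have h6 := mul_le_mul_of_nonneg_right (ht s) (sub_nonneg.2 (hG1 s))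
    linarith
  refine le_trans ?_ (Finset.sum_le_sum key)
  have e : ∑ s, (V * F * (16 * π ^ 3 / 5 * k s ^ 5 - 16 * π ^ 3 * d ^ 2 * k₁ s) +
      c * (4 / 3 * π * k s ^ 3 * (N - (spinClass σ s).card) * F -
        x ^ 3 * ((N - (spinClass σ s).card) * F - G s) - 2 * θ * x ^ 3 * (N * F))) =
      V * F * (∑ s, (16 * π ^ 3 / 5 * k s ^ 5 - 16 * π ^ 3 * d ^ 2 * k₁ s)) +
      c * ((∑ s, 4 / 3 * π * k s ^ 3 * (N - (spinClass σ s).card)) * F -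
        x ^ 3 * (∑ s, ((N - (spinClass σ s).card) * F - G s)) - q * (2 * θ * x ^ 3 * (N * F))) := by
    have e1 : (q : ℝ) * (2 * θ * x ^ 3 * (N * F)) = ∑ _s : Fin q, 2 * θ * x ^ 3 * (N * F) := by
      rw [Finset.sum_const, Finset.card_univ, Fintype.card_fin, nsmul_eq_mul]
    rw [e1, Finset.sum_mul, Finset.mul_sum (a := x ^ 3), ← Finset.sum_sub_distrib,
      ← Finset.sum_sub_distrib, Finset.mul_sum, Finset.mul_sum, ← Finset.sum_add_distrib]
  rw [e]
  have h7 := mul_le_mul_of_nonneg_left hGsum (mul_nonneg hc hx3)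
  linarith
end

section
variable {N q : ℕ} {L : ℝ} {f : (Fin N → R3) → ℂ} {v κ : R3 → ℝ}

/-- The energy of one spin configuration. -/
def configEnergy (v : R3 → ℝ) (f : (Fin N → R3) → ℂ) : ℝ :=
  ∫ X : Fin N → R3, ((∑ i, gradSq (fun y => f (Function.update X i y)) (X i)) +
      ∑ i, ∑ j, if i < j then v (X i - X j) * ‖f X‖ ^ 2 else 0)

theorem IsTest.integrable_gradSqAt (h : IsTest L f) (i : Fin N) : Integrable (gradSqAt f i) := by
  refine (h.continuous_gradSqAt i).integrable_of_hasCompactSupport ?_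
  have hb : Bornology.IsBounded {X : Fin N → R3 | ∀ i, X i ∈ openCube L} := by
    have := Bornology.IsBounded.pi (fun _ : Fin N => isBounded_openCube L)
    refine this.subset fun X hX i _ => hX i
  have hK : IsCompact (closure {X : Fin N → R3 | ∀ i, X i ∈ openCube L}) := hb.isCompact_closure
  refine HasCompactSupport.intro hK fun X hX => ?_
  have : ∃ k, X k ∉ openCube L := by
    by_contra hk
    push Not at hk
    exact hX (subset_closure hk)
  obtain ⟨k, hk⟩ := this
  exact h.gradSqAt_eq_zero i hk

theorem IsTest.integrable_pair (h : IsTest L f) (hv : Measurable v) (hv0 : ∀ x, 0 ≤ v x)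
    (hvC : ∃ c, ∀ x, v x ≤ c) (i j : Fin N) :
    Integrable fun X : Fin N → R3 => v (X i - X j) * ‖f X‖ ^ 2 := by
  obtain ⟨c, hc⟩ := hvC
  have hg : Measurable fun X : Fin N → R3 => X i - X j := by fun_prop
  have hm : Measurable fun X : Fin N → R3 => v (X i - X j) := by
    have := hv.comp hg
    exact this
  have hf : Measurable fun X => ‖f X‖ ^ 2 := h.bddMeas.meas.norm.pow_const 2
  have hmf : Measurable fun X => v (X i - X j) * ‖f X‖ ^ 2 := hm.mul hf
  refine (h.integrable_norm_sq.const_mul c).mono' hmf.aestronglyMeasurable (.of_forall fun X => ?_)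
  rw [norm_mul, norm_of_nonneg (hv0 _), norm_pow, norm_norm]
  exact mul_le_mul_of_nonneg_right (hc _) (by positivity)

theorem IsTest.configEnergy_eq (h : IsTest L f) (hv : Measurable v) (hv0 : ∀ x, 0 ≤ v x)
    (hvC : ∃ c, ∀ x, v x ≤ c) :
    configEnergy v f = (∑ i, ∫ X, gradSqAt f i X) +
      ∑ i, ∑ j, if i < j then ∫ X, v (X i - X j) * ‖f X‖ ^ 2 else 0 := by
  have i1 : Integrable fun X => ∑ i, gradSqAt f i X :=
    integrable_finsetSum _ fun i _ => h.integrable_gradSqAt i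
  have i3 : ∀ i j : Fin N, Integrable fun X : Fin N → R3 =>
      if i < j then v (X i - X j) * ‖f X‖ ^ 2 else 0 := by
    intro i j
    split_ifs
    · exact h.integrable_pair hv hv0 hvC i j
    · exact integrable_zero _ _ _
  have i4 : ∀ i : Fin N, Integrable fun X : Fin N → R3 => ∑ j, 
      if i < j then v (X i - X j) * ‖f X‖ ^ 2 else 0 := fun i =>
    integrable_finsetSum _ fun j _ => i3 i j
  have i2 : Integrable fun X : Fin N → R3 => ∑ i, ∑ j,
      if i < j then v (X i - X j) * ‖f X‖ ^ 2 else 0 :=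
    integrable_finsetSum _ fun i _ => i4 i
  have e : configEnergy v f = ∫ X, ((∑ i, gradSqAt f i X) + ∑ i, ∑ j,
      if i < j then v (X i - X j) * ‖f X‖ ^ 2 else 0) := rfl
  rw [e, integral_add i1 i2, integral_finsetSum _ fun i _ => h.integrable_gradSqAt i,
    integral_finsetSum _ fun i _ => i4 i]
  congr 1
  refine Finset.sum_congr rfl fun i _ => ?_
  rw [integral_finsetSum _ fun j _ => i3 i j]
  refine Finset.sum_congr rfl fun j _ => ?_
  split_ifs
  · rfl
  · exact integral_zero _ _

theorem IsTest.kinetic_le_configEnergy (h : IsTest L f) (hv : Measurable v) (hv0 : ∀ x, 0 ≤ v x)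
    (hvC : ∃ c, ∀ x, v x ≤ c) : ∑ i, ∫ X, gradSqAt f i X ≤ configEnergy v f := by
  rw [h.configEnergy_eq hv hv0 hvC]
  refine le_add_of_nonneg_right (Finset.sum_nonneg fun i _ => Finset.sum_nonneg fun j _ => ?_)
  split_ifs
  · exact integral_nonneg fun X => mul_nonneg (hv0 _) (by positivity)
  · exact le_rfl

theorem IsTest.sum_classEnergy_le (h : IsTest L f) (hv : Measurable v) (hv0 : ∀ x, 0 ≤ v x)
    (hvC : ∃ c, ∀ x, v x ≤ c) (hvs : ∀ x, v (-x) = v x) (σ : Fin N → Fin q) :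
    ∑ s, classEnergy v (spinClass σ s) f ≤ configEnergy v f := by
  rw [h.configEnergy_eq hv hv0 hvC]
  set P : Fin N → Fin N → ℝ := fun i j => ∫ X : Fin N → R3, v (X i - X j) * ‖f X‖ ^ 2 with hP
  have hP0 : ∀ i j, 0 ≤ P i j := fun i j =>
    integral_nonneg fun X => mul_nonneg (hv0 _) (by positivity)
  have hPs : ∀ i j, P i j = P j i := by
    intro i j
    simp only [hP]
    congr with X
    rw [← hvs, neg_sub]
  have e1 : ∑ s, classEnergy v (spinClass σ s) f =
      ∑ i, ((∫ X, gradSqAt f i X) + (1 / 2) * ∑ j ∈ (spinClass σ (σ i))ᶜ, P i j) := by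
    rw [← Finset.sum_fiberwise Finset.univ σ]
    refine Finset.sum_congr rfl fun s _ => ?_
    rw [classEnergy, spinClass]
    refine Finset.sum_congr rfl fun i hi => ?_
    rw [(Finset.mem_filter.1 hi).2, spinClass]
  rw [e1, Finset.sum_add_distrib]
  refine add_le_add le_rfl ?_
  have e2 : ∀ i, ∑ j ∈ (spinClass σ (σ i))ᶜ, P i j ≤
      (∑ j, if i < j then P i j else 0) + ∑ j, if j < i then P j i else 0 := by
    intro i
    rw [← Finset.sum_add_distrib]
    refine (Finset.sum_le_sum fun j hj => ?_).trans
      (Finset.sum_le_sum_of_subset_of_nonneg (Finset.subset_univ _) fun j _ _ => ?_)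
    · have hij : i ≠ j := by
        rintro rfl
        simp [spinClass] at hj
      rcases lt_or_gt_of_ne hij with h1 | h1
      · rw [if_pos h1, if_neg h1.not_gt, add_zero]
      · rw [if_neg h1.not_gt, if_pos h1, zero_add, hPs]
    · have := hP0 i j
      have := hP0 j i
      split_ifs <;> positivity
  have e3 := Finset.sum_le_sum fun i (_ : i ∈ (Finset.univ : Finset (Fin N))) => e2 i
  rw [Finset.sum_add_distrib, Finset.sum_comm (f := fun i j => if j < i then P j i else 0)] at e3
  rw [← Finset.mul_sum]
  linarith
end

section
variable {v φ κ : R3 → ℝ} {R0 a : ℝ}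

/-- The one-body bound for the parameters of a gas of density at most `x ^ 3`. -/
theorem IsScatteringSolution.oneBodyBound (h : IsScatteringSolution v φ R0 a)
    (hκ : ∀ᵐ x, v x * φ x = 8 * π * a * κ x) (hκi : Integrable κ)
    (hκs : ∀ x, R0 < ‖x‖ → κ x = 0) (hκ0 : ∀ x, 0 ≤ κ x) (hκ1 : ∫ x, κ x = 1)
    {θ x k : ℝ} (hθ : 0 < θ) (hθ1 : θ ≤ 1 / 20) (hx : 0 < x) (hax : a * x ≤ θ ^ 18)
    (hRx : R0 * x ≤ θ ^ 2) (hk : 0 ≤ k) (hkx : k ≤ x) :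
    OneBodyBound v κ (θ ^ 2 / x) k (√(k ^ 2 + 4 * a * x ^ 3 / (π * θ ^ 8)))
      (4 * π ^ 2 * (4 * a * x ^ 3 / (π * θ ^ 8)))
      ((1 - θ ^ 2) ^ 2 * (4 * π * a / (1 + 2 * a / (θ ^ 2 / x)))) ∧
    4 * a * x ^ 3 / (π * θ ^ 8) ≤ x ^ 2 := by
  have hp := pi_pos
  have hp3 := pi_gt_three
  have hp4 := pi_lt_d2
  have a0 := h.length_nonneg
  set d := 4 * a * x ^ 3 / (π * θ ^ 8) with hd
  have hd0 : 0 ≤ d := by positivity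
  have hdx : d ≤ x ^ 2 := by
    rw [hd, div_le_iff₀ (by positivity)]
    have h1 : θ ^ 18 ≤ θ ^ 8 * (1 / 4) := by
      have : θ ^ 10 ≤ (1 / 20) ^ 10 := pow_le_pow_left₀ hθ.le hθ1 10
      have h8 : 0 < θ ^ 8 := by positivity
      calc θ ^ 18 = θ ^ 8 * θ ^ 10 := by ring
        _ ≤ θ ^ 8 * (1 / 4) := mul_le_mul_of_nonneg_left (this.trans (by norm_num)) h8.le
    have h2 : 4 * (a * x) ≤ θ ^ 8 := by linarith
    have h3 := mul_le_mul_of_nonneg_left h2 (sq_nonneg x)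
    have h4 : 0 < x ^ 2 * θ ^ 8 := by positivity
    nlinarith
  have hk1 : √(k ^ 2 + d) ≤ 2 * x := by
    rw [sqrt_le_left (by positivity)]
    nlinarith
  have hsq : √(k ^ 2 + d) ^ 2 = k ^ 2 + d := sq_sqrt (by positivity)
  have hR' : 0 < θ ^ 2 / x := by positivity
  have hDd : 16 * π * a / ((θ ^ 2 / x) ^ 3 * θ ^ 2) = 4 * π ^ 2 * d := by
    rw [hd]
    field_simp
    norm_num
    ring
  have hθ2 : θ ^ 2 ≤ 1 / 400 := by nlinarith
  have hpi2 : π ^ 2 ≤ 10 := by nlinarith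
  refine ⟨?_, hdx⟩
  intro N s y hy u hu huc
  have := h.one_body (R := θ ^ 2 / x) (K := x / (4 * π * θ ^ 2)) (δ := θ ^ 2) (k := k)
    (k₁ := √(k ^ 2 + d)) ?_ ?_ hκ hκi hκs hκ0 hκ1 (by positivity) (by linarith) hk ?_ ?_ ?_ ?_ s y hy
    hu huc
  · rw [hDd] at this
    exact this
  · rwa [le_div_iff₀ hx]
  · apply le_of_eq; field_simp
  · exact le_sqrt_of_sq_le (by linarith)
  · refine hk1.trans ?_
    rw [le_div_iff₀ (by positivity)]
    have : 2 * (4 * π * θ ^ 2) ≤ 1 := by nlinarith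
    nlinarith
  · rw [hDd, hsq]
    linarith
  · rw [hDd]
    have e : θ ^ 2 * (4 * π ^ 2 * (x / (4 * π * θ ^ 2)) ^ 2) = x ^ 2 / (4 * θ ^ 2) := by
      field_simp
    rw [e, le_div_iff₀ (by positivity)]
    have h1 : k ^ 2 ≤ x ^ 2 := pow_le_pow_left₀ hk hkx 2
    have h2 : 4 * π ^ 2 * k ^ 2 + 4 * π ^ 2 * d ≤ 80 * x ^ 2 := by
      have h3 : k ^ 2 + d ≤ 2 * x ^ 2 := by linarith
      have h4 : 4 * π ^ 2 * (k ^ 2 + d) ≤ 40 * (2 * x ^ 2) :=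
        mul_le_mul (by linarith) h3 (by positivity) (by norm_num)
      linarith
    have h5 : 4 * θ ^ 2 ≤ 1 / 100 := by linarith
    calc (4 * π ^ 2 * k ^ 2 + 4 * π ^ 2 * d) * (4 * θ ^ 2) ≤ 80 * x ^ 2 * (1 / 100) :=
          mul_le_mul h2 h5 (by positivity) (by positivity)
      _ ≤ x ^ 2 := by nlinarith [sq_nonneg x]
end

theorem tangent_fermi_energy {A B k l x : ℝ} (hk : 0 ≤ k) (hl : 0 ≤ l) (hkx : k ≤ x) (hlx : l ≤ x)
    (hB : 0 ≤ B) (hAB : 6 * B * x ≤ A) :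
    A * l ^ 5 - B * l ^ 6 + (5 / 3 * A * l ^ 2 - 2 * B * l ^ 3) * (k ^ 3 - l ^ 3) ≤
      A * k ^ 5 - B * k ^ 6 := by
  have hx : 0 ≤ x := hk.trans hkx
  set p := 3 * k ^ 3 + 6 * k ^ 2 * l + 4 * k * l ^ 2 + 2 * l ^ 3 with hp
  have p0 : 0 ≤ p := by positivity
  have h1 : (k ^ 2 + k * l + l ^ 2) ^ 2 ≤ 2 * x * p := by
    have h2 : k ^ 2 + k * l + l ^ 2 ≤ 2 * x * (k + l) := by nlinarith [mul_nonneg hk hl]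
    have h3 : (k + l) * (k ^ 2 + k * l + l ^ 2) ≤ p := by
      rw [hp]
      have := mul_nonneg (pow_nonneg hk 2) hl
      have := mul_nonneg hk (pow_nonneg hl 2)
      nlinarith [pow_nonneg hk 3, pow_nonneg hl 3]
    calc (k ^ 2 + k * l + l ^ 2) ^ 2 = (k ^ 2 + k * l + l ^ 2) * (k ^ 2 + k * l + l ^ 2) := sq _
      _ ≤ 2 * x * (k + l) * (k ^ 2 + k * l + l ^ 2) :=
          mul_le_mul_of_nonneg_right h2 (by positivity)
      _ = 2 * x * ((k + l) * (k ^ 2 + k * l + l ^ 2)) := by ring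
      _ ≤ 2 * x * p := mul_le_mul_of_nonneg_left h3 (by positivity)
  have h4 : B * (k ^ 2 + k * l + l ^ 2) ^ 2 ≤ A / 3 * p := by
    have := mul_le_mul_of_nonneg_left h1 hB
    have := mul_le_mul_of_nonneg_right hAB p0
    linarith
  have h5 := mul_le_mul_of_nonneg_left h4 (sq_nonneg (k - l))
  have e : A * k ^ 5 - B * k ^ 6 - (A * l ^ 5 - B * l ^ 6 +
      (5 / 3 * A * l ^ 2 - 2 * B * l ^ 3) * (k ^ 3 - l ^ 3)) =
      (k - l) ^ 2 * (A / 3 * p) - (k - l) ^ 2 * (B * (k ^ 2 + k * l + l ^ 2) ^ 2) := by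
    rw [hp]; ring
  linarith

/-- Equal populations of the spin states minimize the energy. -/
theorem sum_fermi_energy_ge {q : ℕ} (hq : 1 ≤ q) {k : Fin q → ℝ} {a x ρ l : ℝ} (ha : 0 ≤ a)
    (hk : ∀ s, 0 ≤ k s) (hkx : ∀ s, k s ≤ x) (hl : 0 ≤ l) (hlx : l ≤ x) (hax : 20 * (a * x) ≤ 1)
    (hρ : ∑ s, 4 / 3 * π * k s ^ 3 = ρ) (hlρ : q * (4 / 3 * π * l ^ 3) = ρ) :
    q * (16 * π ^ 3 / 5) * l ^ 5 + 4 * π * a * (1 - 1 / q) * ρ ^ 2 ≤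
      ∑ s, (16 * π ^ 3 / 5 * k s ^ 5 + 4 * π * a * (4 / 3 * π * k s ^ 3 * (ρ - 4 / 3 * π * k s ^ 3))) := by
  have hp := pi_pos
  have hq0 : (0:ℝ) < q := by exact_mod_cast hq
  set A := 16 * π ^ 3 / 5 with hA
  set B := 4 * π * a * (4 / 3 * π) ^ 2 with hB
  have hAB : 6 * B * x ≤ A := by
    have : 6 * B * x = π ^ 3 * (128 / 3 * (a * x)) := by rw [hB]; ring
    rw [this, hA]
    have := mul_le_mul_of_nonneg_left (show 128 / 3 * (a * x) ≤ 16 / 5 by linarith)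
      (pow_nonneg hp.le 3)
    linarith
  have h1 := Finset.sum_le_sum fun s (_ : s ∈ (Finset.univ : Finset (Fin q))) =>
    tangent_fermi_energy (A := A) (B := B) (hk s) hl (hkx s) hlx (by positivity) hAB
  have hs : ∑ s, (k s ^ 3 - l ^ 3) = 0 := by
    rw [← Finset.mul_sum] at hρ
    rw [Finset.sum_sub_distrib, Finset.sum_const, Finset.card_univ, Fintype.card_fin, nsmul_eq_mul]
    have : 4 / 3 * π * (∑ s, k s ^ 3 - q * l ^ 3) = 0 := by linarith
    rcases mul_eq_zero.1 this with h | h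
    · nlinarith
    · exact h
  rw [Finset.sum_add_distrib, ← Finset.mul_sum, hs, mul_zero, add_zero, Finset.sum_const,
    Finset.card_univ, Fintype.card_fin, nsmul_eq_mul] at h1
  have e : ∑ s, (A * k s ^ 5 + 4 * π * a * (4 / 3 * π * k s ^ 3 * (ρ - 4 / 3 * π * k s ^ 3))) =
      ∑ s, (A * k s ^ 5 - B * k s ^ 6) + 4 * π * a * ρ * ∑ s, 4 / 3 * π * k s ^ 3 := by
    rw [Finset.mul_sum, ← Finset.sum_add_distrib]
    refine Finset.sum_congr rfl fun s _ => ?_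
    rw [hB]; ring
  rw [e, hρ]
  refine le_trans (le_of_eq ?_) (add_le_add h1 le_rfl)
  rw [← hlρ, hB]
  field_simp
  ring

/-- The enlarged box. -/
def enlargedCube (T L : ℝ) : Set R3 := {x | ∀ j, x j ∈ Set.Ioo (-T) (L + T)}

theorem enlargedCube_eq (T L : ℝ) : enlargedCube T L =
    (MeasurableEquiv.toLp 2 (Fin 3 → ℝ)).symm ⁻¹' (Set.univ.pi fun _ => Set.Ioo (-T) (L + T)) := by
  ext x
  simp [enlargedCube, Set.mem_pi]

theorem measurableSet_enlargedCube (T L : ℝ) : MeasurableSet (enlargedCube T L) := by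
  rw [enlargedCube_eq]
  exact (MeasurableEquiv.measurable _) (MeasurableSet.univ_pi fun _ => measurableSet_Ioo)

theorem volume_enlargedCube {T L : ℝ} :
    volume (enlargedCube T L) = ENNReal.ofReal (L + 2 * T) ^ 3 := by
  rw [enlargedCube_eq, (EuclideanSpace.volume_preserving_symm_measurableEquiv_toLp (Fin 3)).measure_preimage
    (MeasurableSet.univ_pi fun _ => measurableSet_Ioo).nullMeasurableSet, volume_pi_pi]
  simp only [Real.volume_Ioo, Finset.prod_const, Finset.card_univ, Fintype.card_fin]
  ring_nf

theorem volume_real_enlargedCube {T L : ℝ} (h : 0 ≤ L + 2 * T) :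
    ((volume : Measure R3).restrict (enlargedCube T L)).real Set.univ = (L + 2 * T) ^ 3 := by
  rw [measureReal_restrict_apply_univ, measureReal_def, volume_enlargedCube, ENNReal.toReal_pow,
    ENNReal.toReal_ofReal h]

theorem openCube_subset_enlargedCube {T L : ℝ} (hT : 0 ≤ T) : openCube L ⊆ enlargedCube T L :=
  fun _ hx j => ⟨by linarith [(hx j).1], by linarith [(hx j).2]⟩

theorem mem_enlargedCube {T L : ℝ} {y x : R3} (hy : y ∈ openCube L) (hxy : ‖x - y‖ < T) :
    x ∈ enlargedCube T L := by
  intro j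
  have h1 := (PiLp.norm_apply_le (x - y) j).trans_lt hxy
  rw [PiLp.sub_apply, Real.norm_eq_abs, abs_lt] at h1
  have h2 := hy j
  exact ⟨by linarith [h2.1], by linarith [h2.2]⟩

theorem exists_cube_root {t : ℝ} (ht : 0 ≤ t) : ∃ k : ℝ, 0 ≤ k ∧ k ^ 3 = t :=
  ⟨t ^ ((1:ℝ) / 3), by positivity, by
    rw [← rpow_natCast, ← rpow_mul ht]; norm_num⟩

/-- Bounds for the effective coupling constant. -/
theorem coupling_bounds {a θ x : ℝ} (ha : 0 ≤ a) (hθ : 0 < θ) (hθ1 : θ ≤ 1 / 20) (hx : 0 < x)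
    (hax : a * x ≤ θ ^ 18) :
    (1 - θ ^ 2) ^ 2 * (4 * π * a / (1 + 2 * a / (θ ^ 2 / x))) ≤ 4 * π * a ∧
    4 * π * a - 16 * π * a * θ ≤ (1 - θ ^ 2) ^ 2 * (4 * π * a / (1 + 2 * a / (θ ^ 2 / x))) := by
  have hp := pi_pos
  have hw : 2 * a / (θ ^ 2 / x) = 2 * (a * x) / θ ^ 2 := by field_simp
  set w := 2 * a / (θ ^ 2 / x) with hwd
  have w0 : 0 ≤ w := by positivity
  have hθ2 : θ ^ 2 ≤ θ := by nlinarith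
  have hwθ : w ≤ θ := by
    rw [hw, div_le_iff₀ (by positivity)]
    have : θ ^ 15 ≤ (1 / 20) ^ 15 := pow_le_pow_left₀ hθ.le hθ1 15
    have h3 : θ ^ 18 = θ * θ ^ 2 * θ ^ 15 := by ring
    have h4 := mul_le_mul_of_nonneg_left (this.trans (by norm_num : _ ≤ (1:ℝ) / 2))
      (show 0 ≤ θ * θ ^ 2 by positivity)
    linarith
  have h1 : 0 ≤ 1 - θ ^ 2 := by linarith
  have h2 : (1 - θ ^ 2) ^ 2 ≤ 1 := by nlinarith [sq_nonneg θ]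
  constructor
  · calc (1 - θ ^ 2) ^ 2 * (4 * π * a / (1 + w)) ≤ 1 * (4 * π * a / 1) := by
          apply mul_le_mul h2 _ (by positivity) zero_le_one
          exact div_le_div_of_nonneg_left (by positivity) one_pos (by linarith)
      _ = 4 * π * a := by ring
  · rw [← mul_div_assoc, le_div_iff₀ (by linarith)]
    have h3 : (1 - 4 * θ) * (1 + w) ≤ (1 - θ ^ 2) ^ 2 := by
      have h4 : (1 - 4 * θ) * (1 + w) ≤ (1 - 4 * θ) * (1 + θ) :=
        mul_le_mul_of_nonneg_left (by linarith) (by linarith)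
      nlinarith [sq_nonneg (θ ^ 2)]
    have := mul_le_mul_of_nonneg_left h3 (show 0 ≤ 4 * π * a by positivity)
    linarith

theorem kinetic_error_le {a θ x k₁ : ℝ} (ha : 0 ≤ a) (hθ : 0 < θ) (hθ1 : θ ≤ 1 / 20) (hx : 0 < x)
    (hax : a * x ≤ θ ^ 18) (hk₁ : k₁ ≤ 2 * x) :
    16 * π ^ 3 * (4 * a * x ^ 3 / (π * θ ^ 8)) ^ 2 * k₁ ≤ 512 * π * a * θ * x ^ 6 := by
  have hp := pi_pos
  calc 16 * π ^ 3 * (4 * a * x ^ 3 / (π * θ ^ 8)) ^ 2 * k₁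
      ≤ 16 * π ^ 3 * (4 * a * x ^ 3 / (π * θ ^ 8)) ^ 2 * (2 * x) :=
        mul_le_mul_of_nonneg_left hk₁ (by positivity)
    _ = 512 * π * a * x ^ 6 * (a * x / θ ^ 16) := by field_simp; ring
    _ ≤ 512 * π * a * x ^ 6 * θ := by
        refine mul_le_mul_of_nonneg_left ?_ (by positivity)
        rw [div_le_iff₀ (by positivity)]
        refine hax.trans ?_
        have : θ ^ 18 = θ * θ ^ 16 * θ := by ring
        have : 0 < θ * θ ^ 16 := by positivity
        nlinarith
    _ = 512 * π * a * θ * x ^ 6 := by ring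

/-- Constant in the error terms. -/
def errorConst (q : ℕ) : ℝ := 536 * π * q + 4096 * π ^ 3 / 9 * q ^ 2

theorem errorConst_nonneg (q : ℕ) : 0 ≤ errorConst q := by
  have := pi_pos
  unfold errorConst; positivity

/-- Collecting the error terms. -/
theorem collect_errors {q : ℕ} {N V F E T a c θ x K S kin : ℝ} (ha : 0 ≤ a) (hV : 0 ≤ V) (hF : 0 ≤ F)
    (hT0 : 0 ≤ T) (hTE : T ≤ E) (hθ : 0 < θ) (hθ1 : θ ≤ 1 / 20) (hx : 0 < x) (hN0 : 0 ≤ N)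
    (hN : N ≤ V * x ^ 3) (hc : c ≤ 4 * π * a) (hc0 : 0 ≤ c) (hc' : 4 * π * a - 16 * π * a * θ ≤ c)
    (hS0 : 0 ≤ S) (hS : S ≤ q * x ^ 3 * N)
    (hK : kin - q * (512 * π * a * θ * x ^ 6) ≤ K)
    (h : F * (V * K + c * (S - 2 * q * θ * x ^ 3 * N)) -
      c * x ^ 3 * (4 * q * (q * (2 * (4 / 3 * π * (x / θ) ^ 3) *
        (N * (4 / 3 * π * (2 * (θ ^ 2 / x)) ^ 3)) * F) + 1 / (2 * π ^ 2 * (x / θ) ^ 2) * T)) ≤ E) :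
    F * (V * kin + 4 * π * a * S - errorConst q * a * θ * x ^ 6 * V) ≤
      (1 + 8 * q * a * x * θ ^ 2 / π) * E := by
  have hp := pi_pos
  have e1 : c * x ^ 3 * (4 * q * (q * (2 * (4 / 3 * π * (x / θ) ^ 3) *
        (N * (4 / 3 * π * (2 * (θ ^ 2 / x)) ^ 3)) * F) + 1 / (2 * π ^ 2 * (x / θ) ^ 2) * T)) =
      c * (1024 * π ^ 2 / 9 * q ^ 2 * θ ^ 3 * x ^ 3 * (N * F)) + c * (2 * q * x * θ ^ 2 / π ^ 2 * T) := by
    field_simp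
    ring
  rw [e1] at h
  have hNx : x ^ 3 * N ≤ x ^ 6 * V := by
    have := mul_le_mul_of_nonneg_left hN (pow_nonneg hx.le 3)
    calc x ^ 3 * N ≤ x ^ 3 * (V * x ^ 3) := this
      _ = x ^ 6 * V := by ring
  have b1 : c * (2 * q * x * θ ^ 2 / π ^ 2 * T) ≤ 8 * q * a * x * θ ^ 2 / π * E := by
    calc c * (2 * q * x * θ ^ 2 / π ^ 2 * T) ≤ 4 * π * a * (2 * q * x * θ ^ 2 / π ^ 2 * E) := by
          refine mul_le_mul hc (mul_le_mul_of_nonneg_left hTE (by positivity)) (by positivity)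
            (by positivity)
      _ = 8 * q * a * x * θ ^ 2 / π * E := by field_simp; ring
  have hθ3 : θ ^ 3 ≤ θ := by nlinarith [pow_pos hθ 2, pow_le_pow_left₀ hθ.le hθ1 2]
  have b2 : c * (1024 * π ^ 2 / 9 * q ^ 2 * θ ^ 3 * x ^ 3 * (N * F)) ≤
      4096 * π ^ 3 / 9 * q ^ 2 * a * θ * x ^ 6 * V * F := by
    calc c * (1024 * π ^ 2 / 9 * q ^ 2 * θ ^ 3 * x ^ 3 * (N * F))
        = c * (1024 * π ^ 2 / 9 * q ^ 2 * θ ^ 3 * (x ^ 3 * N)) * F := by ring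
      _ ≤ 4 * π * a * (1024 * π ^ 2 / 9 * q ^ 2 * θ * (x ^ 6 * V)) * F := by
          refine mul_le_mul_of_nonneg_right (mul_le_mul hc ?_ (by positivity) (by positivity)) hF
          refine mul_le_mul (mul_le_mul_of_nonneg_left hθ3 (by positivity)) hNx (by positivity)
            (by positivity)
      _ = 4096 * π ^ 3 / 9 * q ^ 2 * a * θ * x ^ 6 * V * F := by ring
  have b3 : 4 * π * a * S - 24 * π * q * a * θ * x ^ 6 * V ≤ c * (S - 2 * q * θ * x ^ 3 * N) := by
    have c1 := mul_le_mul_of_nonneg_right hc' hS0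
    have hqN : q * (x ^ 3 * N) ≤ q * (x ^ 6 * V) := mul_le_mul_of_nonneg_left hNx (Nat.cast_nonneg q)
    have c2 : 16 * π * a * θ * S ≤ 16 * π * a * θ * (q * (x ^ 6 * V)) :=
      mul_le_mul_of_nonneg_left (hS.trans (by linarith)) (by positivity)
    have c3 : c * (2 * θ * (q * (x ^ 3 * N))) ≤ 4 * π * a * (2 * θ * (q * (x ^ 6 * V))) :=
      mul_le_mul hc (mul_le_mul_of_nonneg_left hqN (by positivity)) (by positivity) (by positivity)
    linarith
  have b4 := mul_le_mul_of_nonneg_left hK hV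
  have b5 := mul_le_mul_of_nonneg_left (add_le_add b4 b3) hF
  rw [errorConst]
  linarith

open FourierTransform in
set_option maxHeartbeats 1000000 in
/-- Lower bound for the energy of one spin configuration in terms of the density. -/
theorem IsScatteringSolution.configEnergy_ge {v φ : R3 → ℝ} {R0 a : ℝ}
    (h : IsScatteringSolution v φ R0 a) (hvs : ∀ x, v (-x) = v x) {q : ℕ} (hq : 1 ≤ q)
    {θ x : ℝ} (hθ : 0 < θ) (hθ1 : θ ≤ 1 / 20) (hx : 0 < x) (hax : a * x ≤ θ ^ 18)
    (hRx : R0 * x ≤ θ ^ 2) (hRx' : 4 * π * R0 * x ≤ θ) :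
    ∃ T : ℝ, 0 < T ∧ ∀ {N : ℕ} {L : ℝ}, 0 < L → N ≤ (L + 2 * T) ^ 3 * x ^ 3 →
      ∀ {l : ℝ}, 0 ≤ l → (L + 2 * T) ^ 3 * (q * (4 / 3 * π * l ^ 3)) = N →
      ∀ {f : (Fin N → R3) → ℂ} (σ : Fin N → Fin q), IsTest L f →
      (∀ i k, i ≠ k → σ i = σ k → ∀ X, f (X ∘ Equiv.swap i k) = -f X) →
      (∫ X, ‖f X‖ ^ 2) * ((L + 2 * T) ^ 3 * (q * (16 * π ^ 3 / 5) * l ^ 5 +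
        4 * π * a * (1 - 1 / q) * (N / (L + 2 * T) ^ 3) ^ 2 -
        errorConst q * a * θ * x ^ 6)) ≤
      (1 + 8 * q * a * x * θ ^ 2 / π) * configEnergy v f := by
  have hp := pi_pos
  have hp3 := pi_gt_three
  have hp4 := pi_lt_d2
  have a0 := h.length_nonneg
  have hq0 : (0:ℝ) < q := by exact_mod_cast hq
  obtain ⟨κ, hκm, hκ0, ⟨Cκ, hκC⟩, hκs, hκ1, hκ⟩ := h.exists_density
  have hκi : Integrable κ := integrable_of_bdd_of_support hκm
    (fun x => by rw [abs_of_nonneg (hκ0 x)]; exact hκC x) hκs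
  obtain ⟨T, hT, hM⟩ := exists_overlap_radius hκi hκ0 hκ1 h.R0_pos.le hκs x
    (show 0 < θ * x ^ 3 by positivity)
  refine ⟨T, hT, ?_⟩
  intro N L hL hN l hl hlN f σ hf hanti
  set B := enlargedCube T L with hBdef
  have hVreal := volume_real_enlargedCube (T := T) (L := L) (by positivity)
  set V := (L + 2 * T) ^ 3 with hV
  have V0 : 0 < V := by positivity
  have : IsFiniteMeasure ((volume : Measure R3).restrict B) := by
    refine ⟨?_⟩
    rw [Measure.restrict_apply_univ, hBdef, volume_enlargedCube]
    exact ENNReal.pow_lt_top ENNReal.ofReal_lt_top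
  have hθ2 : θ ^ 2 ≤ 1 / 400 := by nlinarith
  set d := 4 * a * x ^ 3 / (π * θ ^ 8) with hd
  set R := θ ^ 2 / x with hR
  have R0' : 0 < R := by positivity
  set c := (1 - θ ^ 2) ^ 2 * (4 * π * a / (1 + 2 * a / R)) with hc
  have c0 : 0 ≤ c := by positivity
  obtain ⟨hc1, hc2⟩ := coupling_bounds a0 hθ hθ1 hx hax
  rw [← hR, ← hc] at hc1 hc2
  choose k hk0 hk using fun s => exists_cube_root
    (show 0 ≤ 3 / (4 * π * V) * ((spinClass σ s).card : ℝ) by positivity)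
  have hcard : ∀ s, ((spinClass σ s).card : ℝ) = V * (4 / 3 * π * k s ^ 3) := by
    intro s
    rw [hk s]
    field_simp
  have ht : ∀ s, 4 / 3 * π * k s ^ 3 ≤ x ^ 3 := by
    intro s
    have h1 := (card_spinClass_le σ s).trans hN
    rw [hcard s] at h1
    exact le_of_mul_le_mul_left h1 V0
  have hcube : ∀ {y : ℝ}, 0 ≤ y → 4 / 3 * π * y ^ 3 ≤ x ^ 3 → y ≤ x := by
    intro y hy hyx
    refine le_of_pow_le_pow_left₀ three_ne_zero hx.le (le_trans ?_ hyx)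
    have := pow_nonneg hy 3
    nlinarith
  have hkx : ∀ s, k s ≤ x := fun s => hcube (hk0 s) (ht s)
  have hlx : l ≤ x := by
    refine hcube hl ?_
    have h1 : V * (q * (4 / 3 * π * l ^ 3)) ≤ V * x ^ 3 := hlN.le.trans hN
    have h2 := le_of_mul_le_mul_left h1 V0
    have h3 : (1:ℝ) ≤ q := by exact_mod_cast hq
    have h4 : 0 ≤ 4 / 3 * π * l ^ 3 := by positivity
    nlinarith
  set k₁ : Fin q → ℝ := fun s => √(k s ^ 2 + d) with hk₁
  have hob := fun s => h.oneBodyBound hκ hκi hκs hκ0 hκ1 hθ hθ1 hx hax hRx (hk0 s) (hkx s)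
  have hd0 : 0 ≤ d := by positivity
  have hk₁x : ∀ s, k₁ s ≤ 2 * x := by
    intro s
    have h1 := (hob s).2
    have h2 := pow_le_pow_left₀ (hk0 s) (hkx s) 2
    rw [hk₁, sqrt_le_left (by positivity)]
    nlinarith
  have hsumcard : ∑ s, ((spinClass σ s).card : ℝ) = N := by
    have := sum_spinClass σ Finset.univ (fun _ => (1:ℝ))
    simpa using this
  have hcd : c * (4 / R ^ 3) ≤ 4 * π ^ 2 * d := by
    refine (mul_le_mul_of_nonneg_right hc1 (by positivity)).trans ?_
    have e1 : 4 * π * a * (4 / R ^ 3) = 16 * π * a * x ^ 3 / θ ^ 6 := by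
      rw [hR]; field_simp; ring
    have e2 : 4 * π ^ 2 * d = 16 * π * a * x ^ 3 / θ ^ 8 := by
      rw [hd]; field_simp; ring
    rw [e1, e2]
    refine div_le_div_of_nonneg_left (by positivity) (by positivity) ?_
    exact pow_le_pow_of_le_one hθ.le (by linarith) (by norm_num)
  have hKx : 4 * π * R * x ≤ 1 := by
    have : 4 * π * R * x = 4 * π * θ ^ 2 := by rw [hR]; field_simp
    rw [this]
    nlinarith
  have hTs : ∀ s, 4 / 3 * π * k s ^ 3 - 2 * θ * x ^ 3 ≤
      ∫ z in {z | ‖z‖ < T}, ‖𝓕⁻ (lowProfile κ (k s)) z‖ ^ 2 := by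
    intro s
    refine le_trans ?_ (hM (k s) (hk0 s) (hkx s))
    have h1 : 4 * π * R0 * k s ≤ θ :=
      (mul_le_mul_of_nonneg_left (hkx s) (mul_nonneg (by positivity) h.R0_pos.le)).trans hRx'
    have h2 : 0 ≤ 4 / 3 * π * k s ^ 3 := mul_nonneg (by positivity) (pow_nonneg (hk0 s) 3)
    have h3 : 4 * π * R0 * k s * (4 / 3 * π * k s ^ 3) ≤ θ * x ^ 3 := mul_le_mul h1 (ht s) h2 hθ.le
    linarith
  have hQ : 0 < x / θ := by positivity
  have main := sum_classEnergy_ge (by rw [hVreal]; exact V0.ne') hf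
    (openCube_subset_enlargedCube hT.le) (measurableSet_enlargedCube T L)
    (fun y hy z hz => mem_enlargedCube hy hz) σ hanti h.meas h.nonneg h.bdd hκi hκ0 hκ1 R0' hKx hx.le
    hθ.le hd0 c0 hcd hQ hk0 hkx (k₁ := k₁) (fun s => sqrt_nonneg _)
    (fun s => sq_sqrt (by positivity)) (fun s => (hob s).1) (by rw [hVreal]; exact hcard)
    (by rw [hVreal]; exact hN) hTs
  rw [hVreal] at main
  have main2 := main.trans (hf.sum_classEnergy_le h.meas h.nonneg h.bdd hvs σ)
  set S := ∑ s, 4 / 3 * π * k s ^ 3 * (N - (spinClass σ s).card) with hS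
  have hnn : ∀ s, (0:ℝ) ≤ N - (spinClass σ s).card := fun s => sub_nonneg.2 (card_spinClass_le σ s)
  have htn : ∀ s, 0 ≤ 4 / 3 * π * k s ^ 3 := fun s => mul_nonneg (by positivity) (pow_nonneg (hk0 s) 3)
  have hS0 : 0 ≤ S := Finset.sum_nonneg fun s _ => mul_nonneg (htn s) (hnn s)
  have hS1 : S ≤ q * x ^ 3 * N := by
    have : ∀ s ∈ (Finset.univ : Finset (Fin q)), 4 / 3 * π * k s ^ 3 * (N - (spinClass σ s).card) ≤
        x ^ 3 * N := fun s _ => mul_le_mul (ht s) (sub_le_self _ (Nat.cast_nonneg _)) (hnn s)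
          (by positivity)
    refine (Finset.sum_le_sum this).trans (le_of_eq ?_)
    rw [Finset.sum_const, Finset.card_univ, Fintype.card_fin, nsmul_eq_mul]
    ring
  have hK : (∑ s, 16 * π ^ 3 / 5 * k s ^ 5) - q * (512 * π * a * θ * x ^ 6) ≤
      ∑ s, (16 * π ^ 3 / 5 * k s ^ 5 - 16 * π ^ 3 * d ^ 2 * k₁ s) := by
    rw [Finset.sum_sub_distrib]
    refine sub_le_sub_left ?_ _
    have := Finset.sum_le_sum fun s (_ : s ∈ (Finset.univ : Finset (Fin q))) =>
      kinetic_error_le a0 hθ hθ1 hx hax (hk₁x s)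
    refine this.trans (le_of_eq ?_)
    rw [Finset.sum_const, Finset.card_univ, Fintype.card_fin, nsmul_eq_mul]
  have hF0 : 0 ≤ ∫ X, ‖f X‖ ^ 2 := integral_nonneg fun X => by positivity
  have hkin0 : 0 ≤ ∑ i, ∫ X, gradSqAt f i X :=
    Finset.sum_nonneg fun i _ => integral_nonneg fun X => gradSqAt_nonneg f i X
  have fin := collect_errors a0 V0.le hF0 hkin0
    (hf.kinetic_le_configEnergy h.meas h.nonneg h.bdd) hθ hθ1 hx (Nat.cast_nonneg N) hN hc1 c0 hc2
    hS0 hS1 hK main2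
  refine le_trans (mul_le_mul_of_nonneg_left ?_ hF0) fin
  have hax' : 20 * (a * x) ≤ 1 := by
    have : θ ^ 18 ≤ (1 / 20) ^ 18 := pow_le_pow_left₀ hθ.le hθ1 18
    have h1 := hax.trans (this.trans (by norm_num : _ ≤ (1:ℝ) / 20))
    linarith
  have hρ : ∑ s, 4 / 3 * π * k s ^ 3 = N / V := by
    rw [eq_div_iff V0.ne', ← hsumcard, Finset.sum_mul]
    exact Finset.sum_congr rfl fun s _ => by rw [hcard s, mul_comm]
  have hlρ : q * (4 / 3 * π * l ^ 3) = N / V := by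
    rw [eq_div_iff V0.ne', ← hlN, mul_comm]
  have jen := mul_le_mul_of_nonneg_left
    (sum_fermi_energy_ge hq a0 hk0 hkx hl hlx hax' hρ hlρ) V0.le
  have e : V * ∑ s, (16 * π ^ 3 / 5 * k s ^ 5 +
      4 * π * a * (4 / 3 * π * k s ^ 3 * (N / V - 4 / 3 * π * k s ^ 3))) =
      V * (∑ s, 16 * π ^ 3 / 5 * k s ^ 5) + 4 * π * a * S := by
    rw [hS, Finset.mul_sum, Finset.mul_sum, Finset.mul_sum, ← Finset.sum_add_distrib]
    refine Finset.sum_congr rfl fun s _ => ?_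
    rw [hcard s]
    field_simp
  rw [e] at jen
  linarith

theorem norm_sum_sq_of_disjoint {ι : Type*} [Fintype ι] (a : ι → ℂ)
    (h : ∀ k m, k ≠ m → a k = 0 ∨ a m = 0) : ‖∑ k, a k‖ ^ 2 = ∑ k, ‖a k‖ ^ 2 := by
  by_cases h0 : ∃ k, a k ≠ 0
  · obtain ⟨k, hk⟩ := h0
    have h1 : ∀ m, m ≠ k → a m = 0 := fun m hm => (h k m hm.symm).resolve_left hk
    rw [Finset.sum_eq_single k (fun m _ hm => h1 m hm) (by simp),
      Finset.sum_eq_single k (fun m _ hm => by simp [h1 m hm]) (by simp)]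
  · push Not at h0
    simp [h0]

/-- Slater determinant of the translates of `g` by the points `p k`. -/
def slater {N : ℕ} (g : R3 → ℂ) (p : Fin N → R3) (X : Fin N → R3) : ℂ :=
  (Matrix.of fun i k => g (X i - p k)).det

section
variable {N : ℕ} {g : R3 → ℂ} {p : Fin N → R3} {r s L : ℝ}

theorem slater_swap {i j : Fin N} (hij : i ≠ j) (X : Fin N → R3) :
    slater g p (X ∘ Equiv.swap i j) = -slater g p X := by
  have := Matrix.det_permute (Equiv.swap i j) (Matrix.of fun i k => g (X i - p k))
  rw [Equiv.Perm.sign_swap hij] at this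
  have e : (Matrix.of fun i k => g (X i - p k)).submatrix (Equiv.swap i j) id =
      Matrix.of fun l k => g ((X ∘ Equiv.swap i j) l - p k) := rfl
  rw [e] at this
  rw [slater, slater, this]
  simp

theorem exists_perm_of_slater_ne_zero {X : Fin N → R3} (hX : slater g p X ≠ 0) :
    ∃ τ : Equiv.Perm (Fin N), ∀ i, g (X (τ i) - p i) ≠ 0 := by
  rw [slater, Matrix.det_apply] at hX
  obtain ⟨τ, -, hτ⟩ := Finset.exists_ne_zero_of_sum_ne_zero hX
  refine ⟨τ, fun i h0 => hτ ?_⟩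
  rw [Finset.prod_eq_zero (Finset.mem_univ i) (by simpa using h0), smul_zero]

theorem contDiff_slater (hg : ContDiff ℝ (⊤ : ℕ∞) g) : ContDiff ℝ (⊤ : ℕ∞) (slater g p) := by
  unfold slater
  simp only [Matrix.det_apply, Matrix.of_apply]
  refine ContDiff.sum fun τ _ => ?_
  refine ContDiff.const_smul _ (contDiff_prod fun i _ => ?_)
  exact hg.comp (((contDiff_apply ℝ R3 (τ i))).sub contDiff_const)

theorem isTest_slater (hg : ContDiff ℝ (⊤ : ℕ∞) g) (hs : ∀ y, r < ‖y‖ → g y = 0)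
    (hp : ∀ k y, ‖y - p k‖ ≤ r → y ∈ openCube L) : IsTest L (slater g p) := by
  refine ⟨contDiff_slater hg, ?_⟩
  have hc : IsClosed {X : Fin N → R3 | ∀ i, ∃ k, ‖X i - p k‖ ≤ r} := by
    have e : {X : Fin N → R3 | ∀ i, ∃ k, ‖X i - p k‖ ≤ r} =
        ⋂ i, ⋃ k, {X : Fin N → R3 | ‖X i - p k‖ ≤ r} := by
      ext X; simp
    rw [e]
    refine isClosed_iInter fun i => isClosed_iUnion_of_finite fun k => ?_
    exact isClosed_le (by fun_prop) continuous_const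
  have h1 : tsupport (slater g p) ⊆ {X : Fin N → R3 | ∀ i, ∃ k, ‖X i - p k‖ ≤ r} := by
    refine closure_minimal (fun X hX i => ?_) hc
    obtain ⟨τ, hτ⟩ := exists_perm_of_slater_ne_zero hX
    refine ⟨τ.symm i, ?_⟩
    by_contra hlt
    have := hτ (τ.symm i)
    rw [Equiv.apply_symm_apply] at this
    exact this (hs _ (not_le.1 hlt))
  intro X hX i
  obtain ⟨k, hk⟩ := h1 hX i
  exact hp k _ hk

theorem slice_slater (i : Fin N) (X : Fin N → R3) : ∃ c : Fin N → ℂ, ∀ y,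
    slice (slater g p) i X y = ∑ k, g (y - p k) * c k := by
  set M : Matrix (Fin N) (Fin N) ℂ := Matrix.of fun i k => g (X i - p k) with hM
  refine ⟨fun k => M.adjugate k i, fun y => ?_⟩
  have e : (Matrix.of fun j k => g (Function.update X i y j - p k)) =
      M.updateRow i fun k => g (y - p k) := by
    ext j k
    rcases eq_or_ne j i with rfl | hj
    · simp
    · simp [hj, hM]
  rw [slice, slater, e, Matrix.det_eq_sum_mul_adjugate_row _ i]
  refine Finset.sum_congr rfl fun k _ => ?_
  have ea : (M.updateRow i fun k => g (y - p k)).adjugate k i = M.adjugate k i := by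
    rw [Matrix.adjugate_apply, Matrix.adjugate_apply, Matrix.updateRow_idem]
  rw [Matrix.updateRow_self, ea]

theorem integral_gradSq_sum (hg : ContDiff ℝ (⊤ : ℕ∞) g) (hs : ∀ y, r < ‖y‖ → g y = 0)
    (hsep : ∀ k m, k ≠ m → 2 * r < ‖p k - p m‖) (c : Fin N → ℂ) :
    (∫ y, ‖g y‖ ^ 2) * ∫ y, gradSq (fun y => ∑ k, g (y - p k) * c k) y =
      (∫ y, gradSq g y) * ∫ y, ‖∑ k, g (y - p k) * c k‖ ^ 2 := by
  have hcs : HasCompactSupport g := by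
    refine HasCompactSupport.intro (isCompact_closedBall (0:R3) r) fun y hy => hs y ?_
    simpa using hy
  have hts : ∀ y, y ∈ tsupport g → ‖y‖ ≤ r := by
    have hcl : IsClosed {y : R3 | ‖y‖ ≤ r} := isClosed_le continuous_norm continuous_const
    intro y hy
    refine closure_minimal (fun y hy => ?_) hcl hy
    by_contra hlt
    exact hy (hs y (not_le.1 hlt))
  have hfd0 : ∀ y, r < ‖y‖ → fderiv ℝ g y = 0 := by
    intro y hy
    by_contra h0
    exact absurd (hts y (support_fderiv_subset ℝ h0)) (not_le.2 hy)
  have hor : ∀ y k m, k ≠ m → r < ‖y - p k‖ ∨ r < ‖y - p m‖ := by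
    intro y k m hkm
    by_contra! hc
    have h1 := hsep k m hkm
    have h2 : ‖p k - p m‖ ≤ ‖y - p m‖ + ‖y - p k‖ := by
      have := norm_sub_le (y - p m) (y - p k)
      simpa using this
    linarith [hc.1, hc.2]
  have hdiff : Differentiable ℝ g := hg.differentiable (by simp)
  have hfd : ∀ y, fderiv ℝ (fun y => ∑ k, g (y - p k) * c k) y =
      ∑ k, c k • fderiv ℝ g (y - p k) := by
    intro y
    have : HasFDerivAt (fun y => ∑ k, g (y - p k) * c k)
        (∑ k, c k • fderiv ℝ g (y - p k)) y := by
      refine HasFDerivAt.fun_sum fun k _ => ?_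
      refine HasFDerivAt.mul_const ?_ (c k)
      have := (hdiff (y - p k)).hasFDerivAt.comp y ((hasFDerivAt_id y).sub_const (p k))
      rw [ContinuousLinearMap.comp_id] at this
      exact this
    exact this.fderiv
  have hgrad : ∀ y, gradSq (fun y => ∑ k, g (y - p k) * c k) y =
      ∑ k, ‖c k‖ ^ 2 * gradSq g (y - p k) := by
    intro y
    unfold gradSq
    simp_rw [hfd, Finset.mul_sum]
    rw [Finset.sum_comm]
    refine Finset.sum_congr rfl fun j _ => ?_
    rw [_root_.sum_apply, norm_sum_sq_of_disjoint]
    · refine Finset.sum_congr rfl fun k _ => ?_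
      simp [mul_pow]
    · intro k m hkm
      rcases hor y k m hkm with h | h
      · left; simp [hfd0 _ h]
      · right; simp [hfd0 _ h]
  have hnorm : ∀ y, ‖∑ k, g (y - p k) * c k‖ ^ 2 = ∑ k, ‖c k‖ ^ 2 * ‖g (y - p k)‖ ^ 2 := by
    intro y
    rw [norm_sum_sq_of_disjoint]
    · refine Finset.sum_congr rfl fun k _ => ?_
      rw [norm_mul, mul_pow, mul_comm]
    · intro k m hkm
      rcases hor y k m hkm with h | h
      · left; simp [hs _ h]
      · right; simp [hs _ h]
  have hgc : Continuous (gradSq g) := by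
    unfold gradSq
    have := hg.continuous_fderiv (by simp)
    fun_prop
  have hgi : Integrable (gradSq g) := by
    refine hgc.integrable_of_hasCompactSupport
      (HasCompactSupport.intro (isCompact_closedBall (0:R3) r) fun y hy => ?_)
    have : r < ‖y‖ := by simpa using hy
    simp [gradSq, hfd0 y this]
  have hni : Integrable fun y => ‖g y‖ ^ 2 := by
    refine (hg.continuous.norm.pow 2).integrable_of_hasCompactSupport
      (HasCompactSupport.intro (isCompact_closedBall (0:R3) r) fun y hy => ?_)
    have : r < ‖y‖ := by simpa using hy
    simp [hs y this]
  simp_rw [hgrad, hnorm]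
  rw [integral_finsetSum _ fun k _ => (hgi.comp_sub_right (p k)).const_mul _,
    integral_finsetSum _ fun k _ => (hni.comp_sub_right (p k)).const_mul _]
  simp_rw [integral_const_mul]
  rw [Finset.mul_sum, Finset.mul_sum]
  refine Finset.sum_congr rfl fun k _ => ?_
  rw [integral_sub_right_eq_self (gradSq g) (p k),
    integral_sub_right_eq_self (fun y => ‖g y‖ ^ 2) (p k)]
  ring

theorem integral_gradSqAt_slater (hg : ContDiff ℝ (⊤ : ℕ∞) g) (hs : ∀ y, r < ‖y‖ → g y = 0)
    (hp : ∀ k y, ‖y - p k‖ ≤ r → y ∈ openCube L) (hL : 0 < L)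
    (hsep : ∀ k m, k ≠ m → 2 * r < ‖p k - p m‖) (i : Fin N) :
    (∫ y, ‖g y‖ ^ 2) * ∫ X, gradSqAt (slater g p) i X =
      (∫ y, gradSq g y) * ∫ X, ‖slater g p X‖ ^ 2 := by
  have h := isTest_slater hg hs hp
  set B := enlargedCube 1 L with hB
  have hBs : openCube L ⊆ B := openCube_subset_enlargedCube zero_le_one
  have hV := volume_real_enlargedCube (T := 1) (L := L) (by positivity)
  set ν := (volume : Measure R3).restrict B with hν
  have : IsFiniteMeasure ν := by
    refine ⟨?_⟩
    rw [hν, Measure.restrict_apply_univ, hB, volume_enlargedCube]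
    exact ENNReal.pow_lt_top ENNReal.ofReal_lt_top
  have hV0 : 0 < ν.real Set.univ := by
    rw [hV]
    positivity
  have h1 := integral_update_real ν i (h.bddMeas_gradSqAt i)
  have h2 := integral_update_real ν i h.bddMeas.norm_sq
  rw [integral_pi_eq_of_supported hBs (fun X ⟨k, hX⟩ => h.gradSqAt_eq_zero i hX)] at h1
  have h2' : ∫ X, ‖slater g p X‖ ^ 2 ∂(Measure.pi fun _ => ν) = ∫ X, ‖slater g p X‖ ^ 2 :=
    integral_pi_eq_of_supported hBs (fun X ⟨k, hX⟩ => by rw [h.eq_zero hX]; simp)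
  rw [h2'] at h2
  have e : ∀ X, (∫ y, ‖g y‖ ^ 2) * ∫ x, gradSqAt (slater g p) i (Function.update X i x) ∂ν =
      (∫ y, gradSq g y) * ∫ x, ‖slater g p (Function.update X i x)‖ ^ 2 ∂ν := by
    intro X
    obtain ⟨c, hc⟩ := slice_slater (g := g) (p := p) i X
    have e1 : ∫ x, gradSqAt (slater g p) i (Function.update X i x) ∂ν =
        ∫ x, gradSq (slice (slater g p) i X) x := by
      simp only [IsTest.gradSq_slice]
      exact setIntegral_eq_of_supported hBs fun x hx =>
        h.gradSqAt_eq_zero i (k := i) (by simpa using hx)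
    have e2 : ∫ x, ‖slater g p (Function.update X i x)‖ ^ 2 ∂ν =
        ∫ x, ‖slice (slater g p) i X x‖ ^ 2 := by
      refine setIntegral_eq_of_supported hBs fun x hx => ?_
      rw [h.eq_zero (i := i) (by simpa using hx)]
      simp
    rw [e1, e2, funext hc]
    exact integral_gradSq_sum hg hs hsep c
  have h3 := congrArg (fun F : (Fin N → R3) → ℝ => ∫ X, F X ∂(Measure.pi fun _ => ν)) (funext e)
  simp only [integral_const_mul] at h3
  rw [h1, h2] at h3
  refine mul_left_cancel₀ hV0.ne' ?_
  linarith

theorem integral_norm_sq_slater_pos (hg : ContDiff ℝ (⊤ : ℕ∞) g) (hs : ∀ y, r < ‖y‖ → g y = 0)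
    (hr : 0 ≤ r) (hp : ∀ k y, ‖y - p k‖ ≤ r → y ∈ openCube L)
    (hsep : ∀ k m, k ≠ m → 2 * r < ‖p k - p m‖) (h0 : g 0 ≠ 0) :
    0 < ∫ X, ‖slater g p X‖ ^ 2 := by
  have h := isTest_slater hg hs hp
  have hc : Continuous fun X => ‖slater g p X‖ ^ 2 := h.smooth.continuous.norm.pow 2
  refine hc.integral_pos_of_hasCompactSupport_nonneg_nonzero (x := p) ?_
    (fun X => by positivity) ?_
  · refine h.hasCompactSupport.mono fun X hX => ?_
    contrapose! hX
    simp at hX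
    simp [hX]
  · have : (Matrix.of fun i k => g (p i - p k)) = Matrix.diagonal fun _ : Fin N => g 0 := by
      ext i k
      rcases eq_or_ne i k with rfl | hik
      · simp
      · rw [Matrix.diagonal_apply_ne _ hik, Matrix.of_apply]
        refine hs _ ?_
        linarith [hsep i k hik]
    rw [slater, this, Matrix.det_diagonal]
    simp [h0]

theorem slater_interaction_eq_zero {v : R3 → ℝ} (hv : ∀ x : R3, s < ‖x‖ → v x = 0)
    (hs : ∀ y, r < ‖y‖ → g y = 0) (hsep : ∀ k m, k ≠ m → 2 * r + s < ‖p k - p m‖)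
    {i j : Fin N} (hij : i ≠ j) (X : Fin N → R3) :
    v (X i - X j) * ‖slater g p X‖ ^ 2 = 0 := by
  by_cases hX : slater g p X = 0
  · simp [hX]
  obtain ⟨τ, hτ⟩ := exists_perm_of_slater_ne_zero hX
  have hb : ∀ i, ‖X i - p (τ.symm i)‖ ≤ r := by
    intro i
    by_contra hlt
    have := hτ (τ.symm i)
    rw [Equiv.apply_symm_apply] at this
    exact this (hs _ (not_le.1 hlt))
  rw [hv, zero_mul]
  have h1 := hsep _ _ (τ.symm.injective.ne hij)
  have h2 : p (τ.symm i) - p (τ.symm j) =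
      (X i - X j) - (X i - p (τ.symm i)) + (X j - p (τ.symm j)) := by abel
  have h3 := norm_add_le ((X i - X j) - (X i - p (τ.symm i))) (X j - p (τ.symm j))
  have h4 := norm_sub_le (X i - X j) (X i - p (τ.symm i))
  rw [← h2] at h3
  linarith [hb i, hb j]

end

theorem exists_separated_points {N : ℕ} {L r : ℝ} (hr : 0 < r)
    (hN : (N : ℝ) ≤ (L / (4 * r) - 1) ^ 3) (hL1 : 1 ≤ L / (4 * r)) : ∃ p : Fin N → R3,
      (∀ k y, ‖y - p k‖ ≤ r → y ∈ openCube L) ∧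
      ∀ k m, k ≠ m → 2 * r + r < ‖p k - p m‖ := by
  set m := ⌊L / (4 * r)⌋₊ with hm
  have hmL : (m : ℝ) ≤ L / (4 * r) := Nat.floor_le (by linarith)
  have hmL' : L / (4 * r) - 1 ≤ m := (Nat.sub_one_lt_floor _).le
  have hcard : N ≤ m ^ 3 := by
    have : (N : ℝ) ≤ (m : ℝ) ^ 3 := hN.trans (pow_le_pow_left₀ (by linarith) hmL' 3)
    exact_mod_cast this
  obtain ⟨e⟩ : Nonempty (Fin N ↪ (Fin 3 → Fin m)) :=
    Function.Embedding.nonempty_of_card_le (by simpa using hcard)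
  refine ⟨fun k => WithLp.toLp 2 fun j => 4 * r * ((e k j : ℝ) + 1 / 2), ?_, ?_⟩
  · intro k y hy j
    have h1 := (PiLp.norm_apply_le (y - WithLp.toLp 2 fun j => 4 * r * ((e k j : ℝ) + 1 / 2)) j).trans hy
    rw [PiLp.sub_apply, Real.norm_eq_abs, abs_le] at h1
    have h2 : (0:ℝ) ≤ (e k j : ℝ) := Nat.cast_nonneg _
    have h3 : ((e k j : ℕ) : ℝ) + 1 ≤ m := by exact_mod_cast (e k j).isLt
    rw [le_div_iff₀ (by positivity)] at hmL
    have h4 := mul_le_mul_of_nonneg_right h3 (show 0 ≤ 4 * r by positivity)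
    have h5 := mul_nonneg h2 (show 0 ≤ 4 * r by positivity)
    simp only at h1
    constructor <;> linarith [h1.1, h1.2]
  · intro k l hkl
    obtain ⟨j, hj⟩ := Function.ne_iff.1 (e.injective.ne hkl)
    refine lt_of_lt_of_le ?_ (PiLp.norm_apply_le _ j)
    rw [PiLp.sub_apply, Real.norm_eq_abs]
    simp only
    rw [← mul_sub, abs_mul, abs_of_pos (show 0 < 4 * r by positivity)]
    have h1 : (1:ℝ) ≤ |((e k j : ℕ) : ℝ) + 1 / 2 - (((e l j : ℕ) : ℝ) + 1 / 2)| := by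
      rw [add_sub_add_right_eq_sub]
      have : ((e k j : ℕ) : ℤ) - ((e l j : ℕ) : ℤ) ≠ 0 := by
        intro h0
        exact hj (Fin.ext (by omega))
      exact_mod_cast Int.one_le_abs this
    nlinarith

theorem gradSq_const_mul {h : R3 → ℂ} (hh : Differentiable ℝ h) (c : ℂ) (x : R3) :
    gradSq (fun y => c * h y) x = ‖c‖ ^ 2 * gradSq h x := by
  unfold gradSq
  rw [fderiv_const_mul (hh x), Finset.mul_sum]
  refine Finset.sum_congr rfl fun j _ => ?_
  simp [mul_pow]

theorem energyForm_eq_sum_configEnergy {N q : ℕ} (v : R3 → ℝ)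
    (Ψ : (Fin N → R3) → (Fin N → Fin q) → ℂ) :
    energyForm N q v Ψ = ∑ σ, configEnergy v fun X => Ψ X σ := rfl

theorem exists_fermionicState {q : ℕ} (hq : 1 ≤ q) {v : R3 → ℝ} {r : ℝ} (hr : 0 < r)
    (hv : ∀ x : R3, r < ‖x‖ → v x = 0) : ∃ K : ℝ, ∀ {N : ℕ} {L : ℝ}, 0 < L →
      (N : ℝ) ≤ (L / (4 * r) - 1) ^ 3 → 1 ≤ L / (4 * r) →
      ∃ Ψ, IsFermionicState N q L Ψ ∧ energyForm N q v Ψ = N * K := by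
  classical
  let b : ContDiffBump (0 : R3) := ⟨r / 2, r, by positivity, by linarith⟩
  set g : R3 → ℂ := fun y => (b y : ℂ) with hgdef
  have hg : ContDiff ℝ (⊤ : ℕ∞) g := Complex.ofRealCLM.contDiff.comp b.contDiff
  have hs : ∀ y, r < ‖y‖ → g y = 0 := by
    intro y hy
    have : b y = 0 := b.zero_of_le_dist (by simpa using hy.le)
    simp [hgdef, this]
  have hg0 : g 0 ≠ 0 := by
    have : b (0:R3) = 1 := b.one_of_mem_closedBall (by simpa using b.rIn_pos.le)
    simp [hgdef, this]
  have hG : 0 < ∫ y, ‖g y‖ ^ 2 := by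
    have hc : Continuous fun y => ‖g y‖ ^ 2 := hg.continuous.norm.pow 2
    refine hc.integral_pos_of_hasCompactSupport_nonneg_nonzero (x := 0) ?_
      (fun X => by positivity) (by simpa using hg0)
    refine HasCompactSupport.intro (isCompact_closedBall (0:R3) r) fun y hy => ?_
    have : r < ‖y‖ := by simpa using hy
    simp [hs y this]
  refine ⟨(∫ y, gradSq g y) / ∫ y, ‖g y‖ ^ 2, ?_⟩
  intro N L hL hN hL1
  obtain ⟨p, hp, hsep⟩ := exists_separated_points hr hN hL1
  have hsep' : ∀ k m, k ≠ m → 2 * r < ‖p k - p m‖ := fun k m hkm => by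
    linarith [hsep k m hkm]
  have hf := isTest_slater hg hs hp
  set f := slater g p with hfdef
  have hn := integral_norm_sq_slater_pos hg hs hr.le hp hsep' hg0
  rw [← hfdef] at hn
  set n := ∫ X, ‖f X‖ ^ 2 with hndef
  set c : ℂ := (((√n)⁻¹ : ℝ) : ℂ) with hc
  have hc2 : ‖c‖ ^ 2 = n⁻¹ := by
    rw [hc, Complex.norm_real, norm_of_nonneg (by positivity), inv_pow, sq_sqrt hn.le]
  set s₀ : Fin N → Fin q := fun _ => ⟨0, hq⟩ with hs₀
  have hsw : ∀ (i j : Fin N) σ, σ ∘ Equiv.swap i j = s₀ ↔ σ = s₀ := by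
    intro i j σ
    constructor
    · intro h
      funext k
      have := congrFun h (Equiv.swap i j k)
      simpa [hs₀] using this
    · rintro rfl
      rfl
  have hdf : Differentiable ℝ f := hf.smooth.differentiable (by simp)
  refine ⟨fun X σ => if σ = s₀ then c * f X else 0, ⟨?_, ?_, ?_, ?_⟩, ?_⟩
  · intro σ
    by_cases h : σ = s₀
    · simp only [h, if_true]
      exact contDiff_const.mul hf.smooth
    · simp only [h, if_false]
      exact contDiff_const
  · intro σ
    by_cases h : σ = s₀
    · simp only [h, if_true]
      exact (tsupport_mul_subset_right (f := fun _ => c) (g := f)).trans hf.supp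
    · simp only [h, if_false]
      have : tsupport (fun _ : Fin N → R3 => (0:ℂ)) = ∅ := tsupport_eq_empty_iff.2 rfl
      rw [this]
      exact Set.empty_subset _
  · intro i j hij X σ
    simp only [hsw]
    split_ifs
    · rw [hfdef, slater_swap hij, mul_neg]
    · rw [neg_zero]
  · rw [Finset.sum_eq_single s₀]
    · simp only [if_true, norm_mul, mul_pow, integral_const_mul]
      rw [hc2, ← hndef, inv_mul_cancel₀ hn.ne']
    · intro σ _ h
      simp [h]
    · simp
  · rw [energyForm_eq_sum_configEnergy, Finset.sum_eq_single s₀]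
    · simp only [if_true]
      have e1 : configEnergy v (fun X => c * f X) = ∫ X, n⁻¹ * ∑ i, gradSqAt f i X := by
        refine integral_congr_ae (.of_forall fun X => ?_)
        have h2 : (∑ i, ∑ j, if i < j then v (X i - X j) * ‖c * f X‖ ^ 2 else 0) = 0 := by
          refine Finset.sum_eq_zero fun i _ => Finset.sum_eq_zero fun j _ => ?_
          split_ifs with hij
          · have := slater_interaction_eq_zero hv hs hsep hij.ne X
            rw [norm_mul, mul_pow, mul_left_comm, ← hfdef] at *
            rw [this, mul_zero]
          · rfl
        simp only
        rw [h2, add_zero, Finset.mul_sum]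
        refine Finset.sum_congr rfl fun i _ => ?_
        have hd : Differentiable ℝ (slice f i X) := (hf.smooth_slice i X).differentiable (by simp)
        have := gradSq_const_mul hd c (X i)
        rw [hc2] at this
        exact this
      rw [e1, integral_const_mul, integral_finsetSum _ fun i _ => hf.integrable_gradSqAt i]
      have e2 : ∀ i, ∫ X, gradSqAt f i X = (∫ y, gradSq g y) / (∫ y, ‖g y‖ ^ 2) * n := by
        intro i
        have := integral_gradSqAt_slater hg hs hp hL hsep' i
        rw [← hfdef, ← hndef] at this
        field_simp
        linarith
      simp only [e2, Finset.sum_const, Finset.card_univ, Fintype.card_fin, nsmul_eq_mul]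
      field_simp
    · intro σ _ h
      simp [h, configEnergy, gradSq]
    · simp

theorem IsFermionicState.isTest {N q : ℕ} {L : ℝ} {Ψ : (Fin N → R3) → (Fin N → Fin q) → ℂ}
    (h : IsFermionicState N q L Ψ) (σ : Fin N → Fin q) : IsTest L fun X => Ψ X σ :=
  ⟨h.1 σ, h.2.1 σ⟩

theorem IsFermionicState.swap_eq_neg {N q : ℕ} {L : ℝ}
    {Ψ : (Fin N → R3) → (Fin N → Fin q) → ℂ} (h : IsFermionicState N q L Ψ)
    {σ : Fin N → Fin q} {i k : Fin N} (hik : i ≠ k) (hσ : σ i = σ k) (X : Fin N → R3) :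
    Ψ (X ∘ Equiv.swap i k) σ = -Ψ X σ := by
  have e : σ ∘ Equiv.swap i k = σ := by
    funext m
    rw [Function.comp_apply, Equiv.swap_apply_def]
    split_ifs with h1 h2
    · rw [h1, hσ]
    · rw [h2, hσ]
    · rfl
  have := h.2.2.1 i k hik X σ
  rwa [e] at this

/-- Lower bound for the ground state energy in terms of the density. -/
theorem IsScatteringSolution.groundEnergy_ge {v φ : R3 → ℝ} {R0 a : ℝ}
    (h : IsScatteringSolution v φ R0 a) (hvs : ∀ x, v (-x) = v x) {q : ℕ} (hq : 1 ≤ q)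
    {θ x : ℝ} (hθ : 0 < θ) (hθ1 : θ ≤ 1 / 20) (hx : 0 < x) (hax : a * x ≤ θ ^ 18)
    (hRx : R0 * x ≤ θ ^ 2) (hRx' : 4 * π * R0 * x ≤ θ) :
    ∃ T : ℝ, 0 < T ∧ ∀ {N : ℕ} {L : ℝ}, 0 < L → N ≤ (L + 2 * T) ^ 3 * x ^ 3 →
      (∃ Ψ, IsFermionicState N q L Ψ) →
      ∀ {l : ℝ}, 0 ≤ l → (L + 2 * T) ^ 3 * (q * (4 / 3 * π * l ^ 3)) = N →
      (L + 2 * T) ^ 3 * (q * (16 * π ^ 3 / 5) * l ^ 5 +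
        4 * π * a * (1 - 1 / q) * (N / (L + 2 * T) ^ 3) ^ 2 -
        errorConst q * a * θ * x ^ 6) / (1 + 8 * q * a * x * θ ^ 2 / π) ≤
      groundEnergy N q L v := by
  obtain ⟨T, hT, H⟩ := h.configEnergy_ge hvs hq hθ hθ1 hx hax hRx hRx'
  refine ⟨T, hT, fun {N L} hL hN ⟨Ψ₀, hΨ₀⟩ {l} hl hlN => ?_⟩
  have a0 := h.length_nonneg
  have hp := pi_pos
  refine le_csInf ⟨_, Ψ₀, hΨ₀, rfl⟩ ?_
  rintro E ⟨Ψ, hΨ, rfl⟩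
  rw [div_le_iff₀ (by positivity), mul_comm (energyForm _ _ _ _), energyForm_eq_sum_configEnergy,
    Finset.mul_sum]
  have := Finset.sum_le_sum fun σ (_ : σ ∈ (Finset.univ : Finset (Fin N → Fin q))) =>
    H hL hN hl hlN σ (hΨ.isTest σ) fun i k hik hσ X => hΨ.swap_eq_neg hik hσ X
  rw [← Finset.sum_mul, hΨ.2.2.2, one_mul] at this
  exact this

theorem groundEnergy_le {q : ℕ} (hq : 1 ≤ q) {v : R3 → ℝ} (hv0 : ∀ x, 0 ≤ v x) {r : ℝ}
    (hr : 0 < r) (hv : ∀ x : R3, r < ‖x‖ → v x = 0) : ∃ K : ℝ, ∀ {N : ℕ} {L : ℝ}, 0 < L →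
      (N : ℝ) ≤ (L / (4 * r) - 1) ^ 3 → 1 ≤ L / (4 * r) →
      (∃ Ψ, IsFermionicState N q L Ψ) ∧ groundEnergy N q L v ≤ N * K := by
  obtain ⟨K, hK⟩ := exists_fermionicState hq hr hv
  refine ⟨K, fun {N L} hL hN hL1 => ?_⟩
  obtain ⟨Ψ, hΨ, hE⟩ := hK hL hN hL1
  refine ⟨⟨Ψ, hΨ⟩, csInf_le ⟨0, ?_⟩ ⟨Ψ, hΨ, hE⟩⟩
  rintro E ⟨Ψ', -, rfl⟩
  refine Finset.sum_nonneg fun σ _ => integral_nonneg fun X => ?_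
  refine add_nonneg (Finset.sum_nonneg fun i _ => Finset.sum_nonneg fun j _ => by positivity) ?_
  refine Finset.sum_nonneg fun i _ => Finset.sum_nonneg fun j _ => ?_
  split_ifs
  · exact mul_nonneg (hv0 _) (by positivity)
  · exact le_rfl

theorem fermi_energy_eq {q : ℕ} (hq : 1 ≤ q) {ρ : ℝ} (hρ : 0 < ρ) :
    q * (16 * π ^ 3 / 5) * ((3 / (4 * π * q) * ρ) ^ ((1:ℝ) / 3)) ^ 5 =
      (3/5) * (6 * π ^ 2 / q) ^ ((2:ℝ)/3) * ρ ^ ((5:ℝ)/3) := by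
  have hp := pi_pos
  have hq0 : (0:ℝ) < q := by exact_mod_cast hq
  set b := 3 / (4 * π * (q:ℝ)) with hb
  have b0 : 0 < b := by positivity
  have e1 : ((b * ρ) ^ ((1:ℝ) / 3)) ^ 5 = b ^ ((5:ℝ)/3) * ρ ^ ((5:ℝ)/3) := by
    rw [← rpow_natCast, ← rpow_mul (by positivity), mul_rpow b0.le hρ.le]
    norm_num
  have e2 : b ^ ((5:ℝ)/3) = b * b ^ ((2:ℝ)/3) := by
    rw [show (5:ℝ)/3 = 1 + 2/3 by norm_num, rpow_add b0, rpow_one]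
  have e3 : (6 * π ^ 2 / q) ^ ((2:ℝ)/3) = 4 * π ^ 2 * b ^ ((2:ℝ)/3) := by
    have : 6 * π ^ 2 / q = (2 * π) ^ (3:ℝ) * b := by
      rw [hb]
      norm_cast
      field_simp
      ring
    rw [this, mul_rpow (by positivity) b0.le, ← rpow_mul (by positivity),
      show (3:ℝ) * (2 / 3) = 2 by norm_num, rpow_two]
    ring
  rw [e1, e2, e3, hb]
  field_simp
  ring

theorem tendsto_density {ρ T : ℝ} (hρ : 0 ≤ ρ) :
    Tendsto (fun L : ℝ => (⌊ρ * L ^ 3⌋₊ : ℝ) / (L + 2 * T) ^ 3) atTop (nhds ρ) ∧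
      Tendsto (fun L : ℝ => (L + 2 * T) ^ 3 / L ^ 3) atTop (nhds 1) := by
  have h3 : Tendsto (fun L : ℝ => L ^ 3) atTop atTop := tendsto_pow_atTop three_ne_zero
  have h1 := (tendsto_nat_floor_mul_div_atTop hρ).comp h3
  have h2 : Tendsto (fun L : ℝ => (L + 2 * T) ^ 3 / L ^ 3) atTop (nhds 1) := by
    have h4 : Tendsto (fun L : ℝ => (1 + 2 * T / L) ^ 3) atTop (nhds ((1 + 0) ^ 3)) :=
      ((tendsto_const_nhds.add (tendsto_const_nhds.div_atTop tendsto_id))).pow 3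
    rw [add_zero, one_pow] at h4
    refine h4.congr' ?_
    filter_upwards [eventually_gt_atTop 0] with L hL
    field_simp
  refine ⟨?_, h2⟩
  have h5 := h1.div h2 one_ne_zero
  rw [div_one] at h5
  refine h5.congr' ?_
  filter_upwards [eventually_gt_atTop 0] with L hL
  have : L ^ 3 ≠ 0 := by positivity
  simp only [Pi.div_apply, Function.comp_apply]
  rw [div_div_div_cancel_right₀ this]

theorem sub_error_le_div {P E ξ : ℝ} (hP : 0 ≤ P) (hE : 0 ≤ E) (hξ : 0 ≤ ξ) :
    P - E - ξ * P ≤ (P - E) / (1 + ξ) := by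
  rw [le_div_iff₀ (by positivity)]
  nlinarith [mul_nonneg hξ hE, mul_nonneg (mul_nonneg hξ hξ) hP]

/-- The limiting lower bound with explicit error terms. -/
theorem IsScatteringSolution.liminf_groundEnergy_ge {v φ : R3 → ℝ} {R0 a : ℝ}
    (h : IsScatteringSolution v φ R0 a) (hvs : ∀ x, v (-x) = v x) {q : ℕ} (hq : 1 ≤ q)
    {θ x ρ : ℝ} (hθ : 0 < θ) (hθ1 : θ ≤ 1 / 20) (hx : 0 < x) (hax : a * x ≤ θ ^ 18)
    (hRx : R0 * x ≤ θ ^ 2) (hRx' : 4 * π * R0 * x ≤ θ) (hρ : x ^ 3 = ρ) :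
    ((3/5) * (6 * π ^ 2 / q) ^ ((2:ℝ)/3) * ρ ^ ((5:ℝ)/3) + 4 * π * a * (1 - 1/q) * ρ ^ 2 -
      errorConst q * a * θ * x ^ 6) / (1 + 8 * q * a * x * θ ^ 2 / π) ≤
    liminf (fun L : ℝ => groundEnergy (⌊ρ * L ^ 3⌋₊) q L v / L ^ 3) atTop := by
  have hp := pi_pos
  have hp3 := pi_gt_three
  have r0 := h.R0_pos
  have hρ0 : 0 < ρ := by rw [← hρ]; positivity
  have hq0 : (0:ℝ) < q := by exact_mod_cast hq
  obtain ⟨T, hT, H⟩ := h.groundEnergy_ge hvs hq hθ hθ1 hx hax hRx hRx'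
  obtain ⟨K, hK⟩ := groundEnergy_le hq h.nonneg r0 h.supp
  obtain ⟨t1, t2⟩ := tendsto_density (T := T) hρ0.le
  set D : ℝ → ℝ := fun L => (⌊ρ * L ^ 3⌋₊ : ℝ) / (L + 2 * T) ^ 3 with hD
  set l : ℝ → ℝ := fun L => (3 / (4 * π * q) * D L) ^ ((1:ℝ) / 3) with hl
  have tl : Tendsto l atTop (nhds ((3 / (4 * π * q) * ρ) ^ ((1:ℝ) / 3))) :=
    (t1.const_mul _).rpow_const (Or.inr (by norm_num))
  have tW : Tendsto (fun L : ℝ => (L + 2 * T) ^ 3 / L ^ 3 * ((q * (16 * π ^ 3 / 5) * l L ^ 5 +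
      4 * π * a * (1 - 1 / q) * D L ^ 2 - errorConst q * a * θ * x ^ 6) /
        (1 + 8 * q * a * x * θ ^ 2 / π))) atTop
      (nhds (1 * ((q * (16 * π ^ 3 / 5) * ((3 / (4 * π * q) * ρ) ^ ((1:ℝ) / 3)) ^ 5 +
      4 * π * a * (1 - 1 / q) * ρ ^ 2 - errorConst q * a * θ * x ^ 6) /
        (1 + 8 * q * a * x * θ ^ 2 / π)))) :=
    t2.mul (((((tl.pow 5).const_mul _).add ((t1.pow 2).const_mul _)).sub_const _).div_const _)
  rw [one_mul, fermi_energy_eq hq hρ0] at tW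
  have key : ∀ᶠ L : ℝ in atTop, 0 < L ∧ (⌊ρ * L ^ 3⌋₊ : ℝ) ≤ ρ * L ^ 3 ∧
      (∃ Ψ, IsFermionicState ⌊ρ * L ^ 3⌋₊ q L Ψ) ∧
      groundEnergy ⌊ρ * L ^ 3⌋₊ q L v ≤ ⌊ρ * L ^ 3⌋₊ * K := by
    filter_upwards [eventually_ge_atTop (8 * R0)] with L hL
    have hL0 : 0 < L := by linarith
    have hfl : (⌊ρ * L ^ 3⌋₊ : ℝ) ≤ ρ * L ^ 3 := Nat.floor_le (by positivity)
    have hu : L = L / (4 * R0) * (4 * R0) := by field_simp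
    set u := L / (4 * R0) with hudef
    have hu2 : 2 ≤ u := by rw [hudef, le_div_iff₀ (by positivity)]; linarith
    have hRx2 : 8 * R0 * x ≤ 1 := by
      have : 0 < R0 * x := by positivity
      nlinarith
    have hxL : x * L ≤ u - 1 := by
      rw [hu]
      nlinarith
    refine ⟨hL0, hfl, hK hL0 ?_ (by linarith)⟩
    refine hfl.trans ?_
    rw [← hρ, ← mul_pow]
    exact pow_le_pow_left₀ (by positivity) hxL 3
  rw [← tW.liminf_eq]
  refine liminf_le_liminf ?_ tW.isBoundedUnder_ge ?_
  · filter_upwards [key] with L ⟨hL0, hfl, hne, _⟩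
    have hV : 0 < (L + 2 * T) ^ 3 := by positivity
    have hN : (⌊ρ * L ^ 3⌋₊ : ℝ) ≤ (L + 2 * T) ^ 3 * x ^ 3 := by
      refine hfl.trans ?_
      rw [hρ, mul_comm]
      exact mul_le_mul_of_nonneg_right (pow_le_pow_left₀ hL0.le (by linarith) 3) hρ0.le
    have hD0 : 0 ≤ D L := by positivity
    have hl0 : 0 ≤ l L := by positivity
    have hl3 : l L ^ 3 = 3 / (4 * π * q) * D L := by
      rw [hl]
      simp only
      rw [← rpow_natCast, ← rpow_mul (by positivity)]
      norm_num
    have hlN : (L + 2 * T) ^ 3 * (q * (4 / 3 * π * l L ^ 3)) = (⌊ρ * L ^ 3⌋₊ : ℝ) := by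
      rw [hl3, hD]
      field_simp
    have := H hL0 hN hne hl0 hlN
    rw [le_div_iff₀ (by positivity)]
    refine le_trans (le_of_eq ?_) this
    have : L ^ 3 ≠ 0 := by positivity
    rw [div_mul_eq_mul_div, div_mul_cancel₀ _ this, ← mul_div_assoc]
  · have hb : IsBoundedUnder (· ≤ ·) atTop
        (fun L : ℝ => groundEnergy (⌊ρ * L ^ 3⌋₊) q L v / L ^ 3) := by
      refine isBoundedUnder_of_eventually_le (a := ρ * |K|) ?_
      filter_upwards [key] with L ⟨hL0, hfl, _, hE⟩
      rw [div_le_iff₀ (by positivity)]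
      calc _ ≤ (⌊ρ * L ^ 3⌋₊ : ℝ) * K := hE
        _ ≤ (⌊ρ * L ^ 3⌋₊ : ℝ) * |K| := mul_le_mul_of_nonneg_left (le_abs_self K) (Nat.cast_nonneg _)
        _ ≤ ρ * L ^ 3 * |K| := mul_le_mul_of_nonneg_right hfl (abs_nonneg K)
        _ = ρ * |K| * L ^ 3 := by ring
    exact hb.isCoboundedUnder_ge

theorem dilute_fermi_gas_lower_bound
    (q : ℕ) (hq : 1 ≤ q)
    (v φ : R3 → ℝ) (R0 a : ℝ) (hR0 : 0 < R0)
    (hv_meas : Measurable v)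
    (hv_nonneg : ∀ x, 0 ≤ v x)
    (hv_bdd : ∃ C, ∀ x, v x ≤ C)
    (hv_radial : ∀ x y : R3, ‖x‖ = ‖y‖ → v x = v y)
    (hv_supp : ∀ x : R3, R0 < ‖x‖ → v x = 0)
    (hφ_C1 : ContDiff ℝ 1 φ)
    (hφ_nonneg : ∀ x, 0 ≤ φ x)
    (hφ_le_one : ∀ x, φ x ≤ 1)
    (hφ_eq : ∀ x : R3, R0 ≤ ‖x‖ → φ x = 1 - a / ‖x‖)
    (hφ_scatt : ∀ g : R3 → ℝ, ContDiff ℝ (⊤ : ℕ∞) g → HasCompactSupport g →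
      (∫ x : R3, ⟪gradient φ x, gradient g x⟫) + (1/2) * ∫ x : R3, v x * φ x * g x = 0) :
    ∀ ε > (0:ℝ), ∃ ρ₀ > (0:ℝ), ∀ ρ : ℝ, 0 < ρ → ρ < ρ₀ →
      (3/5) * (6 * π ^ 2 / q) ^ ((2:ℝ)/3) * ρ ^ ((5:ℝ)/3)
          + 4 * π * (1 - 1/q) * a * ρ ^ 2 - ε * ρ ^ 2 ≤
        liminf (fun L : ℝ => groundEnergy (⌊ρ * L ^ 3⌋₊) q L v / L ^ 3) atTop := by
  have h : IsScatteringSolution v φ R0 a := ⟨hR0, hv_meas, hv_nonneg, hv_bdd, hv_supp, hφ_C1,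
    hφ_nonneg, hφ_le_one, hφ_eq, hφ_scatt⟩
  have hvs : ∀ x, v (-x) = v x := fun x => hv_radial _ _ (norm_neg x)
  have a0 := h.length_nonneg
  have hp := pi_pos
  have hq1 : (1:ℝ) ≤ q := by exact_mod_cast hq
  have hq0 : (0:ℝ) < q := by linarith
  have hqi : 0 ≤ 1 - 1 / (q:ℝ) := by
    rw [sub_nonneg, div_le_one hq0]
    exact hq1
  have he0 := errorConst_nonneg q
  intro ε hε
  set A := (3/5) * (6 * π ^ 2 / q) ^ ((2:ℝ)/3) with hA
  set B := 4 * π * a * (1 - 1 / q) with hB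
  have A0 : 0 ≤ A := by positivity
  have B0 : 0 ≤ B := mul_nonneg (by positivity) hqi
  set M := errorConst q * a + 8 * q * a / π * (A + B) with hM
  have M0 : 0 ≤ M := by positivity
  set θ := min (1 / 20) (ε / (M + 1)) with hθ
  have θ0 : 0 < θ := lt_min (by norm_num) (by positivity)
  have θ1 : θ ≤ 1 / 20 := min_le_left _ _
  have hθM : M * θ ≤ ε := by
    have h1 : θ ≤ ε / (M + 1) := min_le_right _ _
    rw [le_div_iff₀ (by positivity)] at h1
    linarith
  set x₀ := min (min 1 (θ ^ 18 / (a + 1))) (min (θ ^ 2 / R0) (θ / (4 * π * R0))) with hx₀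
  have x₀0 : 0 < x₀ := by
    refine lt_min (lt_min one_pos ?_) (lt_min ?_ ?_) <;> positivity
  refine ⟨x₀ ^ 3, by positivity, fun ρ hρ hρx => ?_⟩
  set x := ρ ^ ((1:ℝ) / 3) with hx
  have x0 : 0 < x := by positivity
  have hx3 : x ^ 3 = ρ := by
    rw [hx, ← rpow_natCast, ← rpow_mul hρ.le]
    norm_num
  have hx5 : x ^ 5 = ρ ^ ((5:ℝ) / 3) := by
    rw [hx, ← rpow_natCast, ← rpow_mul hρ.le]
    norm_num
  have hxx : x < x₀ := by
    rw [← hx3] at hρx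
    exact lt_of_pow_lt_pow_left₀ 3 x₀0.le hρx
  have l1 : x ≤ 1 := hxx.le.trans ((min_le_left _ _).trans (min_le_left _ _))
  have l2 : x ≤ θ ^ 18 / (a + 1) := hxx.le.trans ((min_le_left _ _).trans (min_le_right _ _))
  have l3 : x ≤ θ ^ 2 / R0 := hxx.le.trans ((min_le_right _ _).trans (min_le_left _ _))
  have l4 : x ≤ θ / (4 * π * R0) := hxx.le.trans ((min_le_right _ _).trans (min_le_right _ _))
  rw [le_div_iff₀ (by positivity)] at l2 l3 l4
  refine le_trans ?_ (h.liminf_groundEnergy_ge hvs hq θ0 θ1 x0 (by linarith) (by linarith)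
    (by linarith) hx3)
  rw [← hA, ← hB, ← hx5, ← hx3]
  have P0 : 0 ≤ A * x ^ 5 + B * (x ^ 3) ^ 2 := by positivity
  refine le_trans ?_ (sub_error_le_div P0 (by positivity) (by positivity))
  have hP : A * x ^ 5 + B * (x ^ 3) ^ 2 ≤ (A + B) * x ^ 5 := by
    have h1 : (x ^ 3) ^ 2 ≤ x ^ 5 := by
      rw [← pow_mul]
      exact pow_le_pow_of_le_one x0.le l1 (by norm_num)
    linarith [mul_le_mul_of_nonneg_left h1 B0]
  have hξ : 8 * q * a * x * θ ^ 2 / π * (A * x ^ 5 + B * (x ^ 3) ^ 2) ≤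
      8 * q * a / π * (A + B) * θ * x ^ 6 := by
    have h2 : θ ^ 2 ≤ θ := by nlinarith
    calc _ ≤ 8 * q * a * x * θ ^ 2 / π * ((A + B) * x ^ 5) :=
          mul_le_mul_of_nonneg_left hP (by positivity)
      _ = 8 * q * a / π * (A + B) * x ^ 6 * θ ^ 2 := by ring
      _ ≤ 8 * q * a / π * (A + B) * x ^ 6 * θ := mul_le_mul_of_nonneg_left h2 (by positivity)
      _ = _ := by ring
  have hfin : M * θ * x ^ 6 ≤ ε * x ^ 6 := mul_le_mul_of_nonneg_right hθM (by positivity)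
  have e1 : M * θ * x ^ 6 =
      errorConst q * a * θ * x ^ 6 + 8 * q * a / π * (A + B) * θ * x ^ 6 := by rw [hM]; ring
  have e2 : 4 * π * (1 - 1 / (q:ℝ)) * a = B := by rw [hB]; ring
  have e3 : (x ^ 3) ^ 2 = x ^ 6 := by ring
  rw [e2]
  rw [e3] at hξ ⊢
  linarith
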